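/- Let λₙ∈(0,1] with λₙ→0. Let χ, b∈C_c^∞(ℝ³;ℝ), let m̃:ℝ³→ℝ be an even real symbol of order 0, and set A = b·m̃((1/i)∇). Let K⊂ℝ³ be compact with supp χ contained in the interior of K, and c>0. Let ψₙ, Nₙ, βₙ=(βₙ¹,βₙ²), γₙ be C⁴ real functions on ℝ³ and ψ₀, N₀, β₀, γ₀ smooth, with Nₙ, N₀ > 0 everywhere and Nₙ, N₀ ≥ c on K. Write (e₀)ₙ = ∂_t−βₙⁱ∂_i and (e₀)₀ = ∂_t−β₀ⁱ∂_i. Assume: sup_n λₙ^{−1}(‖ψₙ−ψ₀‖_{L^∞(K)}+‖Nₙ−N₀‖_{L^∞(K)}+‖βₙ−β₀‖_{L^∞(K)}+‖γₙ−γ₀‖_{L^∞(K)}) < ∞; sup_n(‖∂ψₙ‖_{L^∞(K)}+‖∂Nₙ‖_{L^∞(K)}+‖∂βₙ‖_{L^∞(K)}+‖∂γₙ‖_{L^∞(K)}) < ∞; and sup_n λₙ^{−1/2}‖∂(γₙ−γ₀)‖_{L^∞(K)} < ∞ (full spacetime gradient). Then ∫_{ℝ³} [(e₀)ₙ(χψₙ)/Nₙ]·{∂_t[e^{2γₙ}·A((e₀)ₙ(χψₙ)/Nₙ)]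 − A(∂_t[e^{2γₙ}·((e₀)ₙ(χψₙ)/Nₙ)])} dx − ∫_{ℝ³} [(e₀)₀(χψₙ)/N₀]·{∂_t[e^{2γ₀}·A((e₀)₀(χψₙ)/N₀)] − A(∂_t[e^{2γ₀}·((e₀)₀(χψₙ)/N₀)])} dx → 0 as n→∞. -/

import Mathlib

open MeasureTheory Real Filter
open scoped ENNReal

noncomputable section

abbrev E3 : Type := Fin 3 → ℝ

/-- Partial derivative in coordinate direction `α` (direction `0` is time, `1`, `2` spatial). -/
noncomputable def pd (α : Fin 3) (f : E3 → ℝ) (x : E3) : ℝ :=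
  fderiv ℝ f x (Pi.single α 1)

/-- Iterated partial derivatives along a list of directions. -/
noncomputable def pds : List (Fin 3) → (E3 → ℝ) → E3 → ℝ
  | [], f => f
  | α :: l, f => pd α (pds l f)

/-- The spatial indices `1, 2` of `Fin 3`. -/
def sp : Fin 2 → Fin 3 := ![1, 2]

/-- The vector field `(e₀) = ∂_t − βⁱ∂_i` applied to `f`. -/
noncomputable def e0 (b : Fin 2 → E3 → ℝ) (f : E3 → ℝ) (x : E3) : ℝ :=
  pd 0 f x - (b 0 x * pd 1 f x + b 1 x * pd 2 f x)

/-- Fourier transform with the normalization `f̂(ξ) = (2π)^{−3/2} ∫ e^{−i x·ξ} f(x) dx`. -/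
noncomputable def FT (f : E3 → ℂ) (ξ : E3) : ℂ :=
  (((2 * Real.pi) ^ (-(3 : ℝ) / 2) : ℝ) : ℂ) *
    ∫ x : E3, Complex.exp (-Complex.I * ((∑ α, x α * ξ α : ℝ) : ℂ)) * f x

/-- The Fourier multiplier `m̃((1/i)∇)`, defined via the inversion formula, so that
`(m̃((1/i)∇)f)^ = m̃ · f̂`. -/
noncomputable def FMul (m : E3 → ℝ) (f : E3 → ℝ) (x : E3) : ℂ :=
  (((2 * Real.pi) ^ (-(3 : ℝ) / 2) : ℝ) : ℂ) *
    ∫ ξ : E3, Complex.exp (Complex.I * ((∑ α, x α * ξ α : ℝ) : ℂ)) * ((m ξ : ℝ) : ℂ)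
      * FT (fun y => ((f y : ℝ) : ℂ)) ξ

/-- A symbol of order 0: all derivatives of order `k` decay like `(1+|ξ|)^{−k}`. -/
def SymbolOrder0 (m : E3 → ℝ) : Prop :=
  ContDiff ℝ (⊤ : ℕ∞) m ∧
  ∀ l : List (Fin 3), ∃ C : ℝ, ∀ ξ, |pds l m ξ| ≤ C * (1 + ‖ξ‖) ^ (-(l.length : ℝ))

/-- Partial derivative of a complex-valued function in coordinate direction `α`. -/
noncomputable def pdC (α : Fin 3) (f : E3 → ℂ) (x : E3) : ℂ :=
  fderiv ℝ f x (Pi.single α 1)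

open scoped FourierTransform ContDiff in
theorem Lp.fourier_toLp_ae_eq {V : Type*} [NormedAddCommGroup V] [InnerProductSpace ℝ V]
    [FiniteDimensional ℝ V] [MeasurableSpace V] [BorelSpace V] {f : V → ℂ}
    (h1 : Integrable f) (h2 : MemLp f 2) :
    (𝓕 (h2.toLp f) : Lp ℂ 2 (volume : Measure V)) =ᵐ[volume] 𝓕 f := by
  have hc : Continuous (𝓕 f) :=
    VectorFourier.fourierIntegral_continuous Real.continuous_fourierChar
      (by exact continuous_inner) h1
  refine ae_eq_of_integral_contDiff_smul_eq ?_ hc.locallyIntegrable ?_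
  · exact (Lp.memLp _).locallyIntegrable (by norm_num)
  intro g hg hgc
  have hgC : ContDiff ℝ ∞ (fun x => (g x : ℂ)) := Complex.ofRealCLM.contDiff.comp hg
  have hgcC : HasCompactSupport (fun x => (g x : ℂ)) := hgc.comp_left (g := fun r : ℝ => (r : ℂ)) rfl
  let G : SchwartzMap V ℂ := hgcC.toSchwartzMap hgC
  have hG : ∀ x, G x = (g x : ℂ) := fun x => rfl
  have key := congrArg (fun T => T G) (Lp.fourier_toTemperedDistribution_eq (h2.toLp f))
  simp only [TemperedDistribution.fourier_apply] at key
  rw [Lp.toTemperedDistribution_apply, Lp.toTemperedDistribution_apply] at key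
  have e1 : ∫ x, g x • (𝓕 (h2.toLp f) : Lp ℂ 2 (volume : Measure V)) x
      = ∫ x, G x • (𝓕 (h2.toLp f) : Lp ℂ 2 (volume : Measure V)) x := by
    refine integral_congr_ae (Eventually.of_forall fun x => ?_)
    simp [hG]
  have e2 : ∫ x, g x • 𝓕 f x = ∫ x, G x • 𝓕 f x := by
    refine integral_congr_ae (Eventually.of_forall fun x => ?_)
    simp [hG]
  rw [e1, e2, ← key]
  have e3 : ∫ x, (𝓕 G) x • (h2.toLp f) x = ∫ x, (𝓕 (G : V → ℂ)) x • f x := by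
    refine integral_congr_ae ?_
    filter_upwards [h2.coeFn_toLp] with x hx
    rw [hx, SchwartzMap.fourier_coe]
  rw [e3]
  have := VectorFourier.integral_fourierIntegral_smul_eq_flip (μ := (volume : Measure V))
    (ν := (volume : Measure V)) (L := innerₗ V)
    (f := (G : V → ℂ)) (g := f) Real.continuous_fourierChar
    (by exact continuous_inner) G.integrable h1
  simpa using! this

/-- The normalization constant `(2π)^{-3/2}` of the Fourier transform. -/
def fourierConst : ℝ := (2 * Real.pi) ^ (-(3 : ℝ) / 2)

/-- The phase `e^{i x·ξ}`. -/
def phase (x ξ : E3) : ℂ := Complex.exp (Complex.I * ((∑ α, x α * ξ α : ℝ) : ℂ))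

/-- The inverse Fourier transform `(2π)^{-3/2} ∫ e^{i x·ξ} X(ξ) dξ`. -/
def IF (X : E3 → ℂ) (x : E3) : ℂ := (fourierConst : ℂ) * ∫ ξ : E3, phase x ξ * X ξ

/-- Functions that are both integrable and square integrable. -/
structure L12 (X : E3 → ℂ) : Prop where
  int : Integrable X
  sq : MemLp X 2

theorem fourierConst_pos : 0 < fourierConst := by
  unfold fourierConst; positivity

theorem fourierConst_sq : fourierConst ^ 2 * (2 * Real.pi) ^ 3 = 1 := by
  unfold fourierConst
  rw [← Real.rpow_natCast, ← Real.rpow_mul (by positivity), ← Real.rpow_natCast,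
    ← Real.rpow_add (by positivity)]
  norm_num

theorem norm_phase (x ξ : E3) : ‖phase x ξ‖ = 1 := by
  unfold phase
  rw [mul_comm]; exact Complex.norm_exp_ofReal_mul_I _

theorem phase_comm (x ξ : E3) : phase x ξ = phase ξ x := by
  unfold phase; simp only [mul_comm]

theorem phase_add_right (x ξ ζ : E3) : phase x (ξ + ζ) = phase x ξ * phase x ζ := by
  unfold phase
  rw [← Complex.exp_add, ← mul_add, ← Complex.ofReal_add, ← Finset.sum_add_distrib]
  simp only [Pi.add_apply, mul_add]

theorem phase_add_left (x y ξ : E3) : phase (x + y) ξ = phase x ξ * phase y ξ := by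
  rw [phase_comm, phase_add_right, phase_comm ξ, phase_comm ξ]

theorem phase_neg_left (x ξ : E3) : phase (-x) ξ = (starRingEnd ℂ) (phase x ξ) := by
  unfold phase
  rw [← Complex.exp_conj]
  simp

theorem phase_neg_right (x ξ : E3) : phase x (-ξ) = (starRingEnd ℂ) (phase x ξ) := by
  rw [phase_comm, phase_neg_left, phase_comm]

theorem continuous_phase : Continuous (fun p : E3 × E3 => phase p.1 p.2) := by
  unfold phase; fun_prop

@[fun_prop]
theorem continuous_phase_right (x : E3) : Continuous (fun ξ => phase x ξ) := by
  unfold phase; fun_prop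

@[fun_prop]
theorem continuous_phase_left (ξ : E3) : Continuous (fun x => phase x ξ) := by
  unfold phase; fun_prop

theorem FT_eq_IF_neg (f : E3 → ℂ) (ξ : E3) : FT f ξ = IF f (-ξ) := by
  unfold FT IF fourierConst
  congr 2
  funext x
  rw [phase_neg_left, phase_comm, ← phase_neg_left, phase]
  simp

theorem FMul_eq (m f : E3 → ℝ) (x : E3) :
    FMul m f x = IF (fun ξ => (m ξ : ℂ) * FT (fun y => (f y : ℂ)) ξ) x := by
  unfold FMul IF fourierConst phase
  simp only [mul_assoc]

theorem norm_IF_le (X : E3 → ℂ) (x : E3) : ‖IF X x‖ ≤ fourierConst * ∫ ξ, ‖X ξ‖ := by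
  unfold IF
  rw [norm_mul, Complex.norm_real, Real.norm_of_nonneg fourierConst_pos.le]
  refine mul_le_mul_of_nonneg_left ?_ fourierConst_pos.le
  refine (norm_integral_le_integral_norm _).trans (le_of_eq ?_)
  simp [norm_phase]

theorem MeasureTheory.Integrable.phase_mul {X : E3 → ℂ} (hX : Integrable X) (x : E3) :
    Integrable (fun ξ => phase x ξ * X ξ) :=
  hX.bdd_mul (c := 1) (continuous_phase_right x).aestronglyMeasurable
    (Eventually.of_forall fun ξ => (norm_phase x ξ).le)

theorem continuous_IF {X : E3 → ℂ} (hX : Integrable X) : Continuous (IF X) := by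
  unfold IF
  refine continuous_const.mul (continuous_of_dominated (bound := fun ξ => ‖X ξ‖) ?_ ?_ hX.norm ?_)
  · exact fun x => (hX.phase_mul x).aestronglyMeasurable
  · exact fun x => Eventually.of_forall fun ξ => by simp [norm_phase]
  · exact Eventually.of_forall fun ξ => (continuous_phase_left ξ).mul continuous_const

section Euclidean
open scoped FourierTransform

theorem IF_eq_fourier (X : E3 → ℂ) (x : E3) :
    IF X x = fourierConst * 𝓕 (X ∘ WithLp.ofLp : EuclideanSpace ℝ (Fin 3) → ℂ)
      ((-(2 * Real.pi)⁻¹ : ℝ) • WithLp.toLp 2 x) := by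
  unfold IF
  rw [Real.fourier_eq']
  congr 1
  rw [← (EuclideanSpace.volume_preserving_symm_measurableEquiv_toLp (Fin 3)).integral_comp'
    (fun v : E3 => phase x v * X v)]
  refine integral_congr_ae (Eventually.of_forall fun v => ?_)
  simp only [Function.comp_apply, smul_eq_mul, phase]
  congr 2
  simp [PiLp.inner_apply, Fin.sum_univ_three]
  field_simp
  ring

theorem L12.comp_ofLp {X : E3 → ℂ} (hX : L12 X) :
    Integrable (X ∘ WithLp.ofLp : EuclideanSpace ℝ (Fin 3) → ℂ) ∧
      MemLp (X ∘ WithLp.ofLp : EuclideanSpace ℝ (Fin 3) → ℂ) 2 := by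
  have h := EuclideanSpace.volume_preserving_symm_measurableEquiv_toLp (Fin 3)
  exact ⟨(h.integrable_comp_emb (MeasurableEquiv.measurableEmbedding _)).2 hX.int,
    hX.sq.comp_measurePreserving h⟩

theorem memLp_IF {X : E3 → ℂ} (hX : L12 X) : MemLp (IF X) 2 := by
  obtain ⟨h1, h2⟩ := hX.comp_ofLp
  have h3 : MemLp (𝓕 (X ∘ WithLp.ofLp : EuclideanSpace ℝ (Fin 3) → ℂ)) 2 :=
    (memLp_congr_ae (Lp.fourier_toLp_ae_eq h1 h2)).1 (Lp.memLp _)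
  have hc : Continuous (IF X) := continuous_IF hX.int
  rw [memLp_two_iff_integrable_sq_norm hc.aestronglyMeasurable]
  rw [memLp_two_iff_integrable_sq_norm h3.1] at h3
  have h4 := (h3.comp_smul (R := (-(2 * Real.pi)⁻¹ : ℝ)) (by simp [Real.pi_ne_zero])).const_mul
    (fourierConst ^ 2)
  have h5 := ((EuclideanSpace.volume_preserving_symm_measurableEquiv_toLp (Fin 3)).symm.integrable_comp_emb
    (MeasurableEquiv.measurableEmbedding _)).2 h4
  refine h5.congr (Eventually.of_forall fun x => ?_)
  simp only [Function.comp_apply]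
  rw [IF_eq_fourier, norm_mul, Complex.norm_real, mul_pow, Real.norm_of_nonneg fourierConst_pos.le]
  rfl

theorem integral_IF_mul_conj {X Y : E3 → ℂ} (hX : L12 X) (hY : L12 Y) :
    ∫ x, IF X x * (starRingEnd ℂ) (IF Y x) = ∫ ξ, X ξ * (starRingEnd ℂ) (Y ξ) := by
  obtain ⟨h1, h2⟩ := hX.comp_ofLp
  obtain ⟨h1', h2'⟩ := hY.comp_ofLp
  have hp := EuclideanSpace.volume_preserving_symm_measurableEquiv_toLp (Fin 3)
  have key := Lp.inner_fourier_eq (h2'.toLp _) (h2.toLp _)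
  rw [MeasureTheory.L2.inner_def, MeasureTheory.L2.inner_def] at key
  have e1 : ∫ ξ, X ξ * (starRingEnd ℂ) (Y ξ) =
      ∫ a, inner ℂ ((h2'.toLp _ : Lp ℂ 2 (volume : Measure (EuclideanSpace ℝ (Fin 3)))) a)
        ((h2.toLp _ : Lp ℂ 2 (volume : Measure (EuclideanSpace ℝ (Fin 3)))) a) := by
    rw [← hp.integral_comp' (fun v : E3 => X v * (starRingEnd ℂ) (Y v))]
    refine integral_congr_ae ?_
    filter_upwards [h2.coeFn_toLp, h2'.coeFn_toLp] with x hx hx'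
    rw [hx, hx']
    simp
  rw [e1, ← key]
  have e2 : ∫ a, inner ℂ (𝓕 (h2'.toLp _ : Lp ℂ 2 (volume : Measure (EuclideanSpace ℝ (Fin 3)))) a)
        (𝓕 (h2.toLp _ : Lp ℂ 2 (volume : Measure (EuclideanSpace ℝ (Fin 3)))) a) =
      ∫ a, 𝓕 (X ∘ WithLp.ofLp : EuclideanSpace ℝ (Fin 3) → ℂ) a *
        (starRingEnd ℂ) (𝓕 (Y ∘ WithLp.ofLp : EuclideanSpace ℝ (Fin 3) → ℂ) a) := by
    refine integral_congr_ae ?_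
    filter_upwards [Lp.fourier_toLp_ae_eq h1 h2, Lp.fourier_toLp_ae_eq h1' h2'] with x hx hx'
    rw [hx, hx']
    simp
  rw [e2]
  have e3 := Measure.integral_comp_smul (volume : Measure (EuclideanSpace ℝ (Fin 3)))
    (fun a => 𝓕 (X ∘ WithLp.ofLp : EuclideanSpace ℝ (Fin 3) → ℂ) a *
        (starRingEnd ℂ) (𝓕 (Y ∘ WithLp.ofLp : EuclideanSpace ℝ (Fin 3) → ℂ) a))
    (-(2 * Real.pi)⁻¹ : ℝ)
  have e4 : |((-(2 * Real.pi)⁻¹ : ℝ) ^ Module.finrank ℝ (EuclideanSpace ℝ (Fin 3)))⁻¹|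
      = (2 * Real.pi) ^ 3 := by
    simp only [finrank_euclideanSpace, Fintype.card_fin, abs_inv, abs_pow, abs_neg]
    rw [abs_of_pos (by positivity), inv_pow, inv_inv]
  rw [e4] at e3
  have e5 : ∫ x, IF X x * (starRingEnd ℂ) (IF Y x) = (fourierConst ^ 2 : ℝ) •
      ∫ a, 𝓕 (X ∘ WithLp.ofLp : EuclideanSpace ℝ (Fin 3) → ℂ) ((-(2 * Real.pi)⁻¹ : ℝ) • a) *
        (starRingEnd ℂ) (𝓕 (Y ∘ WithLp.ofLp : EuclideanSpace ℝ (Fin 3) → ℂ)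
          ((-(2 * Real.pi)⁻¹ : ℝ) • a)) := by
    rw [← integral_smul, ← hp.integral_comp' (fun v : E3 => IF X v * (starRingEnd ℂ) (IF Y v))]
    refine integral_congr_ae (Eventually.of_forall fun x => ?_)
    have hx : WithLp.toLp 2 ((MeasurableEquiv.toLp 2 (Fin 3 → ℝ)).symm x) = x := rfl
    simp only [IF_eq_fourier, map_mul, Complex.conj_ofReal, Complex.real_smul, hx]
    push_cast
    ring
  rw [e5, e3, smul_smul, fourierConst_sq, one_smul]

end Euclidean

section Euclidean
open scoped FourierTransform

theorem IF_IF {f : E3 → ℂ} (hc : Continuous f) (hf : Integrable f) (hF : Integrable (IF f))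
    (x : E3) : IF (IF f) x = f (-x) := by
  have hp := EuclideanSpace.volume_preserving_symm_measurableEquiv_toLp (Fin 3)
  set f' : EuclideanSpace ℝ (Fin 3) → ℂ := f ∘ WithLp.ofLp with hf'
  have hr : (-(2 * Real.pi)⁻¹ : ℝ) ≠ 0 := by simp [Real.pi_ne_zero]
  have hcp : (fourierConst : ℂ) ≠ 0 := by exact_mod_cast fourierConst_pos.ne'
  have hIF : ∀ v : EuclideanSpace ℝ (Fin 3), IF f (WithLp.ofLp v)
      = fourierConst * 𝓕 f' ((-(2 * Real.pi)⁻¹ : ℝ) • v) := fun v => IF_eq_fourier f _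
  have h1 : Integrable f' :=
    (hp.integrable_comp_emb (MeasurableEquiv.measurableEmbedding _)).2 hf
  have h2 : Integrable (𝓕 f') := by
    have h3 : Integrable (fun v : EuclideanSpace ℝ (Fin 3) => IF f (WithLp.ofLp v)) :=
      (hp.integrable_comp_emb (MeasurableEquiv.measurableEmbedding _)).2 hF
    simp only [hIF] at h3
    have h4 := h3.const_mul ((fourierConst : ℂ)⁻¹)
    simp only [← mul_assoc, inv_mul_cancel₀ hcp, one_mul] at h4
    exact (integrable_comp_smul_iff volume (𝓕 f') hr).1 h4
  have h5 := Continuous.fourierInv_fourier_eq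
    (hc.comp (PiLp.continuous_ofLp 2 _) : Continuous f') h1 h2
  have h6 : f (-x) = 𝓕⁻ (𝓕 f') (WithLp.toLp 2 (-x)) := by rw [h5]; rfl
  rw [h6, Real.fourierInv_eq']
  have e3 := Measure.integral_comp_smul (volume : Measure (EuclideanSpace ℝ (Fin 3)))
    (fun v => Complex.exp (↑(2 * Real.pi * inner ℝ v (WithLp.toLp 2 (-x))) * Complex.I) • 𝓕 f' v)
    (-(2 * Real.pi)⁻¹ : ℝ)
  have e4 : |((-(2 * Real.pi)⁻¹ : ℝ) ^ Module.finrank ℝ (EuclideanSpace ℝ (Fin 3)))⁻¹|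
      = (2 * Real.pi) ^ 3 := by
    simp only [finrank_euclideanSpace, Fintype.card_fin, abs_inv, abs_pow, abs_neg]
    rw [abs_of_pos (by positivity), inv_pow, inv_inv]
  rw [e4] at e3
  have e5 : IF (IF f) x = (fourierConst ^ 2 : ℝ) • ∫ v : EuclideanSpace ℝ (Fin 3),
      Complex.exp (↑(2 * Real.pi * inner ℝ ((-(2 * Real.pi)⁻¹ : ℝ) • v) (WithLp.toLp 2 (-x)))
        * Complex.I) • 𝓕 f' ((-(2 * Real.pi)⁻¹ : ℝ) • v) := by
    rw [show IF (IF f) x = (fourierConst : ℂ) * ∫ ξ : E3, phase x ξ * IF f ξ from rfl,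
      ← hp.integral_comp' (fun v : E3 => phase x v * IF f v), ← integral_const_mul,
      ← integral_smul]
    refine integral_congr_ae (Eventually.of_forall fun v => ?_)
    have := hIF v
    change (fourierConst : ℂ) * (phase x (WithLp.ofLp v) * IF f (WithLp.ofLp v)) = _
    rw [this]
    have e6 : phase x (WithLp.ofLp v) = Complex.exp (↑(2 * Real.pi *
        inner ℝ ((-(2 * Real.pi)⁻¹ : ℝ) • v) (WithLp.toLp 2 (-x))) * Complex.I) := by
      unfold phase
      congr 1
      simp [PiLp.inner_apply, Fin.sum_univ_three]
      field_simp
    rw [e6]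
    simp only [Complex.real_smul, smul_eq_mul]
    push_cast
    ring
  rw [e5, e3, smul_smul, fourierConst_sq, one_smul]

end Euclidean

theorem IF_comp_neg (X : E3 → ℂ) (x : E3) : IF (fun ξ => X (-ξ)) x = IF X (-x) := by
  unfold IF
  congr 1
  rw [← integral_neg_eq_self]
  refine integral_congr_ae (Eventually.of_forall fun ξ => ?_)
  simp [phase_neg_left, phase_neg_right]

theorem IF_FT {f : E3 → ℂ} (hc : Continuous f) (hf : Integrable f) (hF : Integrable (FT f))
    (x : E3) : IF (FT f) x = f x := by
  have h1 : FT f = fun ξ => IF f (-ξ) := funext fun ξ => FT_eq_IF_neg f ξ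
  have h2 : Integrable (IF f) := by
    rw [h1] at hF
    simpa using hF.comp_neg
  rw [h1, IF_comp_neg, IF_IF hc hf h2, neg_neg]

theorem FT_IF {f : E3 → ℂ} (hc : Continuous f) (hf : Integrable f) (hF : Integrable (IF f))
    (x : E3) : FT (IF f) x = f x := by
  rw [FT_eq_IF_neg, IF_IF hc hf hF, neg_neg]

/-- The squared Euclidean norm. -/
def nsq (ξ : E3) : ℝ := ∑ i, ξ i ^ 2

theorem nsq_nonneg (ξ : E3) : 0 ≤ nsq ξ := Finset.sum_nonneg fun _ _ => sq_nonneg _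

@[fun_prop]
theorem continuous_nsq : Continuous nsq := by unfold nsq; fun_prop

/-- The Gaussian `e^{-τ|ξ|²}`. -/
def gauss (τ : ℝ) (ξ : E3) : ℝ := Real.exp (-τ * nsq ξ)

@[fun_prop]
theorem continuous_gauss (τ : ℝ) : Continuous (gauss τ) := by unfold gauss; fun_prop

theorem gauss_pos (τ : ℝ) (ξ : E3) : 0 < gauss τ ξ := Real.exp_pos _

theorem gauss_le_one {τ : ℝ} (hτ : 0 ≤ τ) (ξ : E3) : gauss τ ξ ≤ 1 :=
  Real.exp_le_one_iff.2 (by nlinarith [nsq_nonneg ξ])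

theorem ofReal_gauss (τ : ℝ) (ξ : E3) :
    (gauss τ ξ : ℂ) = Complex.exp (-(τ : ℂ) * ∑ i, (ξ i : ℂ) ^ 2 + ∑ i : Fin 3, (0 : ℂ) * ξ i) := by
  unfold gauss nsq; push_cast; simp

theorem integrable_gauss {τ : ℝ} (hτ : 0 < τ) : Integrable (gauss τ) := by
  have h := GaussianFourier.integrable_cexp_neg_mul_sum_add (ι := Fin 3) (b := (τ : ℂ)) (by simpa using hτ)
    (fun _ => 0)
  simp only [← ofReal_gauss] at h
  exact h.re.congr (Eventually.of_forall fun x => by simp)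

theorem integral_gauss {τ : ℝ} (hτ : 0 < τ) :
    ∫ ξ, gauss τ ξ = (Real.pi / τ) ^ (3 / 2 : ℝ) := by
  have h := GaussianFourier.integral_cexp_neg_mul_sum_add (ι := Fin 3) (b := (τ : ℂ)) (by simpa using hτ)
    (fun _ => 0)
  simp only [← ofReal_gauss] at h
  rw [integral_complex_ofReal] at h
  have h2 : ((∫ ξ, gauss τ ξ : ℝ) : ℂ) = (((Real.pi / τ) ^ (3 / 2 : ℝ) : ℝ) : ℂ) := by
    rw [h, Complex.ofReal_cpow (by positivity)]
    simp
  exact_mod_cast h2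

theorem IF_gauss {τ : ℝ} (hτ : 0 < τ) (y : E3) :
    IF (fun ξ => (gauss τ ξ : ℂ)) y
      = ((fourierConst * (Real.pi / τ) ^ (3 / 2 : ℝ) * gauss (1 / (4 * τ)) y : ℝ) : ℂ) := by
  have h := GaussianFourier.integral_cexp_neg_mul_sum_add (ι := Fin 3) (b := (τ : ℂ)) (by simpa using hτ)
    (fun i => Complex.I * y i)
  unfold IF
  have e : ∀ ξ : E3, phase y ξ * (gauss τ ξ : ℂ) = Complex.exp (-(τ : ℂ) * ∑ i, (ξ i : ℂ) ^ 2
      + ∑ i, Complex.I * y i * ξ i) := by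
    intro ξ
    unfold phase gauss nsq
    push_cast
    rw [← Complex.exp_add, add_comm, Finset.mul_sum Finset.univ (fun i => (y i : ℂ) * (ξ i : ℂ))]
    simp only [mul_assoc]
  simp only [e]
  rw [h]
  push_cast
  rw [Complex.ofReal_cpow (by positivity), mul_assoc]
  congr 2
  · simp
  · unfold gauss nsq
    push_cast
    congr 1
    simp only [mul_pow, Complex.I_sq, ← Finset.mul_sum]
    ring

theorem IF_gauss_mul_FT {τ : ℝ} (hτ : 0 < τ) {u : E3 → ℂ} (hu : Integrable u) (x : E3) :
    IF (fun ξ => (gauss τ ξ : ℂ) * FT u ξ) x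
      = fourierConst * ∫ y, IF (fun ξ => (gauss τ ξ : ℂ)) (x - y) * u y := by
  unfold IF
  congr 1
  have hG : Integrable (fun ξ => (gauss τ ξ : ℂ)) := (integrable_gauss hτ).ofReal
  have e1 : ∀ ξ, phase x ξ * ((gauss τ ξ : ℂ) * FT u ξ)
      = ∫ y, (fourierConst : ℂ) * (phase (x - y) ξ * ((gauss τ ξ : ℂ) * u y)) := by
    intro ξ
    rw [FT_eq_IF_neg, IF, ← mul_assoc, ← integral_const_mul, ← integral_const_mul]
    refine integral_congr_ae (Eventually.of_forall fun y => ?_)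
    simp only
    rw [sub_eq_add_neg, phase_add_left, phase_neg_left, phase_neg_left, phase_comm ξ y]
    ring
  have e2 : ∀ y, (fourierConst : ℂ) * (∫ ξ, phase (x - y) ξ * (gauss τ ξ : ℂ)) * u y
      = ∫ ξ, (fourierConst : ℂ) * (phase (x - y) ξ * ((gauss τ ξ : ℂ) * u y)) := by
    intro y
    rw [← integral_const_mul, ← integral_mul_const]
    refine integral_congr_ae (Eventually.of_forall fun y => ?_)
    simp only
    ring
  simp only [e1, e2]
  rw [integral_integral_swap]
  have h3 := (hG.mul_prod hu).const_mul (fourierConst : ℂ)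
  refine (h3.bdd_mul (c := 1) (f := fun p : E3 × E3 => phase (x - p.2) p.1) ?_ ?_).congr ?_
  · exact (continuous_phase.comp (by fun_prop : Continuous fun p : E3 × E3 => (x - p.2, p.1))).aestronglyMeasurable
  · exact Eventually.of_forall fun p => (norm_phase _ _).le
  · exact Eventually.of_forall fun p => by simp only [Function.uncurry]; ring

theorem norm_IF_gauss_mul_FT_le {τ : ℝ} (hτ : 0 < τ) {u : E3 → ℂ} (hu : Integrable u)
    {M : ℝ} (hM : ∀ x, ‖u x‖ ≤ M) (x : E3) :
    ‖IF (fun ξ => (gauss τ ξ : ℂ) * FT u ξ) x‖ ≤ M := by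
  have hM0 : 0 ≤ M := (norm_nonneg _).trans (hM 0)
  have hτ4 : 0 < 1 / (4 * τ) := by positivity
  rw [IF_gauss_mul_FT hτ hu, norm_mul, Complex.norm_real, Real.norm_of_nonneg fourierConst_pos.le]
  simp only [IF_gauss hτ]
  set A := fourierConst * (Real.pi / τ) ^ (3 / 2 : ℝ) with hA
  have hA0 : 0 ≤ A := mul_nonneg fourierConst_pos.le (by positivity)
  have hint : Integrable (fun y => A * gauss (1 / (4 * τ)) (x - y) * M) :=
    (((integrable_gauss hτ4).comp_sub_left x).const_mul A).mul_const M
  have h1 : ‖∫ y, ((A * gauss (1 / (4 * τ)) (x - y) : ℝ) : ℂ) * u y‖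
      ≤ ∫ y, A * gauss (1 / (4 * τ)) (x - y) * M := by
    refine norm_integral_le_of_norm_le hint (Eventually.of_forall fun y => ?_)
    have h0 : 0 ≤ A * gauss (1 / (4 * τ)) (x - y) := mul_nonneg hA0 (gauss_pos _ _).le
    rw [norm_mul, Complex.norm_real, Real.norm_of_nonneg h0]
    exact mul_le_mul_of_nonneg_left (hM y) h0
  refine (mul_le_mul_of_nonneg_left h1 fourierConst_pos.le).trans (le_of_eq ?_)
  rw [integral_mul_const, integral_const_mul, integral_sub_left_eq_self, integral_gauss hτ4, hA]
  have h2 : (Real.pi / τ) ^ (3 / 2 : ℝ) * (Real.pi / (1 / (4 * τ))) ^ (3 / 2 : ℝ)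
      = (2 * Real.pi) ^ 3 := by
    rw [← Real.mul_rpow (by positivity) (by positivity)]
    have : Real.pi / τ * (Real.pi / (1 / (4 * τ))) = (2 * Real.pi) ^ (2 : ℝ) := by
      rw [Real.rpow_ofNat]
      field_simp
      ring
    rw [this, ← Real.rpow_mul (by positivity)]
    norm_num
  have h3 := fourierConst_sq
  rw [← h2] at h3
  linear_combination M * h3

theorem integral_norm_sq_IF {X : E3 → ℂ} (hX : L12 X) : ∫ x, ‖IF X x‖ ^ 2 = ∫ ξ, ‖X ξ‖ ^ 2 := by
  have h := integral_IF_mul_conj hX hX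
  simp only [Complex.mul_conj, Complex.normSq_eq_norm_sq] at h
  rw [integral_complex_ofReal, integral_complex_ofReal] at h
  exact_mod_cast h

theorem L12.integrable_sq {X : E3 → ℂ} (hX : L12 X) : Integrable (fun ξ => ‖X ξ‖ ^ 2) :=
  (memLp_two_iff_integrable_sq_norm hX.int.1).1 hX.sq

theorem integrable_norm_sq_IF {X : E3 → ℂ} (hX : L12 X) : Integrable (fun x => ‖IF X x‖ ^ 2) :=
  (memLp_two_iff_integrable_sq_norm (continuous_IF hX.int).aestronglyMeasurable).1 (memLp_IF hX)

theorem integrable_norm_IF_mul {X Y : E3 → ℂ} (hX : L12 X) (hY : L12 Y) :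
    Integrable (fun x => ‖IF X x‖ * ‖IF Y x‖) :=
  (memLp_IF hX).norm.integrable_mul (memLp_IF hY).norm

theorem integral_norm_IF_mul_le {X Y : E3 → ℂ} (hX : L12 X) (hY : L12 Y) :
    ∫ x, ‖IF X x‖ * ‖IF Y x‖ ≤ (∫ ξ, ‖X ξ‖ ^ 2) + ∫ ξ, ‖Y ξ‖ ^ 2 := by
  rw [← integral_norm_sq_IF hX, ← integral_norm_sq_IF hY,
    ← integral_add (integrable_norm_sq_IF hX) (integrable_norm_sq_IF hY)]
  refine integral_mono (integrable_norm_IF_mul hX hY)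
    ((integrable_norm_sq_IF hX).add (integrable_norm_sq_IF hY)) fun x => ?_
  simp only
  nlinarith [sq_nonneg (‖IF X x‖ - ‖IF Y x‖), sq_nonneg (‖IF X x‖ + ‖IF Y x‖)]

theorem L12.comp_sub {X : E3 → ℂ} (hX : L12 X) (ζ : E3) : L12 (fun ξ => X (ξ - ζ)) :=
  ⟨hX.int.comp_sub_right ζ, hX.sq.comp_measurePreserving (measurePreserving_sub_right volume ζ)⟩

theorem IF_comp_sub (X : E3 → ℂ) (ζ x : E3) :
    IF (fun ξ => X (ξ - ζ)) x = phase x ζ * IF X x := by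
  unfold IF
  rw [← integral_add_right_eq_self _ ζ]
  simp only [add_sub_cancel_right, phase_add_right]
  have h : ∀ ξ, phase x ξ * phase x ζ * X ξ = phase x ζ * (phase x ξ * X ξ) := fun ξ => by ring
  simp only [h, integral_const_mul]
  ring

/-- The trilinear form `∫∫ A(ζ) B(ξ) conj(C(ζ+ξ)) dξ dζ`. -/
def Tri (A B C : E3 → ℂ) : ℂ :=
  ∫ p : E3 × E3, A p.1 * B p.2 * (starRingEnd ℂ) (C (p.1 + p.2))

theorem aestronglyMeasurable_comp_add {C : E3 → ℂ} (hC : AEStronglyMeasurable C) :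
    AEStronglyMeasurable (fun p : E3 × E3 => C (p.1 + p.2)) :=
  hC.comp_snd.comp_measurePreserving (measurePreserving_prod_add volume volume)

theorem integrable_mul_comp_add {A : E3 → ℝ} {C : E3 → ℝ} (hA : Integrable A) (hC : Integrable C) :
    Integrable (fun p : E3 × E3 => A p.1 * C (p.1 + p.2)) :=
  ((measurePreserving_prod_add volume volume).integrable_comp
    (hA.mul_prod hC).1).2 (hA.mul_prod hC)

theorem integrable_tri {A B C : E3 → ℂ} (hA : Integrable A) (hB : L12 B) (hC : L12 C) :
    Integrable (fun p : E3 × E3 => A p.1 * B p.2 * (starRingEnd ℂ) (C (p.1 + p.2))) := by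
  have h1 : Integrable (fun p : E3 × E3 => ‖A p.1‖ * ‖B p.2‖ ^ 2) :=
    hA.norm.mul_prod hB.integrable_sq
  have h2 : Integrable (fun p : E3 × E3 => ‖A p.1‖ * ‖C (p.1 + p.2)‖ ^ 2) :=
    integrable_mul_comp_add hA.norm hC.integrable_sq
  refine (h1.add h2).mono ?_ (Eventually.of_forall fun p => ?_)
  · exact (hA.1.comp_fst.mul hB.int.1.comp_snd).mul
      (Complex.continuous_conj.comp_aestronglyMeasurable (aestronglyMeasurable_comp_add hC.int.1))
  · simp only [norm_mul, Complex.norm_conj, Pi.add_apply]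
    rw [Real.norm_of_nonneg (by positivity), mul_assoc, ← mul_add]
    refine mul_le_mul_of_nonneg_left ?_ (norm_nonneg _)
    nlinarith [sq_nonneg (‖B p.2‖ - ‖C (p.1 + p.2)‖), sq_nonneg (‖B p.2‖ + ‖C (p.1 + p.2)‖)]

theorem fourierConst_mul_Tri {A B C : E3 → ℂ} (hA : Integrable A) (hB : L12 B) (hC : L12 C) :
    fourierConst * Tri A B C = ∫ x, IF A x * (IF B x * (starRingEnd ℂ) (IF C x)) := by
  have e1 : ∀ ζ, ∫ ξ, A ζ * B ξ * (starRingEnd ℂ) (C (ζ + ξ))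
      = ∫ x, phase x ζ * A ζ * (IF B x * (starRingEnd ℂ) (IF C x)) := by
    intro ζ
    have h := integral_IF_mul_conj (hB.comp_sub ζ) hC
    simp only [IF_comp_sub] at h
    rw [← integral_add_left_eq_self (fun ξ => B (ξ - ζ) * (starRingEnd ℂ) (C ξ)) ζ] at h
    simp only [add_sub_cancel_left] at h
    simp only [mul_assoc]
    rw [integral_const_mul, ← h, ← integral_const_mul]
    congr 1
    funext x
    ring
  have h2 : Integrable (fun p : E3 × E3 => phase p.2 p.1 * A p.1 *
      (IF B p.2 * (starRingEnd ℂ) (IF C p.2))) := by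
    have h3 : Integrable (fun x => IF B x * (starRingEnd ℂ) (IF C x)) := by
      refine (integrable_norm_IF_mul hB hC).mono ?_ (Eventually.of_forall fun x => ?_)
      · exact ((continuous_IF hB.int).mul
          (Complex.continuous_conj.comp (continuous_IF hC.int))).aestronglyMeasurable
      · simp
    refine ((hA.mul_prod h3).bdd_mul (c := 1) (f := fun p : E3 × E3 => phase p.2 p.1) ?_ ?_).congr ?_
    · exact (continuous_phase.comp continuous_swap).aestronglyMeasurable
    · exact Eventually.of_forall fun p => (norm_phase _ _).le
    · exact Eventually.of_forall fun p => by ring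
  unfold Tri
  rw [Measure.volume_eq_prod, integral_prod _ (integrable_tri hA hB hC)]
  simp only [e1]
  rw [integral_integral_swap h2, ← integral_const_mul]
  congr 1
  funext x
  rw [integral_mul_const, ← mul_assoc]
  rfl

theorem norm_Tri_le_left {A B C : E3 → ℂ} {M : ℝ} (hA : Integrable A) (hB : L12 B) (hC : L12 C)
    (hM : ∀ x, ‖IF A x‖ ≤ M) :
    fourierConst * ‖Tri A B C‖ ≤ M * ((∫ ξ, ‖B ξ‖ ^ 2) + ∫ ξ, ‖C ξ‖ ^ 2) := by
  have h : fourierConst * ‖Tri A B C‖ = ‖(fourierConst : ℂ) * Tri A B C‖ := by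
    rw [norm_mul, Complex.norm_real, Real.norm_of_nonneg fourierConst_pos.le]
  have hM0 : 0 ≤ M := (norm_nonneg _).trans (hM 0)
  rw [h, fourierConst_mul_Tri hA hB hC]
  refine (norm_integral_le_of_norm_le ((integrable_norm_IF_mul hB hC).const_mul M)
    (Eventually.of_forall fun x => ?_)).trans ?_
  · rw [norm_mul, norm_mul, Complex.norm_conj]
    exact mul_le_mul_of_nonneg_right (hM x) (by positivity)
  · rw [integral_const_mul]
    exact mul_le_mul_of_nonneg_left (integral_norm_IF_mul_le hB hC) hM0

theorem norm_Tri_le_mid {A B C : E3 → ℂ} {M : ℝ} (hA : L12 A) (hB : L12 B) (hC : L12 C)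
    (hM : ∀ x, ‖IF B x‖ ≤ M) :
    fourierConst * ‖Tri A B C‖ ≤ M * ((∫ ξ, ‖A ξ‖ ^ 2) + ∫ ξ, ‖C ξ‖ ^ 2) := by
  have h : fourierConst * ‖Tri A B C‖ = ‖(fourierConst : ℂ) * Tri A B C‖ := by
    rw [norm_mul, Complex.norm_real, Real.norm_of_nonneg fourierConst_pos.le]
  have hM0 : 0 ≤ M := (norm_nonneg _).trans (hM 0)
  rw [h, fourierConst_mul_Tri hA.int hB hC]
  refine (norm_integral_le_of_norm_le ((integrable_norm_IF_mul hA hC).const_mul M)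
    (Eventually.of_forall fun x => ?_)).trans ?_
  · rw [norm_mul, norm_mul, Complex.norm_conj, mul_left_comm]
    exact mul_le_mul_of_nonneg_right (hM x) (by positivity)
  · rw [integral_const_mul]
    exact mul_le_mul_of_nonneg_left (integral_norm_IF_mul_le hA hC) hM0

theorem norm_Tri_le_right {A B C : E3 → ℂ} {M : ℝ} (hA : L12 A) (hB : L12 B) (hC : L12 C)
    (hM : ∀ x, ‖IF C x‖ ≤ M) :
    fourierConst * ‖Tri A B C‖ ≤ M * ((∫ ξ, ‖A ξ‖ ^ 2) + ∫ ξ, ‖B ξ‖ ^ 2) := by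
  have h : fourierConst * ‖Tri A B C‖ = ‖(fourierConst : ℂ) * Tri A B C‖ := by
    rw [norm_mul, Complex.norm_real, Real.norm_of_nonneg fourierConst_pos.le]
  have hM0 : 0 ≤ M := (norm_nonneg _).trans (hM 0)
  rw [h, fourierConst_mul_Tri hA.int hB hC]
  refine (norm_integral_le_of_norm_le ((integrable_norm_IF_mul hA hB).const_mul M)
    (Eventually.of_forall fun x => ?_)).trans ?_
  · rw [norm_mul, norm_mul, Complex.norm_conj, ← mul_assoc, mul_comm]
    exact mul_le_mul_of_nonneg_right (hM x) (by positivity)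
  · rw [integral_const_mul]
    exact mul_le_mul_of_nonneg_left (integral_norm_IF_mul_le hA hB) hM0

theorem L12.mul_bdd {X : E3 → ℂ} (hX : L12 X) {g : E3 → ℂ} (hg : Continuous g) {C : ℝ}
    (hC : ∀ ξ, ‖g ξ‖ ≤ C) : L12 (fun ξ => g ξ * X ξ) := by
  refine ⟨hX.int.bdd_mul (c := C) hg.aestronglyMeasurable (Eventually.of_forall hC), ?_⟩
  exact hX.sq.mul (p := ⊤) (q := 2) (r := 2)
    (memLp_top_of_bound hg.aestronglyMeasurable C (Eventually.of_forall hC))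

theorem L12.of_bound {X : E3 → ℂ} (hX : Integrable X) {C : ℝ} (hC : ∀ ξ, ‖X ξ‖ ≤ C) : L12 X := by
  refine ⟨hX, (memLp_two_iff_integrable_sq_norm hX.1).2 ?_⟩
  refine (hX.norm.const_mul C).mono (hX.1.norm.pow 2) (Eventually.of_forall fun ξ => ?_)
  have hC0 : 0 ≤ C := (norm_nonneg _).trans (hC ξ)
  rw [Real.norm_of_nonneg (by positivity), Real.norm_of_nonneg (by positivity), pow_two]
  exact mul_le_mul_of_nonneg_right (hC ξ) (norm_nonneg _)

theorem hasLineDerivAt_phase (x ξ v : E3) :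
    HasLineDerivAt ℝ (fun ξ => phase x ξ) (Complex.I * ((∑ α, x α * v α : ℝ) : ℂ) * phase x ξ) ξ v := by
  unfold HasLineDerivAt phase
  have h1 : HasDerivAt (fun t : ℝ => ((∑ α, x α * (ξ + t • v) α : ℝ))) (∑ α, x α * v α) 0 := by
    have : (fun t : ℝ => ((∑ α, x α * (ξ + t • v) α : ℝ)))
        = fun t : ℝ => (∑ α, x α * ξ α) + t * ∑ α, x α * v α := by
      funext t
      rw [Finset.mul_sum, ← Finset.sum_add_distrib]
      refine Finset.sum_congr rfl fun α _ => ?_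
      simp
      ring
    rw [this]
    simpa using ((hasDerivAt_id (0 : ℝ)).mul_const (∑ α, x α * v α)).const_add (∑ α, x α * ξ α)
  have h2 := (h1.ofReal_comp.const_mul Complex.I).cexp
  simp only [zero_smul, add_zero] at h2
  exact h2.congr_deriv (by ring)

theorem IF_lineDeriv {h h' : E3 → ℂ} (j : Fin 3) (hh : Integrable h) (hh' : Integrable h')
    (hd : ∀ ξ, HasLineDerivAt ℝ h (h' ξ) ξ (Pi.single j 1)) (y : E3) :
    IF h' y = -(Complex.I * y j) * IF h y := by
  unfold IF
  have hs : (∑ α, y α * (Pi.single j (1 : ℝ) : E3) α : ℝ) = y j := by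
    simp [Pi.single_apply]
  have hi : Integrable (fun ξ => Complex.I * (y j : ℂ) * phase y ξ * h ξ) := by
    simpa only [mul_assoc] using (hh.phase_mul y).const_mul (Complex.I * (y j : ℂ))
  have key := integral_bilinear_hasLineDerivAt_right_eq_neg_left_of_integrable
    (μ := (volume : Measure E3)) (f := fun ξ => phase y ξ)
    (f' := fun ξ => Complex.I * (y j : ℂ) * phase y ξ)
    (g := h) (g' := h') (v := Pi.single j 1) (B := ContinuousLinearMap.mul ℝ ℂ)
    (by simpa using hi) (by simpa using hh'.phase_mul y) (by simpa using hh.phase_mul y)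
    (fun ξ _ => by
      have := hasLineDerivAt_phase y ξ (Pi.single j 1)
      rwa [hs] at this)
    (fun ξ _ => hd ξ)
  simp only [ContinuousLinearMap.mul_apply'] at key
  rw [key]
  simp only [mul_assoc]
  rw [integral_const_mul, integral_const_mul]
  ring

theorem ContDiff.pd {n : WithTop ℕ∞} {f : E3 → ℝ} (hf : ContDiff ℝ (n + 1) f) (j : Fin 3) :
    ContDiff ℝ n (pd j f) :=
  (hf.fderiv_right le_rfl).clm_apply contDiff_const

theorem HasCompactSupport.pd {f : E3 → ℝ} (hf : HasCompactSupport f) (j : Fin 3) :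
    HasCompactSupport (pd j f) :=
  hf.fderiv_apply (𝕜 := ℝ) (Pi.single j 1)

theorem tsupport_pd_subset (f : E3 → ℝ) (j : Fin 3) : tsupport (pd j f) ⊆ tsupport f :=
  tsupport_fderiv_apply_subset ℝ (Pi.single j 1)

/-- The Fourier transform of a real function. -/
def hat (f : E3 → ℝ) : E3 → ℂ := FT (fun y => (f y : ℂ))

theorem hat_eq_IF_neg (f : E3 → ℝ) (ξ : E3) : hat f ξ = IF (fun y => (f y : ℂ)) (-ξ) :=
  FT_eq_IF_neg _ _

theorem integrable_ofReal_of_compact {f : E3 → ℝ} (hf : Continuous f) (hc : HasCompactSupport f) :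
    Integrable (fun y => (f y : ℂ)) :=
  (hf.integrable_of_hasCompactSupport hc).ofReal

theorem exists_bound_of_compact {f : E3 → ℝ} (hf : Continuous f) (hc : HasCompactSupport f) :
    ∃ C, ∀ x, |f x| ≤ C := hf.bounded_above_of_compact_support hc

theorem L12.ofReal_of_compact {f : E3 → ℝ} (hf : Continuous f) (hc : HasCompactSupport f) :
    L12 (fun y => (f y : ℂ)) := by
  obtain ⟨C, hC⟩ := exists_bound_of_compact hf hc
  exact L12.of_bound (integrable_ofReal_of_compact hf hc) (C := C)
    fun x => by simpa using hC x

theorem continuous_hat {f : E3 → ℝ} (hf : Continuous f) (hc : HasCompactSupport f) :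
    Continuous (hat f) := by
  have := (continuous_IF (integrable_ofReal_of_compact hf hc)).comp continuous_neg
  exact this.congr fun ξ => (hat_eq_IF_neg f ξ).symm

theorem exists_bound_hat (f : E3 → ℝ) : ∃ C, ∀ ξ, ‖hat f ξ‖ ≤ C :=
  ⟨_, fun ξ => by rw [hat_eq_IF_neg]; exact norm_IF_le _ _⟩

theorem hat_pd {f : E3 → ℝ} (hf : ContDiff ℝ 1 f) (hc : HasCompactSupport f) (j : Fin 3) (ξ : E3) :
    hat (pd j f) ξ = Complex.I * ξ j * hat f ξ := by
  rw [hat_eq_IF_neg, hat_eq_IF_neg]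
  have hp : ContDiff ℝ 0 (pd j f) := ContDiff.pd (by simpa using hf) j
  rw [IF_lineDeriv j (integrable_ofReal_of_compact hf.continuous hc)
    (integrable_ofReal_of_compact hp.continuous (hc.pd j))]
  · simp
  · intro x
    have h1 := ((hf.differentiable one_ne_zero x).hasFDerivAt.hasLineDerivAt (Pi.single j 1))
    exact HasDerivAt.ofReal_comp h1

theorem integrable_sq_hat {f : E3 → ℝ} (hf : Continuous f) (hc : HasCompactSupport f) :
    Integrable (fun ξ => ‖hat f ξ‖ ^ 2) := by
  simp only [hat_eq_IF_neg]
  exact (integrable_norm_sq_IF (L12.ofReal_of_compact hf hc)).comp_neg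

theorem integral_sq_hat {f : E3 → ℝ} (hf : Continuous f) (hc : HasCompactSupport f) :
    ∫ ξ, ‖hat f ξ‖ ^ 2 = ∫ x, f x ^ 2 := by
  simp only [hat_eq_IF_neg]
  rw [integral_neg_eq_self (fun ξ => ‖IF (fun y => (f y : ℂ)) ξ‖ ^ 2),
    integral_norm_sq_IF (L12.ofReal_of_compact hf hc)]
  simp

theorem integrable_weight : Integrable (fun ξ : E3 => (1 + ‖ξ‖) ^ (-(4 : ℝ))) :=
  integrable_one_add_norm (by simp; norm_num)

theorem weight_pointwise (ξ : E3) (x : ℝ) :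
    (1 + ‖ξ‖) * x ≤ (1 + ‖ξ‖) ^ (-(4 : ℝ)) + 64 * (x ^ 2 + ∑ j, (ξ j ^ 3 * x) ^ 2) := by
  set n := ‖ξ‖ with hn
  have hn0 : 0 ≤ n := norm_nonneg ξ
  have h1 : (1 + n) ^ (-(4 : ℝ)) = ((1 + n) ^ 2)⁻¹ ^ 2 := by
    rw [Real.rpow_neg (by positivity), inv_pow, ← pow_mul]
    norm_num
  have h2 : (1 + n) * x = ((1 + n) ^ 2)⁻¹ * ((1 + n) ^ 3 * x) := by field_simp
  have h3 : n ^ 6 ≤ ∑ j, (ξ j ^ 3) ^ 2 := by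
    obtain ⟨j, hj⟩ : ∃ j, n = ‖ξ j‖ := by
      obtain ⟨j, -, hj⟩ := Finset.exists_mem_eq_sup' Finset.univ_nonempty (fun j => ‖ξ j‖₊)
      refine ⟨j, ?_⟩
      rw [hn, Pi.norm_def, ← Finset.sup'_eq_sup Finset.univ_nonempty, hj]
      rfl
    have h4 : (ξ j ^ 3) ^ 2 = n ^ 6 := by
      rw [hj, Real.norm_eq_abs, ← pow_mul, Even.pow_abs (by decide)]
    rw [← h4]
    exact Finset.single_le_sum (f := fun j => (ξ j ^ 3) ^ 2) (fun i _ => sq_nonneg _)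
      (Finset.mem_univ j)
  have h5 : (1 + n) ^ 6 ≤ 64 * (1 + n ^ 6) := by
    rcases le_total n 1 with h | h
    · calc (1 + n) ^ 6 ≤ 2 ^ 6 := by gcongr; linarith
        _ ≤ 64 * (1 + n ^ 6) := by nlinarith [pow_nonneg hn0 6]
    · calc (1 + n) ^ 6 ≤ (2 * n) ^ 6 := by gcongr; linarith
        _ ≤ 64 * (1 + n ^ 6) := by nlinarith [pow_nonneg hn0 6]
  have h6 : ((1 + n) ^ 3 * x) ^ 2 ≤ 64 * (x ^ 2 + ∑ j, (ξ j ^ 3 * x) ^ 2) := by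
    have : ∑ j, (ξ j ^ 3 * x) ^ 2 = (∑ j, (ξ j ^ 3) ^ 2) * x ^ 2 := by
      rw [Finset.sum_mul]; simp only [mul_pow]
    rw [this]
    have hx2 := sq_nonneg x
    calc ((1 + n) ^ 3 * x) ^ 2 = (1 + n) ^ 6 * x ^ 2 := by ring
      _ ≤ 64 * (1 + n ^ 6) * x ^ 2 := by gcongr
      _ ≤ 64 * (1 + ∑ j, (ξ j ^ 3) ^ 2) * x ^ 2 := by gcongr
      _ = _ := by ring
  rw [h2, h1]
  set a := ((1 + n) ^ 2)⁻¹
  set c := (1 + n) ^ 3 * x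
  nlinarith [sq_nonneg (a - c), sq_nonneg (a + c)]

theorem integrable_weight_mul {X : E3 → ℂ} (hm : AEStronglyMeasurable X)
    (h0 : Integrable (fun ξ => ‖X ξ‖ ^ 2))
    (h3 : ∀ j : Fin 3, Integrable (fun ξ => (ξ j ^ 3 * ‖X ξ‖) ^ 2)) :
    Integrable (fun ξ => (1 + ‖ξ‖) * ‖X ξ‖) ∧
    ∫ ξ, (1 + ‖ξ‖) * ‖X ξ‖ ≤ (∫ ξ : E3, (1 + ‖ξ‖) ^ (-(4 : ℝ))) +
      64 * ((∫ ξ, ‖X ξ‖ ^ 2) + ∑ j, ∫ ξ, (ξ j ^ 3 * ‖X ξ‖) ^ 2) := by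
  have hs : Integrable (fun ξ => ∑ j, (ξ j ^ 3 * ‖X ξ‖) ^ 2) := integrable_finsetSum _ fun j _ => h3 j
  have hi := integrable_weight.add ((h0.add hs).const_mul 64)
  have hI : Integrable (fun ξ => (1 + ‖ξ‖) * ‖X ξ‖) := by
    refine hi.mono ?_ (Eventually.of_forall fun ξ => ?_)
    · exact (by fun_prop : Continuous fun ξ : E3 => 1 + ‖ξ‖).aestronglyMeasurable.mul hm.norm
    · rw [Real.norm_of_nonneg (by positivity)]
      exact (weight_pointwise ξ _).trans (le_abs_self _)
  refine ⟨hI, (integral_mono hI hi fun ξ => weight_pointwise ξ _).trans (le_of_eq ?_)⟩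
  rw [integral_add' integrable_weight ((h0.add hs).const_mul 64), integral_const_mul]
  simp only [Pi.add_apply]
  rw [integral_add h0 hs, integral_finsetSum _ fun j _ => h3 j]

theorem MeasureTheory.Integrable.of_weight {X : E3 → ℂ} (hm : AEStronglyMeasurable X)
    (h : Integrable (fun ξ => (1 + ‖ξ‖) * ‖X ξ‖)) {g : E3 → ℂ} (hg : Continuous g) {C : ℝ}
    (hC : ∀ ξ, ‖g ξ‖ ≤ C * (1 + ‖ξ‖)) : Integrable (fun ξ => g ξ * X ξ) := by
  refine (h.const_mul C).mono (hg.aestronglyMeasurable.mul hm) (Eventually.of_forall fun ξ => ?_)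
  rw [norm_mul, ← mul_assoc]
  exact (mul_le_mul_of_nonneg_right (hC ξ) (norm_nonneg _)).trans
    ((le_abs_self _).trans (le_of_eq (by simp)))

/-- `C³` functions of compact support. -/
structure C3c (f : E3 → ℝ) : Prop where
  smooth : ContDiff ℝ 3 f
  compact : HasCompactSupport f

theorem C3c.continuous {f : E3 → ℝ} (hf : C3c f) : Continuous f := hf.smooth.continuous

theorem C3c.contDiff_pd {f : E3 → ℝ} (hf : C3c f) (j : Fin 3) : ContDiff ℝ 2 (pd j f) :=
  ContDiff.pd (n := 2) (hf.smooth.of_le (by norm_num)) j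

theorem C3c.hat_pd {f : E3 → ℝ} (hf : C3c f) (j : Fin 3) (ξ : E3) :
    hat (pd j f) ξ = Complex.I * ξ j * hat f ξ :=
  _root_.hat_pd (hf.smooth.of_le (by norm_num)) hf.compact j ξ

theorem C3c.integrable_weight_hat {f : E3 → ℝ} (hf : C3c f) :
    Integrable (fun ξ => (1 + ‖ξ‖) * ‖hat f ξ‖) := by
  refine (integrable_weight_mul (continuous_hat hf.continuous hf.compact).aestronglyMeasurable
    (integrable_sq_hat hf.continuous hf.compact) fun j => ?_).1
  have h1 : ContDiff ℝ 2 (pd j f) := hf.contDiff_pd j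
  have h2 : ContDiff ℝ 1 (pd j (pd j f)) := ContDiff.pd (n := 1) (h1.of_le (by norm_num)) j
  have h3 : ContDiff ℝ 0 (pd j (pd j (pd j f))) := ContDiff.pd (n := 0) (by simpa using h2) j
  refine (integrable_sq_hat h3.continuous (((hf.compact.pd j).pd j).pd j)).congr
    (Eventually.of_forall fun ξ => ?_)
  simp only
  rw [_root_.hat_pd h2 ((hf.compact.pd j).pd j), _root_.hat_pd (h1.of_le (by norm_num)) (hf.compact.pd j),
    hf.hat_pd]
  simp only [norm_mul, Complex.norm_I, Complex.norm_real, Real.norm_eq_abs, one_mul]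
  rw [← mul_assoc, ← mul_assoc, mul_pow _ ‖hat f ξ‖, mul_pow _ ‖hat f ξ‖, abs_mul_abs_self, mul_pow,
    sq_abs]
  ring

theorem C3c.continuous_hat {f : E3 → ℝ} (hf : C3c f) : Continuous (hat f) :=
  _root_.continuous_hat hf.continuous hf.compact

theorem C3c.exists_bound_weight_hat {f : E3 → ℝ} (hf : C3c f) :
    ∃ C, 0 ≤ C ∧ ∀ ξ, (1 + ‖ξ‖) * ‖hat f ξ‖ ≤ C := by
  obtain ⟨C, hC⟩ := exists_bound_hat f
  choose D hD using fun j => exists_bound_hat (pd j f)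
  have hD0 : ∀ j, 0 ≤ D j := fun j => (norm_nonneg _).trans (hD j 0)
  refine ⟨C + ∑ j, D j, add_nonneg ((norm_nonneg _).trans (hC 0))
    (Finset.sum_nonneg fun j _ => hD0 j), fun ξ => ?_⟩
  rw [add_mul, one_mul]
  refine add_le_add (hC ξ) ?_
  have h1 : ‖ξ‖ ≤ (∑ j, D j) / ‖hat f ξ‖ ∨ ‖hat f ξ‖ = 0 := by
    by_cases h : ‖hat f ξ‖ = 0
    · exact Or.inr h
    refine Or.inl ((pi_norm_le_iff_of_nonneg (div_nonneg (Finset.sum_nonneg fun j _ => hD0 j)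
      (norm_nonneg _))).2 fun j => ?_)
    rw [le_div_iff₀ (lt_of_le_of_ne (norm_nonneg _) (Ne.symm h))]
    have := hD j ξ
    rw [hf.hat_pd] at this
    simp only [norm_mul, Complex.norm_I, Complex.norm_real, one_mul] at this
    exact this.trans (Finset.single_le_sum (fun j _ => hD0 j) (Finset.mem_univ j))
  rcases h1 with h1 | h1
  · by_cases h : ‖hat f ξ‖ = 0
    · rw [h, mul_zero]; exact Finset.sum_nonneg fun j _ => hD0 j
    · rwa [le_div_iff₀ (lt_of_le_of_ne (norm_nonneg _) (Ne.symm h))] at h1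
  · rw [h1, mul_zero]; exact Finset.sum_nonneg fun j _ => hD0 j

theorem C3c.L12_mul_hat {f : E3 → ℝ} (hf : C3c f) {g : E3 → ℂ} (hg : Continuous g) {C : ℝ}
    (hC : ∀ ξ, ‖g ξ‖ ≤ C * (1 + ‖ξ‖)) : L12 (fun ξ => g ξ * hat f ξ) := by
  obtain ⟨D, hD0, hD⟩ := hf.exists_bound_weight_hat
  have hC0 : 0 ≤ C := by
    have := (norm_nonneg _).trans (hC 0)
    simpa using this
  refine L12.of_bound (Integrable.of_weight hf.continuous_hat.aestronglyMeasurable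
    hf.integrable_weight_hat hg hC) (C := C * D) fun ξ => ?_
  rw [norm_mul]
  calc ‖g ξ‖ * ‖hat f ξ‖ ≤ C * (1 + ‖ξ‖) * ‖hat f ξ‖ := by gcongr; exact hC ξ
    _ = C * ((1 + ‖ξ‖) * ‖hat f ξ‖) := by ring
    _ ≤ C * D := by gcongr; exact hD ξ

theorem C3c.L12_hat {f : E3 → ℝ} (hf : C3c f) : L12 (hat f) := by
  simpa using hf.L12_mul_hat (g := fun _ => 1) continuous_const (C := 1)
    (fun ξ => by simp)

theorem C3c.IF_hat {f : E3 → ℝ} (hf : C3c f) (x : E3) : IF (hat f) x = f x :=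
  IF_FT (Complex.continuous_ofReal.comp hf.continuous)
    (integrable_ofReal_of_compact hf.continuous hf.compact) hf.L12_hat.int x

/-- The linear functional `x ↦ x·ξ`. -/
def dotL (ξ : E3) : E3 →L[ℝ] ℝ := ∑ α, ξ α • ContinuousLinearMap.proj (R := ℝ) α

theorem dotL_apply (ξ x : E3) : dotL ξ x = ∑ α, x α * ξ α := by
  simp [dotL, mul_comm]

theorem continuous_dotL : Continuous dotL := by unfold dotL; fun_prop

theorem abs_sum_mul_le (x ξ : E3) : |∑ α, x α * ξ α| ≤ 3 * ‖x‖ * ‖ξ‖ := by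
  refine (Finset.abs_sum_le_sum_abs _ _).trans ?_
  calc ∑ α, |x α * ξ α| ≤ ∑ _α : Fin 3, ‖x‖ * ‖ξ‖ := by
        refine Finset.sum_le_sum fun α _ => ?_
        rw [abs_mul]
        exact mul_le_mul (norm_le_pi_norm x α) (norm_le_pi_norm ξ α) (abs_nonneg _) (norm_nonneg _)
    _ = 3 * ‖x‖ * ‖ξ‖ := by simp; ring

theorem norm_dotL_le (ξ : E3) : ‖dotL ξ‖ ≤ 3 * ‖ξ‖ := by
  refine ContinuousLinearMap.opNorm_le_bound _ (by positivity) fun x => ?_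
  rw [dotL_apply, Real.norm_eq_abs]
  exact (abs_sum_mul_le x ξ).trans (le_of_eq (by ring))

theorem hasFDerivAt_phase (x ξ : E3) :
    HasFDerivAt (fun x => phase x ξ)
      (phase x ξ • (Complex.I • (Complex.ofRealCLM.comp (dotL ξ)))) x := by
  have h : HasFDerivAt (fun x : E3 => Complex.I * ((∑ α, x α * ξ α : ℝ) : ℂ))
      (Complex.I • (Complex.ofRealCLM.comp (dotL ξ))) x := by
    have h1 := ((Complex.ofRealCLM.comp (dotL ξ)).hasFDerivAt (x := x)).const_mul Complex.I
    refine h1.congr_of_eventuallyEq (Eventually.of_forall fun y => ?_)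
    simp [dotL_apply]
  exact h.cexp

theorem hasFDerivAt_IF {X : E3 → ℂ} (hm : AEStronglyMeasurable X)
    (h : Integrable (fun ξ => (1 + ‖ξ‖) * ‖X ξ‖)) (x : E3) :
    HasFDerivAt (IF X) ((fourierConst : ℂ) • ∫ ξ, X ξ •
      (phase x ξ • (Complex.I • (Complex.ofRealCLM.comp (dotL ξ))))) x := by
  have hX : Integrable X := by
    simpa using Integrable.of_weight hm h (g := fun _ => 1) continuous_const (C := 1)
      (fun ξ => by simp)
  unfold IF
  refine HasFDerivAt.const_mul (hasFDerivAt_integral_of_dominated_of_fderiv_le (𝕜 := ℝ)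
    (bound := fun ξ => 3 * ((1 + ‖ξ‖) * ‖X ξ‖)) (s := Set.univ)
    (F := fun x ξ => phase x ξ * X ξ)
    (F' := fun x ξ => X ξ • (phase x ξ • (Complex.I • (Complex.ofRealCLM.comp (dotL ξ)))))
    univ_mem ?_ (hX.phase_mul x) ?_ ?_ (h.const_mul 3) ?_) _
  · exact Eventually.of_forall fun y => (hX.phase_mul y).aestronglyMeasurable
  · refine hm.smul (Continuous.aestronglyMeasurable ?_)
    have := continuous_dotL
    fun_prop
  · refine Eventually.of_forall fun ξ y _ => ?_
    rw [norm_smul, norm_smul, norm_smul, norm_phase, Complex.norm_I, one_mul, one_mul]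
    have h1 : ‖Complex.ofRealCLM.comp (dotL ξ)‖ ≤ 3 * ‖ξ‖ := by
      refine (ContinuousLinearMap.opNorm_comp_le _ _).trans ?_
      rw [Complex.ofRealCLM_norm, one_mul]
      exact norm_dotL_le ξ
    nlinarith [norm_nonneg (X ξ), norm_nonneg ξ]
  · refine Eventually.of_forall fun ξ y _ => ?_
    have := (hasFDerivAt_phase y ξ).mul_const (X ξ)
    exact this

theorem differentiable_IF {X : E3 → ℂ} (hm : AEStronglyMeasurable X)
    (h : Integrable (fun ξ => (1 + ‖ξ‖) * ‖X ξ‖)) : Differentiable ℝ (IF X) :=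
  fun x => (hasFDerivAt_IF hm h x).differentiableAt

theorem pdC_IF {X : E3 → ℂ} (hm : AEStronglyMeasurable X)
    (h : Integrable (fun ξ => (1 + ‖ξ‖) * ‖X ξ‖)) (j : Fin 3) (x : E3) :
    pdC j (IF X) x = IF (fun ξ => Complex.I * ξ j * X ξ) x := by
  unfold pdC
  rw [(hasFDerivAt_IF hm h x).fderiv]
  rw [smul_apply]
  unfold IF
  rw [smul_eq_mul]
  congr 1
  rw [ContinuousLinearMap.integral_apply]
  · refine integral_congr_ae (Eventually.of_forall fun ξ => ?_)
    simp [dotL_apply, Pi.single_apply]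
    ring
  · refine (h.const_mul 3).mono (hm.smul (Continuous.aestronglyMeasurable ?_))
      (Eventually.of_forall fun ξ => ?_)
    · have := continuous_dotL
      fun_prop
    · rw [norm_smul, norm_smul, norm_smul, norm_phase, Complex.norm_I, one_mul, one_mul]
      have h1 : ‖Complex.ofRealCLM.comp (dotL ξ)‖ ≤ 3 * ‖ξ‖ := by
        refine (ContinuousLinearMap.opNorm_comp_le _ _).trans ?_
        rw [Complex.ofRealCLM_norm, one_mul]
        exact norm_dotL_le ξ
      refine le_trans ?_ (le_abs_self _)
      nlinarith [norm_nonneg (X ξ), norm_nonneg ξ]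

theorem norm_sq_le_nsq (ξ : E3) : ‖ξ‖ ^ 2 ≤ nsq ξ := by
  have h : ‖ξ‖ ≤ Real.sqrt (nsq ξ) := by
    refine (pi_norm_le_iff_of_nonneg (Real.sqrt_nonneg _)).2 fun j => ?_
    rw [Real.norm_eq_abs]
    refine Real.abs_le_sqrt ?_
    exact Finset.single_le_sum (f := fun i => ξ i ^ 2) (fun i _ => sq_nonneg _) (Finset.mem_univ j)
  calc ‖ξ‖ ^ 2 ≤ Real.sqrt (nsq ξ) ^ 2 := by gcongr
    _ = nsq ξ := Real.sq_sqrt (nsq_nonneg ξ)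

theorem nsq_le (ξ : E3) : nsq ξ ≤ 3 * ‖ξ‖ ^ 2 := by
  unfold nsq
  calc ∑ i, ξ i ^ 2 ≤ ∑ _i : Fin 3, ‖ξ‖ ^ 2 := by
        refine Finset.sum_le_sum fun i _ => ?_
        rw [← sq_abs]
        exact pow_le_pow_left₀ (abs_nonneg _) (norm_le_pi_norm ξ i) 2
    _ = 3 * ‖ξ‖ ^ 2 := by simp

theorem exists_bound_pow_mul_gauss (N : ℕ) {τ : ℝ} (hτ : 0 < τ) :
    ∃ C, 0 < C ∧ ∀ ξ, (1 + ‖ξ‖) ^ N * gauss τ ξ ≤ C := by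
  refine ⟨2 ^ N * (N.factorial * Real.exp τ / τ ^ N), by positivity, fun ξ => ?_⟩
  set n := ‖ξ‖ with hn
  have hn0 : 0 ≤ n := norm_nonneg ξ
  have h1 : (1 + n) ^ N ≤ 2 ^ N * (1 + n ^ 2) ^ N := by
    rw [← mul_pow]
    exact pow_le_pow_left₀ (by positivity) (by nlinarith [sq_nonneg (n - 1)]) N
  have h2 : (τ * (1 + n ^ 2)) ^ N ≤ N.factorial * Real.exp (τ * (1 + n ^ 2)) := by
    have := Real.pow_div_factorial_le_exp (x := τ * (1 + n ^ 2)) (by positivity) N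
    rw [div_le_iff₀ (by positivity)] at this
    linarith
  have h3 : (1 + n ^ 2) ^ N ≤ N.factorial * Real.exp τ / τ ^ N * Real.exp (τ * n ^ 2) := by
    rw [mul_pow, mul_add, mul_one, Real.exp_add] at h2
    rw [div_mul_eq_mul_div, le_div_iff₀ (by positivity)]
    linarith
  have h4 : gauss τ ξ ≤ Real.exp (-(τ * n ^ 2)) := by
    refine Real.exp_le_exp.2 ?_
    have := norm_sq_le_nsq ξ
    nlinarith
  calc (1 + n) ^ N * gauss τ ξ
      ≤ (2 ^ N * (N.factorial * Real.exp τ / τ ^ N * Real.exp (τ * n ^ 2)))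
          * Real.exp (-(τ * n ^ 2)) := by
        refine mul_le_mul (h1.trans (by gcongr)) h4 (gauss_pos _ _).le (by positivity)
    _ = 2 ^ N * (N.factorial * Real.exp τ / τ ^ N) := by
        rw [Real.exp_neg]; field_simp

/-- A function together with its first three derivatives in the direction `j`, where the `k`-th
derivative is bounded by `B ξ / ‖ξ‖ ^ k`. -/
structure Jet (j : Fin 3) (h : ℕ → E3 → ℝ) (B : E3 → ℝ) : Prop where
  deriv : ∀ k, k < 3 → ∀ ξ, HasLineDerivAt ℝ (h k) (h (k + 1) ξ) ξ (Pi.single j 1)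
  cont : ∀ k, k ≤ 3 → Continuous (h k)
  bound : ∀ k, k ≤ 3 → ∀ ξ, ‖ξ‖ ^ k * |h k ξ| ≤ B ξ

/-- The derivatives up to order three of a product. -/
def jetMul (h g : ℕ → E3 → ℝ) : ℕ → E3 → ℝ
  | 0 => fun ξ => h 0 ξ * g 0 ξ
  | 1 => fun ξ => h 1 ξ * g 0 ξ + h 0 ξ * g 1 ξ
  | 2 => fun ξ => h 2 ξ * g 0 ξ + 2 * (h 1 ξ * g 1 ξ) + h 0 ξ * g 2 ξ
  | _ => fun ξ => h 3 ξ * g 0 ξ + 3 * (h 2 ξ * g 1 ξ) + 3 * (h 1 ξ * g 2 ξ) + h 0 ξ * g 3 ξ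

theorem HasLineDerivAt.mul_real {f g : E3 → ℝ} {f' g' : ℝ} {ξ v : E3}
    (hf : HasLineDerivAt ℝ f f' ξ v) (hg : HasLineDerivAt ℝ g g' ξ v) :
    HasLineDerivAt ℝ (fun ξ => f ξ * g ξ) (f' * g ξ + f ξ * g') ξ v := by
  have h := HasDerivAt.mul (x := (0 : ℝ)) hf hg
  simpa only [zero_smul, add_zero] using! h

theorem Jet.mul {j : Fin 3} {h g : ℕ → E3 → ℝ} {B D : E3 → ℝ} (hh : Jet j h B) (hg : Jet j g D) :
    Jet j (jetMul h g) (fun ξ => 8 * (B ξ * D ξ)) := by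
  refine ⟨fun k hk ξ => ?_, fun k hk => ?_, fun k hk ξ => ?_⟩
  · have a0 := hh.deriv 0 (by norm_num) ξ
    have a1 := hh.deriv 1 (by norm_num) ξ
    have a2 := hh.deriv 2 (by norm_num) ξ
    have b0 := hg.deriv 0 (by norm_num) ξ
    have b1 := hg.deriv 1 (by norm_num) ξ
    have b2 := hg.deriv 2 (by norm_num) ξ
    interval_cases k
    · exact a0.mul_real b0
    · refine (HasDerivAt.add (a1.mul_real b0) (a0.mul_real b1)).congr_deriv ?_
      simp only [jetMul]; ring
    · refine (((a2.mul_real b0).add ((a1.mul_real b1).const_mul 2)).add (a0.mul_real b2)).congr_deriv ?_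
      simp only [jetMul]; ring
  · have a0 := hh.cont 0 (by norm_num)
    have a1 := hh.cont 1 (by norm_num)
    have a2 := hh.cont 2 (by norm_num)
    have a3 := hh.cont 3 (by norm_num)
    have b0 := hg.cont 0 (by norm_num)
    have b1 := hg.cont 1 (by norm_num)
    have b2 := hg.cont 2 (by norm_num)
    have b3 := hg.cont 3 (by norm_num)
    interval_cases k <;> simp only [jetMul] <;> fun_prop
  · have key : ∀ a b, a ≤ 3 → b ≤ 3 → a + b = k →
        ‖ξ‖ ^ k * |h a ξ * g b ξ| ≤ B ξ * D ξ := by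
      intro a b ha hb hab
      rw [← hab, pow_add, abs_mul]
      calc ‖ξ‖ ^ a * ‖ξ‖ ^ b * (|h a ξ| * |g b ξ|)
          = (‖ξ‖ ^ a * |h a ξ|) * (‖ξ‖ ^ b * |g b ξ|) := by ring
        _ ≤ B ξ * D ξ := mul_le_mul (hh.bound a ha ξ) (hg.bound b hb ξ) (by positivity)
            (le_trans (by positivity) (hh.bound a ha ξ))
    have hn : 0 ≤ ‖ξ‖ ^ k := by positivity
    have hBD : 0 ≤ B ξ * D ξ := mul_nonneg (le_trans (by positivity) (hh.bound 0 (by norm_num) ξ))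
      (le_trans (by positivity) (hg.bound 0 (by norm_num) ξ))
    interval_cases k
    · have := key 0 0 (by norm_num) (by norm_num) rfl
      simp only [jetMul]
      linarith
    · have k1 := key 1 0 (by norm_num) (by norm_num) rfl
      have k2 := key 0 1 (by norm_num) (by norm_num) rfl
      have := mul_le_mul_of_nonneg_left (abs_add_le (h 1 ξ * g 0 ξ) (h 0 ξ * g 1 ξ)) hn
      simp only [jetMul]
      linarith
    · have k1 := key 2 0 (by norm_num) (by norm_num) rfl
      have k2 := key 1 1 (by norm_num) (by norm_num) rfl
      have k3 := key 0 2 (by norm_num) (by norm_num) rfl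
      have := mul_le_mul_of_nonneg_left
        (abs_add_three (h 2 ξ * g 0 ξ) (2 * (h 1 ξ * g 1 ξ)) (h 0 ξ * g 2 ξ)) hn
      rw [abs_mul 2, abs_two] at this
      simp only [jetMul]
      linarith
    · have k1 := key 3 0 (by norm_num) (by norm_num) rfl
      have k2 := key 2 1 (by norm_num) (by norm_num) rfl
      have k3 := key 1 2 (by norm_num) (by norm_num) rfl
      have k4 := key 0 3 (by norm_num) (by norm_num) rfl
      have e1 := abs_add_three (h 3 ξ * g 0 ξ) (3 * (h 2 ξ * g 1 ξ)) (3 * (h 1 ξ * g 2 ξ))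
      have e2 := abs_add_le (h 3 ξ * g 0 ξ + 3 * (h 2 ξ * g 1 ξ) + 3 * (h 1 ξ * g 2 ξ)) (h 0 ξ * g 3 ξ)
      rw [abs_mul 3, abs_mul 3, abs_of_pos (by norm_num : (0 : ℝ) < 3)] at e1
      have := mul_le_mul_of_nonneg_left (e2.trans (add_le_add_left e1 _)) hn
      simp only [jetMul]
      linarith

theorem hasLineDerivAt_coord (i j : Fin 3) (ξ : E3) :
    HasLineDerivAt ℝ (fun ξ : E3 => ξ i) (if i = j then 1 else 0) ξ (Pi.single j 1) := by
  have h := (hasFDerivAt_apply (𝕜 := ℝ) i ξ).hasLineDerivAt (Pi.single j 1)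
  simpa [Pi.single_apply] using h

/-- The derivatives of the coordinate function `ξ_i` in the direction `j`. -/
def jetCoord (i j : Fin 3) : ℕ → E3 → ℝ
  | 0 => fun ξ => ξ i
  | 1 => fun _ => if i = j then 1 else 0
  | _ => fun _ => 0

theorem abs_coord_le (ξ : E3) (i : Fin 3) : |ξ i| ≤ ‖ξ‖ := norm_le_pi_norm ξ i

theorem jet_coord (i j : Fin 3) : Jet j (jetCoord i j) (fun ξ => ‖ξ‖) := by
  refine ⟨fun k hk ξ => ?_, fun k hk => ?_, fun k hk ξ => ?_⟩
  · interval_cases k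
    · exact hasLineDerivAt_coord i j ξ
    · exact hasDerivAt_const _ _
    · exact hasDerivAt_const _ _
  · interval_cases k <;> simp only [jetCoord] <;> fun_prop
  · interval_cases k
    · simpa [jetCoord] using abs_coord_le ξ i
    · simp only [jetCoord]; split_ifs <;> simp
    · simp [jetCoord]
    · simp [jetCoord]

/-- The derivatives of `|ξ|²` in the direction `j`. -/
def jetNsq (j : Fin 3) : ℕ → E3 → ℝ
  | 0 => nsq
  | 1 => fun ξ => 2 * ξ j
  | 2 => fun _ => 2
  | _ => fun _ => 0

theorem hasLineDerivAt_nsq (j : Fin 3) (ξ : E3) :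
    HasLineDerivAt ℝ nsq (2 * ξ j) ξ (Pi.single j 1) := by
  have h : HasDerivAt (fun t : ℝ => ∑ i, (ξ + t • (Pi.single j 1 : E3)) i ^ 2)
      (∑ i, 2 * ξ i * (if i = j then 1 else 0)) 0 := by
    refine HasDerivAt.fun_sum fun i _ => ?_
    have h1 := HasDerivAt.pow (hasLineDerivAt_coord i j ξ : HasDerivAt _ _ (0 : ℝ)) 2
    simpa using! h1
  refine HasDerivAt.congr_deriv h ?_
  simp

theorem jet_nsq (j : Fin 3) : Jet j (jetNsq j) (fun ξ => 3 * ‖ξ‖ ^ 2) := by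
  refine ⟨fun k hk ξ => ?_, fun k hk => ?_, fun k hk ξ => ?_⟩
  · interval_cases k
    · exact hasLineDerivAt_nsq j ξ
    · refine ((hasLineDerivAt_coord j j ξ).const_mul (2 : ℝ)).congr_deriv ?_
      simp [jetNsq]
    · exact hasDerivAt_const _ _
  · interval_cases k <;> simp only [jetNsq] <;> fun_prop
  · have := sq_nonneg ‖ξ‖
    interval_cases k
    · simp only [jetNsq, pow_zero, one_mul, abs_of_nonneg (nsq_nonneg ξ)]
      exact nsq_le ξ
    · simp only [jetNsq, pow_one, abs_mul, abs_two]
      nlinarith [abs_coord_le ξ j, norm_nonneg ξ]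
    · simp only [jetNsq, abs_two]; nlinarith
    · simp only [jetNsq, abs_zero]; nlinarith

/-- The derivatives of `e^{-|ξ|²}` in the direction `j`. -/
def jetGauss (j : Fin 3) : ℕ → E3 → ℝ
  | 0 => gauss 1
  | 1 => fun ξ => -2 * ξ j * gauss 1 ξ
  | 2 => fun ξ => (4 * ξ j ^ 2 - 2) * gauss 1 ξ
  | _ => fun ξ => (-8 * ξ j ^ 3 + 12 * ξ j) * gauss 1 ξ

theorem hasLineDerivAt_gauss (j : Fin 3) (ξ : E3) :
    HasLineDerivAt ℝ (gauss 1) (-2 * ξ j * gauss 1 ξ) ξ (Pi.single j 1) := by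
  have h1 : HasDerivAt (fun t : ℝ => nsq (ξ + t • (Pi.single j 1 : E3))) (2 * ξ j) 0 :=
    hasLineDerivAt_nsq j ξ
  have h := (h1.const_mul (-1)).exp
  refine HasDerivAt.congr_deriv h ?_
  simp only [zero_smul, add_zero, gauss]
  ring

theorem hasLineDerivAt_coord_self (j : Fin 3) (ξ : E3) :
    HasLineDerivAt ℝ (fun ξ : E3 => ξ j) 1 ξ (Pi.single j 1) := by
  simpa using hasLineDerivAt_coord j j ξ

theorem jet_gauss (j : Fin 3) : Jet j (jetGauss j) (fun ξ => 20 * ((1 + ‖ξ‖) ^ 6 * gauss 1 ξ)) := by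
  refine ⟨fun k hk ξ => ?_, fun k hk => ?_, fun k hk ξ => ?_⟩
  · have hc := hasLineDerivAt_coord_self j ξ
    have hg := hasLineDerivAt_gauss j ξ
    interval_cases k
    · exact hg
    · have h1 : HasLineDerivAt ℝ (fun ξ : E3 => -2 * ξ j) (-2) ξ (Pi.single j 1) :=
        (hc.const_mul (-2 : ℝ)).congr_deriv (by ring)
      refine (h1.mul_real hg).congr_deriv ?_
      simp only [jetGauss]; ring
    · have h1 : HasLineDerivAt ℝ (fun ξ : E3 => 4 * ξ j ^ 2 - 2) (8 * ξ j) ξ (Pi.single j 1) := by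
        refine (((hc.pow 2).const_mul (4 : ℝ)).sub_const 2).congr_deriv ?_
        simp; ring
      refine (h1.mul_real hg).congr_deriv ?_
      simp only [jetGauss]; ring
  · interval_cases k <;> simp only [jetGauss] <;> fun_prop
  · have hg := (gauss_pos 1 ξ).le
    set n := ‖ξ‖ with hn
    have hn0 : 0 ≤ n := norm_nonneg ξ
    have hx := abs_coord_le ξ j
    set x := |ξ j| with hxd
    have hx0 : 0 ≤ x := abs_nonneg _
    have h6 : ∀ i ≤ 6, n ^ i ≤ (1 + n) ^ 6 := fun i hi =>
      (pow_le_pow_left₀ hn0 (by linarith) i).trans (pow_le_pow_right₀ (by linarith) hi)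
    suffices h : ∃ y, |jetGauss j k ξ| ≤ y * gauss 1 ξ ∧ n ^ k * y ≤ 20 * (1 + n) ^ 6 by
      obtain ⟨y, h1, h2⟩ := h
      calc n ^ k * |jetGauss j k ξ| ≤ n ^ k * (y * gauss 1 ξ) := by gcongr
        _ = (n ^ k * y) * gauss 1 ξ := by ring
        _ ≤ 20 * (1 + n) ^ 6 * gauss 1 ξ := by gcongr
        _ = _ := by ring
    have p2 := h6 2 (by norm_num)
    have p4 := h6 4 (by norm_num)
    have p6 := h6 6 (by norm_num)
    have p0 := h6 0 (by norm_num)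
    interval_cases k
    · exact ⟨1, by simp [jetGauss, abs_of_nonneg hg], by linarith⟩
    · refine ⟨2 * n, ?_, by nlinarith⟩
      simp only [jetGauss, abs_mul, abs_of_nonneg hg, abs_neg, abs_two]
      gcongr
    · refine ⟨4 * n ^ 2 + 2, ?_, by nlinarith⟩
      simp only [jetGauss, abs_mul, abs_of_nonneg hg]
      gcongr
      refine (abs_sub _ _).trans ?_
      rw [abs_mul, abs_pow, ← hxd, abs_two, abs_of_pos (by norm_num : (0 : ℝ) < 4)]
      gcongr
    · refine ⟨8 * n ^ 3 + 12 * n, ?_, by nlinarith⟩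
      simp only [jetGauss, abs_mul, abs_of_nonneg hg]
      gcongr
      refine (abs_add_le _ _).trans ?_
      rw [abs_mul, abs_mul, abs_pow, ← hxd, abs_neg, abs_of_pos (by norm_num : (0 : ℝ) < 8),
        abs_of_pos (by norm_num : (0 : ℝ) < 12)]
      gcongr

theorem ContDiff.pds {m : E3 → ℝ} (hm : ContDiff ℝ (⊤ : ℕ∞) m) (l : List (Fin 3)) :
    ContDiff ℝ (⊤ : ℕ∞) (pds l m) := by
  induction l with
  | nil => exact hm
  | cons j l ih =>
    refine ContDiff.pd ?_ j
    exact ih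

theorem SymbolOrder0.exists_bound {m : E3 → ℝ} (hm : SymbolOrder0 m) (l : List (Fin 3)) :
    ∃ C, 0 ≤ C ∧ ∀ ξ, ‖ξ‖ ^ l.length * |pds l m ξ| ≤ C := by
  obtain ⟨C, hC⟩ := hm.2 l
  have hC0 : 0 ≤ C := by
    have := (abs_nonneg _).trans (hC 0)
    simpa using this
  refine ⟨C, hC0, fun ξ => ?_⟩
  have hn := norm_nonneg ξ
  have h1 : |pds l m ξ| ≤ C / (1 + ‖ξ‖) ^ l.length := by
    have := hC ξ
    rwa [Real.rpow_neg (by positivity), Real.rpow_natCast, ← div_eq_mul_inv] at this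
  calc ‖ξ‖ ^ l.length * |pds l m ξ| ≤ (1 + ‖ξ‖) ^ l.length * (C / (1 + ‖ξ‖) ^ l.length) := by
        gcongr; linarith
    _ = C := by field_simp

/-- The derivatives of the rescaled symbol `m(sξ)` in the direction `j`. -/
def jetSymbol (m : E3 → ℝ) (s : ℝ) (j : Fin 3) (k : ℕ) (ξ : E3) : ℝ :=
  s ^ k * pds (List.replicate k j) m (s • ξ)

theorem jet_symbol {m : E3 → ℝ} (hm : SymbolOrder0 m) (j : Fin 3) :
    ∃ C, 0 ≤ C ∧ ∀ s, 0 ≤ s → Jet j (jetSymbol m s j) (fun _ => C) := by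
  choose C hC0 hC using fun k => hm.exists_bound (List.replicate k j)
  refine ⟨C 0 + C 1 + C 2 + C 3, by linarith [hC0 0, hC0 1, hC0 2, hC0 3], fun s hs =>
    ⟨fun k hk ξ => ?_, fun k hk => ?_, fun k hk ξ => ?_⟩⟩
  · have hd : DifferentiableAt ℝ (pds (List.replicate k j) m) (s • ξ) :=
      ((ContDiff.pds hm.1 _).differentiable (by simp)) _
    have h2 : HasFDerivAt (fun ξ : E3 => s • ξ) (s • ContinuousLinearMap.id ℝ E3) ξ :=
      (hasFDerivAt_id ξ).const_smul s
    have h3 := ((hd.hasFDerivAt.comp ξ h2).const_mul (s ^ k)).hasLineDerivAt (Pi.single j 1)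
    refine HasDerivAt.congr_deriv h3 ?_
    simp only [jetSymbol, List.replicate_succ, pds, pd, pow_succ]
    simp
    ring
  · unfold jetSymbol
    have := (ContDiff.pds hm.1 (List.replicate k j)).continuous
    fun_prop
  · have h := hC k (s • ξ)
    have e : ‖ξ‖ ^ k * |jetSymbol m s j k ξ| = ‖s • ξ‖ ^ (List.replicate k j).length
        * |pds (List.replicate k j) m (s • ξ)| := by
      rw [jetSymbol, abs_mul, abs_pow, abs_of_nonneg hs, norm_smul, Real.norm_of_nonneg hs, mul_pow,
        List.length_replicate]
      ring
    rw [e]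
    have : C k ≤ C 0 + C 1 + C 2 + C 3 := by
      interval_cases k <;> linarith [hC0 0, hC0 1, hC0 2, hC0 3]
    exact h.trans this

/-- The rescaled regularized symbol `ξ₀ |ξ|² m(sξ) e^{-|ξ|²}`. -/
def kap (m : E3 → ℝ) (s : ℝ) (ξ : E3) : ℝ :=
  ξ 0 * (nsq ξ * (m (s • ξ) * gauss 1 ξ))

/-- The derivatives of `kap m s` in the direction `j`. -/
def jetKap (m : E3 → ℝ) (s : ℝ) (j : Fin 3) : ℕ → E3 → ℝ :=
  jetMul (jetCoord 0 j) (jetMul (jetNsq j) (jetMul (jetSymbol m s j) (jetGauss j)))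

theorem jetKap_zero (m : E3 → ℝ) (s : ℝ) (j : Fin 3) : jetKap m s j 0 = kap m s := by
  funext ξ
  simp [jetKap, jetMul, jetCoord, jetNsq, jetSymbol, jetGauss, kap, pds]

theorem jetKap_bound {m : E3 → ℝ} (hm : SymbolOrder0 m) :
    ∃ C, 0 ≤ C ∧ ∀ s, 0 ≤ s → ∀ j, (∀ k, k < 3 → ∀ ξ, HasLineDerivAt ℝ (jetKap m s j k)
        (jetKap m s j (k + 1) ξ) ξ (Pi.single j 1)) ∧
      ∀ k, k ≤ 3 → Continuous (jetKap m s j k) ∧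
        ∀ ξ, |jetKap m s j k ξ| ≤ C * (1 + ‖ξ‖) ^ (-(4 : ℝ)) := by
  choose C hC0 hC using fun j => jet_symbol hm j
  obtain ⟨G, hG0, hG⟩ := exists_bound_pow_mul_gauss 13 one_pos
  have hCs : ∀ j, C j ≤ ∑ j, C j := fun j =>
    Finset.single_le_sum (f := C) (fun i _ => hC0 i) (Finset.mem_univ j)
  set D := ∑ j, C j
  have hD0 : 0 ≤ D := Finset.sum_nonneg fun i _ => hC0 i
  refine ⟨30720 * D * G, by positivity, fun s hs j => ?_⟩
  have hj := (jet_coord 0 j).mul ((jet_nsq j).mul ((hC j s hs).mul (jet_gauss j)))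
  refine ⟨hj.deriv, fun k hk => ⟨hj.cont k hk, fun ξ => ?_⟩⟩
  have hw : Continuous fun ξ : E3 => 30720 * D * G * (1 + ‖ξ‖) ^ (-(4 : ℝ)) := by
    refine continuous_const.mul (Continuous.rpow_const (by fun_prop) fun ξ => Or.inl ?_)
    positivity
  have hcl : IsClosed {ξ : E3 | |jetKap m s j k ξ| ≤ 30720 * D * G * (1 + ‖ξ‖) ^ (-(4 : ℝ))} :=
    isClosed_le (hj.cont k hk).abs hw
  have hsub : ({0}ᶜ : Set E3) ⊆
      {ξ : E3 | |jetKap m s j k ξ| ≤ 30720 * D * G * (1 + ‖ξ‖) ^ (-(4 : ℝ))} := by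
    intro ξ hξ
    have hn : 0 < ‖ξ‖ := norm_pos_iff.2 hξ
    have hb := hj.bound k hk ξ
    change ‖ξ‖ ^ k * |jetKap m s j k ξ| ≤ _ at hb
    simp only [Set.mem_ofPred_eq]
    rw [Real.rpow_neg (by positivity), ← div_eq_mul_inv, le_div_iff₀ (by positivity),
      show (4 : ℝ) = ((4 : ℕ) : ℝ) by norm_num, Real.rpow_natCast]
    have hg := (gauss_pos 1 ξ).le
    refine le_of_mul_le_mul_left ?_ (pow_pos hn k)
    have hk3 : ‖ξ‖ ^ (3 - k) ≤ (1 + ‖ξ‖) ^ 3 :=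
      (pow_le_pow_left₀ hn.le (by linarith) _).trans
        (pow_le_pow_right₀ (by linarith) (by omega))
    calc ‖ξ‖ ^ k * (|jetKap m s j k ξ| * (1 + ‖ξ‖) ^ 4)
        = ‖ξ‖ ^ k * |jetKap m s j k ξ| * (1 + ‖ξ‖) ^ 4 := by ring
      _ ≤ _ * (1 + ‖ξ‖) ^ 4 := mul_le_mul_of_nonneg_right hb (by positivity)
      _ = 30720 * C j * (‖ξ‖ ^ 3 * ((1 + ‖ξ‖) ^ 10 * gauss 1 ξ)) := by ring
      _ = 30720 * C j * (‖ξ‖ ^ k * ‖ξ‖ ^ (3 - k) * ((1 + ‖ξ‖) ^ 10 * gauss 1 ξ)) := by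
          rw [← pow_add, Nat.add_sub_cancel' hk]
      _ ≤ 30720 * D * (‖ξ‖ ^ k * (1 + ‖ξ‖) ^ 3 * ((1 + ‖ξ‖) ^ 10 * gauss 1 ξ)) := by
          gcongr; exact hCs j
      _ = 30720 * D * ‖ξ‖ ^ k * ((1 + ‖ξ‖) ^ 13 * gauss 1 ξ) := by ring
      _ ≤ 30720 * D * ‖ξ‖ ^ k * G := by gcongr; exact hG ξ
      _ = _ := by ring
  have := (hcl.closure_subset_iff.2 hsub)
  rw [(dense_compl_singleton (0 : E3)).closure_eq] at this
  exact this (Set.mem_univ ξ)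

theorem one_add_norm_rpow_le_one (ξ : E3) : (1 + ‖ξ‖) ^ (-(4 : ℝ)) ≤ 1 :=
  Real.rpow_le_one_of_one_le_of_nonpos (by linarith [norm_nonneg ξ]) (by norm_num)

theorem L12.ofReal_of_weight {h : E3 → ℝ} (hc : Continuous h) {C : ℝ} (hC0 : 0 ≤ C)
    (hC : ∀ ξ, |h ξ| ≤ C * (1 + ‖ξ‖) ^ (-(4 : ℝ))) :
    L12 (fun ξ => (h ξ : ℂ)) ∧ ∫ ξ, ‖(h ξ : ℂ)‖ ^ 2 ≤
      C ^ 2 * ∫ ξ : E3, (1 + ‖ξ‖) ^ (-(4 : ℝ)) := by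
  have h1 : L12 (fun ξ => (h ξ : ℂ)) := by
    refine L12.of_bound (C := C) ?_ fun ξ => ?_
    · refine (integrable_weight.const_mul C).mono
        (Complex.continuous_ofReal.comp hc).aestronglyMeasurable (Eventually.of_forall fun ξ => ?_)
      rw [Complex.norm_real, Real.norm_eq_abs]
      exact (hC ξ).trans (le_abs_self _)
    · rw [Complex.norm_real, Real.norm_eq_abs]
      exact (hC ξ).trans (mul_le_of_le_one_right hC0 (one_add_norm_rpow_le_one ξ))
  refine ⟨h1, ?_⟩
  rw [← integral_const_mul]
  refine integral_mono h1.integrable_sq (integrable_weight.const_mul _) fun ξ => ?_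
  have hw := one_add_norm_rpow_le_one ξ
  have hw0 : 0 ≤ (1 + ‖ξ‖) ^ (-(4 : ℝ)) := by positivity
  simp only [Complex.norm_real, Real.norm_eq_abs]
  calc |h ξ| ^ 2 ≤ (C * (1 + ‖ξ‖) ^ (-(4 : ℝ))) ^ 2 := by gcongr; exact hC ξ
    _ = C ^ 2 * ((1 + ‖ξ‖) ^ (-(4 : ℝ)) * (1 + ‖ξ‖) ^ (-(4 : ℝ))) := by ring
    _ ≤ C ^ 2 * (1 * (1 + ‖ξ‖) ^ (-(4 : ℝ))) := by gcongr
    _ = _ := by ring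

theorem exists_kernel_bound {m : E3 → ℝ} (hm : SymbolOrder0 m) :
    ∃ C, 0 ≤ C ∧ ∀ s, 0 ≤ s → Continuous (kap m s) ∧ L12 (fun ξ => (kap m s ξ : ℂ)) ∧
      Integrable (fun y => (1 + ‖y‖) * ‖IF (fun ξ => (kap m s ξ : ℂ)) y‖) ∧
      ∫ y, (1 + ‖y‖) * ‖IF (fun ξ => (kap m s ξ : ℂ)) y‖ ≤ C := by
  obtain ⟨D, hD0, hD⟩ := jetKap_bound hm
  set W := ∫ ξ : E3, (1 + ‖ξ‖) ^ (-(4 : ℝ))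
  have hW : 0 ≤ W := integral_nonneg fun ξ => by positivity
  refine ⟨W + 64 * (D ^ 2 * W + 3 * (D ^ 2 * W)), by positivity, fun s hs => ?_⟩
  have hL : ∀ j k, k ≤ 3 → L12 (fun ξ => (jetKap m s j k ξ : ℂ)) ∧
      ∫ ξ, ‖(jetKap m s j k ξ : ℂ)‖ ^ 2 ≤ D ^ 2 * W := fun j k hk =>
    L12.ofReal_of_weight ((hD s hs j).2 k hk).1 hD0 ((hD s hs j).2 k hk).2
  have h0 := hL 0 0 (by norm_num)
  rw [jetKap_zero] at h0
  have hc := ((hD s hs 0).2 0 (by norm_num)).1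
  rw [jetKap_zero] at hc
  have hstep : ∀ j k, k < 3 → ∀ y, IF (fun ξ => (jetKap m s j (k + 1) ξ : ℂ)) y =
      -(Complex.I * y j) * IF (fun ξ => (jetKap m s j k ξ : ℂ)) y := by
    intro j k hk y
    refine IF_lineDeriv j (hL j k hk.le).1.int (hL j (k + 1) hk).1.int (fun ξ => ?_) y
    exact HasDerivAt.ofReal_comp ((hD s hs j).1 k hk ξ)
  have h3 : ∀ j, (fun y : E3 => (y j ^ 3 * ‖IF (fun ξ => (kap m s ξ : ℂ)) y‖) ^ 2) =
      fun y => ‖IF (fun ξ => (jetKap m s j 3 ξ : ℂ)) y‖ ^ 2 := by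
    intro j
    funext y
    rw [hstep j 2 (by norm_num), hstep j 1 (by norm_num), hstep j 0 (by norm_num), jetKap_zero]
    simp only [norm_mul, norm_neg, Complex.norm_I, Complex.norm_real, Real.norm_eq_abs, one_mul,
      mul_pow, sq_abs]
    ring
  obtain ⟨r1, r2⟩ := integrable_weight_mul (X := IF (fun ξ => (kap m s ξ : ℂ)))
    (continuous_IF h0.1.int).aestronglyMeasurable (integrable_norm_sq_IF h0.1)
    (fun j => by
      rw [h3 j]
      exact integrable_norm_sq_IF (hL j 3 le_rfl).1)
  refine ⟨hc, h0.1, r1, r2.trans ?_⟩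
  rw [integral_norm_sq_IF h0.1]
  have e3 : ∑ j : Fin 3, ∫ y : E3, (y j ^ 3 * ‖IF (fun ξ => (kap m s ξ : ℂ)) y‖) ^ 2
      ≤ ∑ _j : Fin 3, D ^ 2 * W := by
    refine Finset.sum_le_sum fun j _ => ?_
    rw [h3 j, integral_norm_sq_IF (hL j 3 le_rfl).1]
    exact (hL j 3 le_rfl).2
  have e3' : ∑ _j : Fin 3, D ^ 2 * W = 3 * (D ^ 2 * W) := by simp
  rw [e3'] at e3
  have := h0.2
  gcongr

/-- The symbol `ξ₀ m(ξ)` of order one. -/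
def rsym (m : E3 → ℝ) (ξ : E3) : ℝ := ξ 0 * m ξ

theorem exp_two_mul_bound {x : ℝ} (hx : 0 ≤ x) : x ^ 2 ≤ 2 * Real.exp x ∧ 1 + x ≤ Real.exp x := by
  have h := Real.quadratic_le_exp_of_nonneg hx
  constructor <;> nlinarith

theorem mul_nsq_mul_gauss_le {τ : ℝ} (hτ : 0 ≤ τ) (ξ : E3) : τ * nsq ξ * gauss τ ξ ≤ 1 := by
  have hx : 0 ≤ τ * nsq ξ := mul_nonneg hτ (nsq_nonneg ξ)
  have h := (exp_two_mul_bound hx).2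
  have e : gauss τ ξ = (Real.exp (τ * nsq ξ))⁻¹ := by rw [← Real.exp_neg, gauss, neg_mul]
  rw [e, ← div_eq_mul_inv, div_le_one (Real.exp_pos _)]
  linarith

/-- A quadratic in `τ|ξ|²` costs a single Gaussian factor. -/
theorem quadratic_mul_gauss_le {τ : ℝ} (hτ : 0 ≤ τ) (ξ : E3) {a b c D : ℝ} (ha : |a| ≤ D)
    (hb : |b| ≤ D) (hc : 2 * |c| ≤ D) :
    |a + b * (τ * nsq ξ) + c * (τ * nsq ξ) ^ 2| * gauss τ ξ ≤ D := by
  have hx : 0 ≤ τ * nsq ξ := mul_nonneg hτ (nsq_nonneg ξ)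
  have h := Real.quadratic_le_exp_of_nonneg hx
  have e : gauss τ ξ = (Real.exp (τ * nsq ξ))⁻¹ := by rw [← Real.exp_neg, gauss, neg_mul]
  have hD : 0 ≤ D := (abs_nonneg a).trans ha
  rw [e, ← div_eq_mul_inv, div_le_iff₀ (Real.exp_pos _)]
  set x := τ * nsq ξ
  calc |a + b * x + c * x ^ 2| ≤ |a| + |b| * x + |c| * x ^ 2 := by
        refine (abs_add_three _ _ _).trans ?_
        rw [abs_mul b x, abs_mul c (x ^ 2), abs_of_nonneg hx, abs_of_nonneg (sq_nonneg x)]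
    _ ≤ D + D * x + D / 2 * x ^ 2 := by gcongr; linarith
    _ = D * (1 + x + x ^ 2 / 2) := by ring
    _ ≤ D * Real.exp x := by gcongr

theorem SymbolOrder0.continuous {m : E3 → ℝ} (hm : SymbolOrder0 m) : Continuous m :=
  hm.1.continuous

theorem SymbolOrder0.continuous_rsym {m : E3 → ℝ} (hm : SymbolOrder0 m) : Continuous (rsym m) := by
  have := hm.continuous
  unfold rsym
  fun_prop

theorem SymbolOrder0.exists_bound_self {m : E3 → ℝ} (hm : SymbolOrder0 m) :
    ∃ C, 0 ≤ C ∧ ∀ ξ, |m ξ| ≤ C := by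
  obtain ⟨C, hC0, hC⟩ := hm.exists_bound []
  exact ⟨C, hC0, fun ξ => by simpa [pds] using hC ξ⟩

theorem coord_sq_le_nsq (ξ : E3) (j : Fin 3) : ξ j ^ 2 ≤ nsq ξ :=
  Finset.single_le_sum (f := fun i => ξ i ^ 2) (fun _ _ => sq_nonneg _) (Finset.mem_univ j)

/-- The weight `ξ₀ m(ξ) (a + b τ|ξ|² + c τ²|ξ|⁴) e^{-2τ|ξ|²}`. -/
def quadWt (m : E3 → ℝ) (a b c τ : ℝ) (ξ : E3) : ℝ :=
  rsym m ξ * ((a + b * (τ * nsq ξ) + c * (τ * nsq ξ) ^ 2) * gauss τ ξ ^ 2)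

theorem continuous_quadWt {m : E3 → ℝ} (hm : SymbolOrder0 m) (a b c τ : ℝ) :
    Continuous (quadWt m a b c τ) := by
  have := hm.continuous_rsym
  unfold quadWt
  fun_prop

theorem abs_quadWt_le {m : E3 → ℝ} {M : ℝ} (hM : ∀ ξ, |m ξ| ≤ M) {τ : ℝ} (hτ : 0 ≤ τ) (ξ : E3)
    {a b c D : ℝ} (ha : |a| ≤ D) (hb : |b| ≤ D) (hc : 2 * |c| ≤ D) :
    |quadWt m a b c τ ξ| ≤ M * D * (|ξ 0| * gauss τ ξ) := by
  have h := quadratic_mul_gauss_le hτ ξ ha hb hc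
  have hg := (gauss_pos τ ξ).le
  have hD : 0 ≤ D := (abs_nonneg a).trans ha
  have hM0 : 0 ≤ M := (abs_nonneg _).trans (hM ξ)
  unfold quadWt rsym
  rw [abs_mul, abs_mul, abs_mul, abs_of_nonneg (pow_nonneg hg 2)]
  calc |ξ 0| * |m ξ| * (|a + b * (τ * nsq ξ) + c * (τ * nsq ξ) ^ 2| * gauss τ ξ ^ 2)
      = |ξ 0| * |m ξ| * ((|a + b * (τ * nsq ξ) + c * (τ * nsq ξ) ^ 2| * gauss τ ξ) * gauss τ ξ) := by
        ring
    _ ≤ |ξ 0| * M * (D * gauss τ ξ) := by gcongr; exact hM ξ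
    _ = _ := by ring

theorem hasDerivAt_gauss_param (τ : ℝ) (ξ : E3) :
    HasDerivAt (fun τ => gauss τ ξ) (-nsq ξ * gauss τ ξ) τ := by
  have h := ((hasDerivAt_id τ).neg.mul_const (nsq ξ)).exp
  refine h.congr_deriv ?_
  simp [gauss]; ring

theorem hasDerivAt_quadWt (m : E3 → ℝ) (a b c τ : ℝ) (ξ : E3) :
    HasDerivAt (fun τ => quadWt m a b c τ ξ)
      (rsym m ξ * ((b * nsq ξ + c * (2 * τ * nsq ξ ^ 2)) * gauss τ ξ ^ 2
        - 2 * nsq ξ * ((a + b * (τ * nsq ξ) + c * (τ * nsq ξ) ^ 2) * gauss τ ξ ^ 2))) τ := by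
  have hx : HasDerivAt (fun τ : ℝ => τ * nsq ξ) (nsq ξ) τ := by
    simpa using (hasDerivAt_id τ).mul_const (nsq ξ)
  have hq := ((hx.const_mul b).const_add a).add ((hx.pow 2).const_mul c)
  have h := (hq.mul ((hasDerivAt_gauss_param τ ξ).pow 2)).const_mul (rsym m ξ)
  refine h.congr_deriv ?_
  simp only [Pi.add_apply, Pi.pow_apply, Nat.cast_ofNat, Nat.reduceSub, pow_one]
  ring

/-- The Gaussian regularization of `ξ₀ m(ξ) - η₀ m(η)`, `η = ζ + ξ`. -/
def regKer (m : E3 → ℝ) (τ : ℝ) (p : E3 × E3) : ℝ :=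
  gauss τ p.1 * quadWt m 1 3 (9 / 2) τ p.2 * gauss τ (p.1 + p.2)
    - gauss τ p.1 * gauss τ p.2 * quadWt m 1 3 (9 / 2) τ (p.1 + p.2)

/-- The derivative of `regKer` in the parameter `τ`. -/
def regKer' (m : E3 → ℝ) (τ : ℝ) (p : E3 × E3) : ℝ :=
  -(∑ j, p.1 j * gauss τ p.1 * quadWt m 2 6 (-18) τ p.2 * ((p.1 + p.2) j * gauss τ (p.1 + p.2)))
  - (∑ j, p.1 j * gauss τ p.1 * (p.2 j * gauss τ p.2) * quadWt m 2 6 (-18) τ (p.1 + p.2))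
  + (nsq p.1 * gauss τ p.1 * gauss τ p.2 * quadWt m 0 0 (27 / 2) τ (p.1 + p.2)
  - nsq p.1 * gauss τ p.1 * quadWt m 0 0 (27 / 2) τ p.2 * gauss τ (p.1 + p.2))
  + (gauss τ p.1 * (nsq p.2 * gauss τ p.2) * quadWt m 0 0 (27 / 2) τ (p.1 + p.2)
  - gauss τ p.1 * quadWt m 0 0 (27 / 2) τ p.2 * (nsq (p.1 + p.2) * gauss τ (p.1 + p.2)))

theorem nsq_add (ζ ξ : E3) : nsq (ζ + ξ) = nsq ζ + nsq ξ + 2 * ∑ j, ζ j * ξ j := by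
  unfold nsq
  rw [Finset.mul_sum, ← Finset.sum_add_distrib, ← Finset.sum_add_distrib]
  exact Finset.sum_congr rfl fun j _ => by simp only [Pi.add_apply]; ring

theorem hasDerivAt_regKer (m : E3 → ℝ) (τ : ℝ) (p : E3 × E3) :
    HasDerivAt (fun τ => regKer m τ p) (regKer' m τ p) τ := by
  obtain ⟨ζ, ξ⟩ := p
  have h := (((hasDerivAt_gauss_param τ ζ).mul (hasDerivAt_quadWt m 1 3 (9 / 2) τ ξ)).mul
    (hasDerivAt_gauss_param τ (ζ + ξ))).sub
    (((hasDerivAt_gauss_param τ ζ).mul (hasDerivAt_gauss_param τ ξ)).mul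
      (hasDerivAt_quadWt m 1 3 (9 / 2) τ (ζ + ξ)))
  refine HasDerivAt.congr_deriv h ?_
  have s1 : ∑ j, ζ j * gauss τ ζ * quadWt m 2 6 (-18) τ ξ * ((ζ + ξ) j * gauss τ (ζ + ξ))
      = (nsq ζ + ∑ j, ζ j * ξ j) * (gauss τ ζ * quadWt m 2 6 (-18) τ ξ * gauss τ (ζ + ξ)) := by
    unfold nsq
    rw [← Finset.sum_add_distrib, Finset.sum_mul]
    exact Finset.sum_congr rfl fun j _ => by simp only [Pi.add_apply]; ring
  have s2 : ∑ j, ζ j * gauss τ ζ * (ξ j * gauss τ ξ) * quadWt m 2 6 (-18) τ (ζ + ξ)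
      = (∑ j, ζ j * ξ j) * (gauss τ ζ * gauss τ ξ * quadWt m 2 6 (-18) τ (ζ + ξ)) := by
    rw [Finset.sum_mul]
    exact Finset.sum_congr rfl fun j _ => by ring
  have hY := nsq_add ζ ξ
  simp only [regKer']
  rw [s1, s2]
  simp only [quadWt, Pi.mul_apply]
  generalize gauss τ (ζ + ξ) = eY at *
  generalize gauss τ ζ = eZ at *
  generalize gauss τ ξ = eX at *
  generalize rsym m ξ = rX at *
  generalize rsym m (ζ + ξ) = rY at *
  generalize nsq (ζ + ξ) = Y at *
  generalize ∑ j, ζ j * ξ j = D at *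
  generalize nsq ζ = Z at *
  generalize nsq ξ = X at *
  have hD : D = (Y - Z - X) / 2 := by linarith
  subst hD
  ring

theorem nsq_mul_gauss_le {τ : ℝ} (hτ : 0 < τ) (ξ : E3) : nsq ξ * gauss τ ξ ≤ 1 / τ := by
  rw [le_div_iff₀ hτ]
  linarith [mul_nsq_mul_gauss_le hτ.le ξ]

theorem coord_mul_gauss_le {τ : ℝ} (hτ : 0 < τ) (ξ : E3) (j : Fin 3) :
    |ξ j| * gauss τ ξ ≤ 1 + 1 / τ := by
  have h1 := nsq_mul_gauss_le hτ ξ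
  have h2 := gauss_le_one hτ.le ξ
  have h3 : |ξ j| ≤ 1 + nsq ξ := by
    have := coord_sq_le_nsq ξ j
    nlinarith [sq_abs (ξ j), abs_nonneg (ξ j), sq_nonneg (|ξ j| - 1)]
  have := mul_le_mul_of_nonneg_right h3 (gauss_pos τ ξ).le
  linarith

theorem abs_mul_three_le {x y z L Q : ℝ} (hx : |x| ≤ L) (hy : |y| ≤ L) (hz : |z| ≤ Q) :
    |x * y * z| ≤ L * L * Q := by
  have hL := (abs_nonneg x).trans hx
  rw [abs_mul, abs_mul]
  gcongr

theorem abs_quadWt_le_const {m : E3 → ℝ} {M : ℝ} (hM : ∀ ξ, |m ξ| ≤ M) {τ : ℝ} (hτ : 0 < τ)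
    (ξ : E3) {a b c D : ℝ} (ha : |a| ≤ D) (hb : |b| ≤ D) (hc : 2 * |c| ≤ D) :
    |quadWt m a b c τ ξ| ≤ M * D * (1 + 1 / τ) := by
  have hM0 : 0 ≤ M := (abs_nonneg _).trans (hM ξ)
  have hD : 0 ≤ D := (abs_nonneg a).trans ha
  exact (abs_quadWt_le hM hτ.le ξ ha hb hc).trans
    (mul_le_mul_of_nonneg_left (coord_mul_gauss_le hτ ξ 0) (by positivity))

theorem abs_quadWt_le_norm {m : E3 → ℝ} {M : ℝ} (hM : ∀ ξ, |m ξ| ≤ M) {τ : ℝ} (hτ : 0 ≤ τ)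
    (ξ : E3) {a b c D : ℝ} (ha : |a| ≤ D) (hb : |b| ≤ D) (hc : 2 * |c| ≤ D) :
    |quadWt m a b c τ ξ| ≤ M * D * ‖ξ‖ := by
  have hM0 : 0 ≤ M := (abs_nonneg _).trans (hM ξ)
  have hD : 0 ≤ D := (abs_nonneg a).trans ha
  refine (abs_quadWt_le hM hτ ξ ha hb hc).trans
    (mul_le_mul_of_nonneg_left ?_ (by positivity))
  calc |ξ 0| * gauss τ ξ ≤ ‖ξ‖ * 1 :=
        mul_le_mul (abs_coord_le ξ 0) (gauss_le_one hτ ξ) (gauss_pos τ ξ).le (norm_nonneg ξ)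
    _ = ‖ξ‖ := mul_one _

theorem continuous_regKer {m : E3 → ℝ} (hm : SymbolOrder0 m) (τ : ℝ) : Continuous (regKer m τ) := by
  have := continuous_quadWt hm
  unfold regKer
  fun_prop

theorem continuous_regKer' {m : E3 → ℝ} (hm : SymbolOrder0 m) (τ : ℝ) :
    Continuous (regKer' m τ) := by
  have := continuous_quadWt hm
  unfold regKer'
  fun_prop

theorem abs_gauss_le {τ : ℝ} (hτ : 0 ≤ τ) (ξ : E3) : |gauss τ ξ| ≤ 1 := by
  rw [abs_of_pos (gauss_pos τ ξ)]; exact gauss_le_one hτ ξ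

theorem abs_regKer_le {m : E3 → ℝ} {M : ℝ} (hM : ∀ ξ, |m ξ| ≤ M) {τ : ℝ} (hτ : 0 ≤ τ)
    (p : E3 × E3) : |regKer m τ p| ≤ M * 9 * ‖p.2‖ + M * 9 * ‖p.1 + p.2‖ := by
  have hq : ∀ ξ, |quadWt m 1 3 (9 / 2) τ ξ| ≤ M * 9 * ‖ξ‖ := fun ξ =>
    abs_quadWt_le_norm hM hτ ξ (by norm_num) (by norm_num) (by norm_num)
  refine (abs_sub _ _).trans (add_le_add ?_ ?_)
  · rw [mul_right_comm]
    exact (abs_mul_three_le (abs_gauss_le hτ _) (abs_gauss_le hτ _) (hq _)).trans (by simp)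
  · exact (abs_mul_three_le (abs_gauss_le hτ _) (abs_gauss_le hτ _) (hq _)).trans (by simp)

theorem abs_regKer'_le {m : E3 → ℝ} {M : ℝ} (hM : ∀ ξ, |m ξ| ≤ M) {τ : ℝ} (hτ : 0 < τ)
    (p : E3 × E3) : |regKer' m τ p| ≤ 360 * M * (1 + 1 / τ) ^ 3 := by
  set L := 1 + 1 / τ with hL
  have hL1 : 1 ≤ L := by rw [hL]; linarith [one_div_pos.2 hτ]
  have hg : ∀ ξ, |gauss τ ξ| ≤ L := fun ξ => (abs_gauss_le hτ.le ξ).trans hL1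
  have hc : ∀ j (ξ : E3), |ξ j * gauss τ ξ| ≤ L := fun j ξ => by
    rw [abs_mul, abs_of_pos (gauss_pos τ ξ)]; exact coord_mul_gauss_le hτ ξ j
  have hn : ∀ ξ, |nsq ξ * gauss τ ξ| ≤ L := fun ξ => by
    rw [abs_of_nonneg (mul_nonneg (nsq_nonneg ξ) (gauss_pos τ ξ).le)]
    linarith [nsq_mul_gauss_le hτ ξ]
  have hv : ∀ ξ, |quadWt m 2 6 (-18) τ ξ| ≤ M * 36 * L := fun ξ =>
    abs_quadWt_le_const hM hτ ξ (by norm_num) (by norm_num) (by norm_num)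
  have hu : ∀ ξ, |quadWt m 0 0 (27 / 2) τ ξ| ≤ M * 36 * L := fun ξ =>
    abs_quadWt_le_const hM hτ ξ (by norm_num) (by norm_num) (by norm_num)
  obtain ⟨ζ, ξ⟩ := p
  unfold regKer'
  simp only
  have s1 : |∑ j, ζ j * gauss τ ζ * quadWt m 2 6 (-18) τ ξ * ((ζ + ξ) j * gauss τ (ζ + ξ))|
      ≤ 3 * (L * L * (M * 36 * L)) := by
    refine (Finset.abs_sum_le_sum_abs _ _).trans ((Finset.sum_le_sum fun j _ => ?_).trans
      (b := ∑ _j : Fin 3, L * L * (M * 36 * L)) (by simp))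
    rw [mul_right_comm]
    exact abs_mul_three_le (hc j ζ) (hc j (ζ + ξ)) (hv ξ)
  have s2 : |∑ j, ζ j * gauss τ ζ * (ξ j * gauss τ ξ) * quadWt m 2 6 (-18) τ (ζ + ξ)|
      ≤ 3 * (L * L * (M * 36 * L)) := by
    refine (Finset.abs_sum_le_sum_abs _ _).trans ((Finset.sum_le_sum fun j _ => ?_).trans
      (b := ∑ _j : Fin 3, L * L * (M * 36 * L)) (by simp))
    exact abs_mul_three_le (hc j ζ) (hc j ξ) (hv (ζ + ξ))
  have t1 := abs_mul_three_le (hn ζ) (hg ξ) (hu (ζ + ξ))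
  have t2 := abs_mul_three_le (hn ζ) (hg (ζ + ξ)) (hu ξ)
  have t3 := abs_mul_three_le (hg ζ) (hn ξ) (hu (ζ + ξ))
  have t4 := abs_mul_three_le (hg ζ) (hn (ζ + ξ)) (hu ξ)
  rw [mul_right_comm] at t2 t4
  rw [abs_le] at *
  constructor <;> linarith [s1.1, s1.2, s2.1, s2.2, t1.1, t1.2, t2.1, t2.2, t3.1, t3.2, t4.1, t4.2]

theorem integrable_mul_ofReal_of_bound {W : E3 × E3 → ℂ} (hW : Integrable W) {k : E3 × E3 → ℝ}
    (hk : Continuous k) {C : ℝ} (hC : ∀ p, |k p| ≤ C) : Integrable (fun p => W p * (k p : ℂ)) :=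
  hW.mul_bdd (c := C) (Complex.continuous_ofReal.comp hk).aestronglyMeasurable
    (Eventually.of_forall fun p => by simpa using hC p)

theorem exists_bound_regKer {m : E3 → ℝ} {M : ℝ} (hM : ∀ ξ, |m ξ| ≤ M) {τ : ℝ} (hτ : 0 < τ)
    (p : E3 × E3) : |regKer m τ p| ≤ 2 * (M * 9 * (1 + 1 / τ)) := by
  have hq : ∀ ξ, |quadWt m 1 3 (9 / 2) τ ξ| ≤ M * 9 * (1 + 1 / τ) := fun ξ =>
    abs_quadWt_le_const hM hτ ξ (by norm_num) (by norm_num) (by norm_num)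
  rw [two_mul]
  refine (abs_sub _ _).trans (add_le_add ?_ ?_)
  · rw [mul_right_comm]
    exact (abs_mul_three_le (abs_gauss_le hτ.le _) (abs_gauss_le hτ.le _) (hq _)).trans (by simp)
  · exact (abs_mul_three_le (abs_gauss_le hτ.le _) (abs_gauss_le hτ.le _) (hq _)).trans (by simp)

theorem hasDerivAt_integral_regKer {m : E3 → ℝ} (hm : SymbolOrder0 m) {W : E3 × E3 → ℂ}
    (hW : Integrable W) {τ : ℝ} (hτ : 0 < τ) :
    HasDerivAt (fun τ => ∫ p, W p * (regKer m τ p : ℂ)) (∫ p, W p * (regKer' m τ p : ℂ)) τ := by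
  obtain ⟨M, hM0, hM⟩ := hm.exists_bound_self
  refine (hasDerivAt_integral_of_dominated_loc_of_deriv_le (𝕜 := ℝ) (s := Set.Ioi (τ / 2))
    (F := fun τ p => W p * (regKer m τ p : ℂ)) (F' := fun τ p => W p * (regKer' m τ p : ℂ))
    (bound := fun p => ‖W p‖ * (360 * M * (1 + 1 / (τ / 2)) ^ 3))
    (Ioi_mem_nhds (by linarith)) (Eventually.of_forall fun t => ?_) ?_ ?_
    (Eventually.of_forall fun p t ht => ?_) (hW.norm.mul_const _)
    (Eventually.of_forall fun p t ht => ?_)).2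
  · exact hW.1.mul (Complex.continuous_ofReal.comp (continuous_regKer hm t)).aestronglyMeasurable
  · exact integrable_mul_ofReal_of_bound hW (continuous_regKer hm τ) (exists_bound_regKer hM hτ)
  · exact hW.1.mul (Complex.continuous_ofReal.comp (continuous_regKer' hm τ)).aestronglyMeasurable
  · have ht' : τ / 2 < t := ht
    have ht0 : 0 < t := by linarith
    rw [norm_mul, Complex.norm_real, Real.norm_eq_abs]
    refine mul_le_mul_of_nonneg_left ((abs_regKer'_le hM ht0 p).trans ?_) (norm_nonneg _)
    gcongr
  · exact ((hasDerivAt_regKer m t p).ofReal_comp).const_mul (W p)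

theorem quadWt_zero (m : E3 → ℝ) (a b c : ℝ) (ξ : E3) : quadWt m a b c 0 ξ = rsym m ξ * a := by
  simp [quadWt, gauss]

theorem regKer_zero (m : E3 → ℝ) (p : E3 × E3) :
    regKer m 0 p = rsym m p.2 - rsym m (p.1 + p.2) := by
  simp [regKer, quadWt_zero, gauss]

theorem tendsto_integral_regKer {m : E3 → ℝ} (hm : SymbolOrder0 m) {W : E3 × E3 → ℂ}
    (hW : AEStronglyMeasurable W) (hW2 : Integrable (fun p => ‖W p‖ * ‖p.2‖))
    (hW3 : Integrable (fun p => ‖W p‖ * ‖p.1 + p.2‖)) :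
    Tendsto (fun τ => ∫ p, W p * (regKer m τ p : ℂ)) (nhdsWithin 0 (Set.Ioi 0))
      (nhds (∫ p, W p * ((rsym m p.2 - rsym m (p.1 + p.2) : ℝ) : ℂ))) := by
  obtain ⟨M, hM0, hM⟩ := hm.exists_bound_self
  simp only [← regKer_zero]
  refine tendsto_integral_filter_of_dominated_convergence
    (fun p => M * 9 * (‖W p‖ * ‖p.2‖) + M * 9 * (‖W p‖ * ‖p.1 + p.2‖))
    (Eventually.of_forall fun t => ?_) ?_ ((hW2.const_mul _).add (hW3.const_mul _))
    (Eventually.of_forall fun p => ?_)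
  · exact hW.mul (Complex.continuous_ofReal.comp (continuous_regKer hm t)).aestronglyMeasurable
  · filter_upwards [self_mem_nhdsWithin] with t ht
    refine Eventually.of_forall fun p => ?_
    rw [norm_mul, Complex.norm_real, Real.norm_eq_abs]
    calc ‖W p‖ * |regKer m t p| ≤ ‖W p‖ * (M * 9 * ‖p.2‖ + M * 9 * ‖p.1 + p.2‖) :=
          mul_le_mul_of_nonneg_left (abs_regKer_le hM (le_of_lt ht) p) (norm_nonneg _)
      _ = _ := by ring
  · have h := (((hasDerivAt_regKer m 0 p).continuousAt).ofReal).const_mul (W p)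
    exact h.mono_left nhdsWithin_le_nhds

/-- Multiplication by a real weight. -/
def wmul (u : E3 → ℝ) (X : E3 → ℂ) (ξ : E3) : ℂ := (u ξ : ℂ) * X ξ

/-- The integrand of `Tri`. -/
def triKer (A B C : E3 → ℂ) (p : E3 × E3) : ℂ :=
  A p.1 * B p.2 * (starRingEnd ℂ) (C (p.1 + p.2))

theorem triKer_wmul (A B C : E3 → ℂ) (u v w : E3 → ℝ) (p : E3 × E3) :
    triKer (wmul u A) (wmul v B) (wmul w C) p =
      triKer A B C p * ((u p.1 * v p.2 * w (p.1 + p.2) : ℝ) : ℂ) := by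
  simp only [triKer, wmul, map_mul, Complex.conj_ofReal]
  push_cast
  ring

theorem C3c.L12_wmul {f : E3 → ℝ} (hf : C3c f) {u : E3 → ℝ} (hu : Continuous u) {C : ℝ}
    (hC : ∀ ξ, |u ξ| ≤ C * (1 + ‖ξ‖)) : L12 (wmul u (hat f)) :=
  hf.L12_mul_hat (Complex.continuous_ofReal.comp hu) (C := C) fun ξ => by simpa using hC ξ

theorem norm_IF_gauss_le {τ : ℝ} (hτ : 0 < τ) {f : E3 → ℝ} (hf : Continuous f)
    (hc : HasCompactSupport f) (h1 : ∀ x, |f x| ≤ 1) (x : E3) :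
    ‖IF (wmul (gauss τ) (hat f)) x‖ ≤ 1 :=
  norm_IF_gauss_mul_FT_le hτ (integrable_ofReal_of_compact hf hc) (fun x => by simpa using h1 x) x

theorem norm_IF_coord_gauss_le {τ : ℝ} (hτ : 0 < τ) {f : E3 → ℝ} (hf : C3c f) (j : Fin 3)
    (h1 : ∀ x, |pd j f x| ≤ 1) (x : E3) :
    ‖IF (wmul (fun ξ => ξ j * gauss τ ξ) (hat f)) x‖ ≤ 1 := by
  have h := norm_IF_gauss_le hτ (hf.contDiff_pd j).continuous (hf.compact.pd j) h1 x
  have e : IF (wmul (gauss τ) (hat (pd j f))) x =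
      Complex.I * IF (wmul (fun ξ => ξ j * gauss τ ξ) (hat f)) x := by
    unfold IF
    rw [mul_left_comm]
    congr 1
    rw [← integral_const_mul]
    congr 1
    funext ξ
    simp only [wmul, hf.hat_pd]
    push_cast
    ring
  rwa [e, norm_mul, Complex.norm_I, one_mul] at h

/-- The weighted energy density of three functions on the Fourier side. -/
def dens (a h g : E3 → ℝ) (ξ : E3) : ℝ :=
  ‖hat h ξ‖ ^ 2 + ‖hat g ξ‖ ^ 2 + nsq ξ * ‖hat a ξ‖ ^ 2

/-- The energy at frequency scale `τ^{-1/2}`. -/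
def ener (τ : ℝ) (a h g : E3 → ℝ) : ℝ := ∫ ξ, nsq ξ * gauss τ ξ * dens a h g ξ

theorem dens_nonneg (a h g : E3 → ℝ) (ξ : E3) : 0 ≤ dens a h g ξ := by
  have := nsq_nonneg ξ
  unfold dens
  positivity

theorem nsq_mul_norm_hat_sq {a : E3 → ℝ} (ha : C3c a) (ξ : E3) :
    nsq ξ * ‖hat a ξ‖ ^ 2 = ∑ j, ‖hat (pd j a) ξ‖ ^ 2 := by
  unfold nsq
  rw [Finset.sum_mul]
  refine Finset.sum_congr rfl fun j _ => ?_
  rw [ha.hat_pd, norm_mul, norm_mul, Complex.norm_I, one_mul, Complex.norm_real, mul_pow,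
    Real.norm_eq_abs, sq_abs]

theorem integrable_dens {a h g : E3 → ℝ} (ha : C3c a) (hh : C3c h) (hg : C3c g) :
    Integrable (dens a h g) ∧ ∫ ξ, dens a h g ξ =
      (∫ x, h x ^ 2) + (∫ x, g x ^ 2) + ∑ j, ∫ x, pd j a x ^ 2 := by
  have i1 := integrable_sq_hat hh.continuous hh.compact
  have i2 := integrable_sq_hat hg.continuous hg.compact
  have i3 : ∀ j : Fin 3, Integrable (fun ξ => ‖hat (pd j a) ξ‖ ^ 2) := fun j =>
    integrable_sq_hat (ha.contDiff_pd j).continuous (ha.compact.pd j)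
  have e : dens a h g = fun ξ =>
      (‖hat h ξ‖ ^ 2 + ‖hat g ξ‖ ^ 2) + ∑ j, ‖hat (pd j a) ξ‖ ^ 2 := by
    funext ξ
    rw [dens, nsq_mul_norm_hat_sq ha]
  have i4 : Integrable (fun ξ => ∑ j, ‖hat (pd j a) ξ‖ ^ 2) := integrable_finsetSum _ fun j _ => i3 j
  have i12 : Integrable (fun ξ => ‖hat h ξ‖ ^ 2 + ‖hat g ξ‖ ^ 2) := i1.add i2
  rw [e]
  refine ⟨i12.add i4, ?_⟩
  rw [integral_add i12 i4, integral_add i1 i2, integral_finsetSum _ fun j _ => i3 j,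
    integral_sq_hat hh.continuous hh.compact, integral_sq_hat hg.continuous hg.compact]
  congr 1
  exact Finset.sum_congr rfl fun j _ =>
    integral_sq_hat (ha.contDiff_pd j).continuous (ha.compact.pd j)

theorem integrable_ener {τ : ℝ} (hτ : 0 < τ) {a h g : E3 → ℝ} (ha : C3c a) (hh : C3c h)
    (hg : C3c g) : Integrable (fun ξ => nsq ξ * gauss τ ξ * dens a h g ξ) := by
  refine (integrable_dens ha hh hg).1.bdd_mul (c := 1 / τ)
    (continuous_nsq.mul (continuous_gauss τ)).aestronglyMeasurable (Eventually.of_forall fun ξ => ?_)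
  rw [Real.norm_of_nonneg (mul_nonneg (nsq_nonneg ξ) (gauss_pos τ ξ).le)]
  exact nsq_mul_gauss_le hτ ξ

theorem ener_nonneg (τ : ℝ) (a h g : E3 → ℝ) : 0 ≤ ener τ a h g :=
  integral_nonneg fun ξ => mul_nonneg (mul_nonneg (nsq_nonneg ξ) (gauss_pos τ ξ).le)
    (dens_nonneg a h g ξ)

theorem integral_norm_sq_wmul_le {τ : ℝ} (hτ : 0 < τ) {a h g : E3 → ℝ} (ha : C3c a) (hh : C3c h)
    (hg : C3c g) {X : E3 → ℂ} {u : E3 → ℝ} {D : ℝ}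
    (hu : ∀ ξ, u ξ ^ 2 * ‖X ξ‖ ^ 2 ≤ D * (nsq ξ * gauss τ ξ * dens a h g ξ)) :
    ∫ ξ, ‖wmul u X ξ‖ ^ 2 ≤ D * ener τ a h g := by
  unfold ener
  rw [← integral_const_mul]
  refine integral_mono_of_nonneg (Eventually.of_forall fun ξ => by positivity)
    ((integrable_ener hτ ha hh hg).const_mul D) (Eventually.of_forall fun ξ => ?_)
  simp only [wmul, norm_mul, mul_pow, Complex.norm_real, Real.norm_eq_abs, sq_abs]
  exact hu ξ

theorem norm_sq_mid_le_dens (a h g : E3 → ℝ) (ξ : E3) : ‖hat h ξ‖ ^ 2 ≤ dens a h g ξ := by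
  have := nsq_nonneg ξ
  unfold dens
  nlinarith [sq_nonneg ‖hat g ξ‖, mul_nonneg this (sq_nonneg ‖hat a ξ‖)]

theorem norm_sq_right_le_dens (a h g : E3 → ℝ) (ξ : E3) : ‖hat g ξ‖ ^ 2 ≤ dens a h g ξ := by
  have := nsq_nonneg ξ
  unfold dens
  nlinarith [sq_nonneg ‖hat h ξ‖, mul_nonneg this (sq_nonneg ‖hat a ξ‖)]

theorem norm_sq_left_le_dens (a h g : E3 → ℝ) (ξ : E3) : nsq ξ * ‖hat a ξ‖ ^ 2 ≤ dens a h g ξ := by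
  unfold dens
  nlinarith [sq_nonneg ‖hat h ξ‖, sq_nonneg ‖hat g ξ‖]

theorem gauss_sq_le {τ : ℝ} (hτ : 0 ≤ τ) (ξ : E3) : gauss τ ξ ^ 2 ≤ gauss τ ξ := by
  rw [pow_two]
  exact mul_le_of_le_one_left (gauss_pos τ ξ).le (gauss_le_one hτ ξ)

theorem sq_le_of_coord_gauss {τ : ℝ} (hτ : 0 ≤ τ) (ξ : E3) (j : Fin 3) {t D : ℝ}
    (ht : |t| ≤ D * (|ξ j| * gauss τ ξ)) : t ^ 2 ≤ D ^ 2 * (nsq ξ * gauss τ ξ) := by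
  calc t ^ 2 = |t| ^ 2 := (sq_abs t).symm
    _ ≤ (D * (|ξ j| * gauss τ ξ)) ^ 2 := by gcongr
    _ = D ^ 2 * (ξ j ^ 2 * gauss τ ξ ^ 2) := by rw [mul_pow, mul_pow, sq_abs]
    _ ≤ D ^ 2 * (nsq ξ * gauss τ ξ) := by
        gcongr
        · exact nsq_nonneg ξ
        · exact coord_sq_le_nsq ξ j
        · exact gauss_sq_le hτ ξ

/-- The weights occurring in the derivative of the regularized commutator: their energy bounds. -/
structure GoodWt (τ : ℝ) (D : ℝ) (u : E3 → ℝ) : Prop where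
  cont : Continuous u
  lin : ∃ C, ∀ ξ, |u ξ| ≤ C * (1 + ‖ξ‖)
  sq : ∀ ξ, u ξ ^ 2 ≤ D * (nsq ξ * gauss τ ξ)

theorem GoodWt.mul_le {τ D : ℝ} {u : E3 → ℝ} (hu : GoodWt τ D u) {ξ : E3} {x w : ℝ}
    (hx : 0 ≤ x) (hxw : x ≤ w) : u ξ ^ 2 * x ≤ D * (nsq ξ * gauss τ ξ * w) := by
  have h := hu.sq ξ
  calc u ξ ^ 2 * x ≤ D * (nsq ξ * gauss τ ξ) * w :=
        mul_le_mul h hxw hx ((sq_nonneg _).trans h)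
    _ = _ := by ring

theorem goodWt_coord {τ : ℝ} (hτ : 0 ≤ τ) (j : Fin 3) : GoodWt τ 1 (fun ξ => ξ j * gauss τ ξ) := by
  refine ⟨by fun_prop, ⟨1, fun ξ => ?_⟩, fun ξ => ?_⟩
  · rw [abs_mul]
    have := mul_le_mul (abs_coord_le ξ j) (abs_gauss_le hτ ξ) (abs_nonneg _) (norm_nonneg ξ)
    linarith
  · have := sq_le_of_coord_gauss hτ ξ j (t := ξ j * gauss τ ξ) (D := 1)
      (by rw [abs_mul, abs_of_pos (gauss_pos τ ξ), one_mul])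
    simpa using this

theorem goodWt_quadWt {m : E3 → ℝ} (hm : SymbolOrder0 m) {M : ℝ} (hM : ∀ ξ, |m ξ| ≤ M) {τ : ℝ}
    (hτ : 0 ≤ τ) {a b c D : ℝ} (ha : |a| ≤ D) (hb : |b| ≤ D) (hc : 2 * |c| ≤ D) :
    GoodWt τ ((M * D) ^ 2) (quadWt m a b c τ) := by
  have hM0 : 0 ≤ M := (abs_nonneg _).trans (hM 0)
  have hD : 0 ≤ D := (abs_nonneg a).trans ha
  refine ⟨continuous_quadWt hm a b c τ, ⟨M * D, fun ξ => ?_⟩, fun ξ => ?_⟩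
  · refine (abs_quadWt_le_norm hM hτ ξ ha hb hc).trans ?_
    gcongr
    linarith
  · exact sq_le_of_coord_gauss hτ ξ 0 (abs_quadWt_le hM hτ ξ ha hb hc)

theorem goodWt_nsq {τ : ℝ} (hτ : 0 < τ) : GoodWt τ (1 / τ) (fun ξ => nsq ξ * gauss τ ξ) := by
  refine ⟨by fun_prop, ⟨1 / τ, fun ξ => ?_⟩, fun ξ => ?_⟩
  · rw [abs_of_nonneg (mul_nonneg (nsq_nonneg ξ) (gauss_pos τ ξ).le)]
    have h1 := nsq_mul_gauss_le hτ ξ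
    have h2 : 0 ≤ 1 / τ * ‖ξ‖ := by positivity
    linarith
  · rw [pow_two]
    exact mul_le_mul_of_nonneg_right (nsq_mul_gauss_le hτ ξ)
      (mul_nonneg (nsq_nonneg ξ) (gauss_pos τ ξ).le)

theorem lin_gauss {τ : ℝ} (hτ : 0 ≤ τ) (ξ : E3) : |gauss τ ξ| ≤ 1 * (1 + ‖ξ‖) := by
  linarith [abs_gauss_le hτ ξ, norm_nonneg ξ]

/-- The standing assumptions on the three functions entering the trilinear form. -/
structure Triple (a h g : E3 → ℝ) : Prop where
  left : C3c a
  mid : C3c h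
  right : C3c g
  left_le : ∀ x, |a x| ≤ 1
  pd_le : ∀ j x, |pd j a x| ≤ 1
  mid_le : ∀ x, |h x| ≤ 1
  right_le : ∀ x, |g x| ≤ 1

theorem GoodWt.L12 {τ D : ℝ} {u : E3 → ℝ} (hu : GoodWt τ D u) {f : E3 → ℝ} (hf : C3c f) :
    L12 (wmul u (hat f)) := by
  obtain ⟨C, hC⟩ := hu.lin
  exact hf.L12_wmul hu.cont hC

theorem GoodWt.integral_mid_le {τ D : ℝ} {u : E3 → ℝ} (hu : GoodWt τ D u) (hτ : 0 < τ)
    {a h g : E3 → ℝ} (H : Triple a h g) :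
    ∫ ξ, ‖wmul u (hat h) ξ‖ ^ 2 ≤ D * ener τ a h g :=
  integral_norm_sq_wmul_le hτ H.left H.mid H.right fun ξ =>
    hu.mul_le (by positivity) (norm_sq_mid_le_dens a h g ξ)

theorem GoodWt.integral_right_le {τ D : ℝ} {u : E3 → ℝ} (hu : GoodWt τ D u) (hτ : 0 < τ)
    {a h g : E3 → ℝ} (H : Triple a h g) :
    ∫ ξ, ‖wmul u (hat g) ξ‖ ^ 2 ≤ D * ener τ a h g :=
  integral_norm_sq_wmul_le hτ H.left H.mid H.right fun ξ =>
    hu.mul_le (by positivity) (norm_sq_right_le_dens a h g ξ)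

theorem integral_left_le {τ : ℝ} (hτ : 0 < τ) {a h g : E3 → ℝ} (H : Triple a h g) :
    ∫ ξ, ‖wmul (fun ξ => nsq ξ * gauss τ ξ) (hat a) ξ‖ ^ 2 ≤ 1 * ener τ a h g := by
  refine integral_norm_sq_wmul_le hτ H.left H.mid H.right fun ξ => ?_
  have h1 := norm_sq_left_le_dens a h g ξ
  have h2 := gauss_sq_le hτ.le ξ
  have h3 := nsq_nonneg ξ
  calc (nsq ξ * gauss τ ξ) ^ 2 * ‖hat a ξ‖ ^ 2
      = nsq ξ * gauss τ ξ ^ 2 * (nsq ξ * ‖hat a ξ‖ ^ 2) := by ring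
    _ ≤ nsq ξ * gauss τ ξ * dens a h g ξ := by gcongr; exact mul_nonneg h3 (gauss_pos τ ξ).le
    _ = _ := by ring

/-- Bound for a weighted trilinear term whose first factor carries a derivative. -/
theorem norm_Tri_coord_le {τ D D' : ℝ} (hτ : 0 < τ) {a h g : E3 → ℝ} (H : Triple a h g) (j : Fin 3)
    {u v : E3 → ℝ} (hu : GoodWt τ D u) (hv : GoodWt τ D' v) :
    fourierConst * ‖Tri (wmul (fun ξ => ξ j * gauss τ ξ) (hat a)) (wmul u (hat h))
      (wmul v (hat g))‖ ≤ (D + D') * ener τ a h g := by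
  refine (norm_Tri_le_left ((goodWt_coord hτ.le j).L12 H.left).int (hu.L12 H.mid) (hv.L12 H.right)
    (norm_IF_coord_gauss_le hτ H.left j (H.pd_le j))).trans ?_
  rw [one_mul, add_mul]
  exact add_le_add (hu.integral_mid_le hτ H) (hv.integral_right_le hτ H)

theorem norm_Tri_nsq_mid_le {τ D : ℝ} (hτ : 0 < τ) {a h g : E3 → ℝ} (H : Triple a h g)
    {v : E3 → ℝ} (hv : GoodWt τ D v) :
    fourierConst * ‖Tri (wmul (fun ξ => nsq ξ * gauss τ ξ) (hat a)) (wmul (gauss τ) (hat h))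
      (wmul v (hat g))‖ ≤ (1 + D) * ener τ a h g := by
  refine (norm_Tri_le_mid ((goodWt_nsq hτ).L12 H.left) (H.mid.L12_wmul (continuous_gauss τ)
    (lin_gauss hτ.le)) (hv.L12 H.right)
    (norm_IF_gauss_le hτ H.mid.continuous H.mid.compact H.mid_le)).trans ?_
  rw [one_mul, add_mul]
  exact add_le_add (integral_left_le hτ H) (hv.integral_right_le hτ H)

theorem norm_Tri_nsq_right_le {τ D : ℝ} (hτ : 0 < τ) {a h g : E3 → ℝ} (H : Triple a h g)
    {u : E3 → ℝ} (hu : GoodWt τ D u) :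
    fourierConst * ‖Tri (wmul (fun ξ => nsq ξ * gauss τ ξ) (hat a)) (wmul u (hat h))
      (wmul (gauss τ) (hat g))‖ ≤ (1 + D) * ener τ a h g := by
  refine (norm_Tri_le_right ((goodWt_nsq hτ).L12 H.left) (hu.L12 H.mid)
    (H.right.L12_wmul (continuous_gauss τ) (lin_gauss hτ.le))
    (norm_IF_gauss_le hτ H.right.continuous H.right.compact H.right_le)).trans ?_
  rw [one_mul, add_mul]
  exact add_le_add (integral_left_le hτ H) (hu.integral_mid_le hτ H)

theorem norm_fderiv_le_of_pdC {v : E3 → ℂ} {x : E3} (h : ∀ j, ‖pdC j v x‖ ≤ 1) :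
    ‖fderiv ℝ v x‖ ≤ 3 := by
  refine ContinuousLinearMap.opNorm_le_bound _ (by norm_num) fun w => ?_
  have e : fderiv ℝ v x w = ∑ j, w j • pdC j v x := by
    conv_lhs => rw [pi_eq_sum_univ' w]
    simp [map_sum, pdC]
  rw [e]
  calc ‖∑ j, w j • pdC j v x‖ ≤ ∑ j : Fin 3, ‖w‖ * 1 := by
        refine norm_sum_le_of_le _ fun j _ => ?_
        rw [norm_smul]
        gcongr
        · exact norm_le_pi_norm w j
        · exact h j
    _ = 3 * ‖w‖ := by simp

theorem phase_smul_left (r : ℝ) (x y : E3) : phase (r • x) y = phase x (r • y) := by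
  unfold phase
  congr 3
  exact Finset.sum_congr rfl fun i _ => by simp only [Pi.smul_apply, smul_eq_mul]; ring

theorem norm_phase_neg_sub_one_le (ζ z : E3) : ‖phase (-ζ) z - 1‖ ≤ 2 := by
  refine (norm_sub_le _ _).trans ?_
  rw [norm_phase, norm_one]
  norm_num

theorem IF_phase_sub {Y : E3 → ℂ} (hY : Integrable Y) (z x : E3) :
    IF (fun ζ => (phase (-ζ) z - 1) * Y ζ) x = IF Y (x - z) - IF Y x := by
  unfold IF
  rw [← mul_sub, ← integral_sub (hY.phase_mul _) (hY.phase_mul _)]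
  congr 2
  funext ζ
  rw [sub_eq_add_neg x z, phase_add_left, phase_neg_left z, phase_comm z, ← phase_neg_left]
  ring

theorem norm_IF_phase_sub_le {τ : ℝ} (hτ : 0 < τ) {a : E3 → ℝ} (ha : C3c a)
    (h1 : ∀ j x, |pd j a x| ≤ 1) (z x : E3) :
    ‖IF (fun ζ => (phase (-ζ) z - 1) * wmul (gauss τ) (hat a) ζ) x‖ ≤ 3 * ‖z‖ := by
  set Y := wmul (gauss τ) (hat a) with hY
  have hL : L12 Y := ha.L12_wmul (continuous_gauss τ) (lin_gauss hτ.le)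
  have hw : Integrable (fun ξ => (1 + ‖ξ‖) * ‖Y ξ‖) := by
    have := ha.integrable_weight_hat.bdd_mul (c := 1) (continuous_gauss τ).aestronglyMeasurable
      (Eventually.of_forall fun ξ => by simpa using abs_gauss_le hτ.le ξ)
    refine this.congr (Eventually.of_forall fun ξ => ?_)
    simp only [hY, wmul, norm_mul, Complex.norm_real, Real.norm_of_nonneg (gauss_pos τ ξ).le]
    ring
  rw [IF_phase_sub hL.int]
  have h := convex_univ.norm_image_sub_le_of_norm_fderiv_le (𝕜 := ℝ) (f := IF Y) (C := 3)
    (fun y _ => differentiable_IF hL.int.1 hw y) (fun y _ => norm_fderiv_le_of_pdC fun j => ?_)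
    (Set.mem_univ x) (Set.mem_univ (x - z))
  · simpa using h
  · have h2 := norm_IF_coord_gauss_le hτ ha j (h1 j) y
    rw [pdC_IF hL.int.1 hw]
    have e : IF (fun ξ => Complex.I * ξ j * Y ξ) y =
        Complex.I * IF (wmul (fun ξ => ξ j * gauss τ ξ) (hat a)) y := by
      unfold IF
      rw [mul_left_comm]
      congr 1
      rw [← integral_const_mul]
      congr 1
      funext ξ
      simp only [hY, wmul]
      push_cast
      ring
    rwa [e, norm_mul, Complex.norm_I, one_mul]

theorem ofReal_eq_integral_phase {k : E3 → ℝ} (hc : Continuous k) (h : L12 (fun ξ => (k ξ : ℂ)))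
    (hF : Integrable (IF fun ξ => (k ξ : ℂ))) (u : E3) :
    (k u : ℂ) = fourierConst * ∫ y, phase (-u) y * IF (fun ξ => (k ξ : ℂ)) y := by
  have e := FT_IF (f := fun ξ => (k ξ : ℂ)) (Complex.continuous_ofReal.comp hc) h.int hF u
  rw [← e, FT_eq_IF_neg]
  rfl

/-- Smoothing commutator estimate: increments of a multiplier with integrable kernel fall on the
first factor. -/
theorem norm_integral_triKer_increment_le {A B C X : E3 → ℂ} {M σ : ℝ} (hσ : 0 ≤ σ)
    (hA : Integrable A) (hB : L12 B) (hC : L12 C) (hX : Integrable X)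
    (hXw : Integrable (fun y => (1 + ‖y‖) * ‖X y‖))
    (hM : ∀ z x, ‖IF (fun ζ => (phase (-ζ) z - 1) * A ζ) x‖ ≤ M * ‖z‖) :
    ‖∫ p : E3 × E3, triKer A B C p * (fourierConst *
        ∫ y, (phase (-(σ • (p.1 + p.2))) y - phase (-(σ • p.2)) y) * X y)‖ ≤
      σ * M * ((∫ ξ, ‖B ξ‖ ^ 2) + ∫ ξ, ‖C ξ‖ ^ 2) * ∫ y, (1 + ‖y‖) * ‖X y‖ := by
  set S := (∫ ξ, ‖B ξ‖ ^ 2) + ∫ ξ, ‖C ξ‖ ^ 2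
  have hS : 0 ≤ S := add_nonneg (integral_nonneg fun _ => by positivity)
    (integral_nonneg fun _ => by positivity)
  have hM0 : 0 ≤ M := by
    have := (norm_nonneg _).trans (hM (fun _ => 1) 0)
    exact nonneg_of_mul_nonneg_left this (norm_pos_iff.2 fun h => one_ne_zero (congrFun h 0))
  set F : E3 × E3 → E3 → ℂ := fun p y =>
    (phase (-(σ • (p.1 + p.2))) y - phase (-(σ • p.2)) y) * (triKer A B C p * X y)
  have hF : Integrable (Function.uncurry F) (volume.prod volume) := by
    refine ((integrable_tri hA hB hC).mul_prod hX).bdd_mul (c := 2) ?_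
      (Eventually.of_forall fun q => ?_)
    · refine Continuous.aestronglyMeasurable ?_
      unfold phase
      fun_prop
    · refine (norm_sub_le _ _).trans ?_
      rw [norm_phase, norm_phase]
      norm_num
  have hT : ∀ y, ∫ p, F p y = X y * Tri (fun ζ => (phase (-ζ) (σ • y) - 1) * A ζ)
      (fun ξ => phase (-ξ) (σ • y) * B ξ) C := by
    intro y
    rw [Tri, ← integral_const_mul]
    congr 1
    funext p
    simp only [F, triKer, ← smul_neg, phase_smul_left, neg_add, phase_add_left]
    ring
  have e : ∫ p : E3 × E3, triKer A B C p * (fourierConst *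
      ∫ y, (phase (-(σ • (p.1 + p.2))) y - phase (-(σ • p.2)) y) * X y) =
      fourierConst * ∫ y, X y * Tri (fun ζ => (phase (-ζ) (σ • y) - 1) * A ζ)
      (fun ξ => phase (-ξ) (σ • y) * B ξ) C := by
    simp_rw [← hT]
    rw [← integral_integral_swap hF, ← integral_const_mul]
    congr 1
    funext p
    rw [mul_left_comm, ← integral_const_mul]
    congr 2
    funext y
    simp only [F]
    ring
  rw [e, ← integral_const_mul, ← integral_const_mul]
  refine norm_integral_le_of_norm_le (hXw.const_mul _) (Eventually.of_forall fun y => ?_)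
  have hAy : Integrable (fun ζ => (phase (-ζ) (σ • y) - 1) * A ζ) := by
    refine hA.bdd_mul (c := 2) ?_ (Eventually.of_forall fun ζ => norm_phase_neg_sub_one_le ζ _)
    refine Continuous.aestronglyMeasurable ?_
    unfold phase
    fun_prop
  have hBy : L12 (fun ξ => phase (-ξ) (σ • y) * B ξ) := by
    refine hB.mul_bdd (C := 1) ?_ fun ξ => (norm_phase _ _).le
    unfold phase
    fun_prop
  have h := norm_Tri_le_left hAy hBy hC (hM (σ • y))
  simp only [norm_mul, norm_phase, one_mul] at h
  rw [norm_mul, norm_mul, Complex.norm_real, Real.norm_of_nonneg fourierConst_pos.le, mul_left_comm]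
  calc ‖X y‖ * (fourierConst * ‖_‖) ≤ ‖X y‖ * (M * ‖σ • y‖ * S) :=
        mul_le_mul_of_nonneg_left h (norm_nonneg _)
    _ = σ * M * S * (‖y‖ * ‖X y‖) := by
        rw [norm_smul, Real.norm_of_nonneg hσ]; ring
    _ ≤ σ * M * S * ((1 + ‖y‖) * ‖X y‖) := by
        gcongr
        linarith

theorem quadWt_eq_kap (m : E3 → ℝ) {σ : ℝ} (hσ : 0 < σ) (ξ : E3) :
    quadWt m 0 0 (27 / 2) (σ ^ 2) ξ =
      27 / 2 * σ * kap m σ⁻¹ (σ • ξ) * (nsq ξ * gauss (σ ^ 2) ξ) := by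
  have h1 : nsq (σ • ξ) = σ ^ 2 * nsq ξ := by
    simp only [nsq, Pi.smul_apply, smul_eq_mul, mul_pow, Finset.mul_sum]
  have h2 : gauss 1 (σ • ξ) = gauss (σ ^ 2) ξ := by
    unfold gauss
    rw [h1]
    ring_nf
  unfold quadWt kap rsym
  rw [smul_smul, inv_mul_cancel₀ hσ.ne', one_smul, h1, h2]
  simp only [Pi.smul_apply, smul_eq_mul]
  ring

/-- The part of the derivative of the regularized commutator in which no derivative falls on the
first factor. -/
def incrKer (m : E3 → ℝ) (τ : ℝ) (p : E3 × E3) : ℝ :=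
  gauss τ p.1 * (nsq p.2 * gauss τ p.2) * quadWt m 0 0 (27 / 2) τ (p.1 + p.2)
    - gauss τ p.1 * quadWt m 0 0 (27 / 2) τ p.2 * (nsq (p.1 + p.2) * gauss τ (p.1 + p.2))

theorem exists_bound_incrKer {m : E3 → ℝ} (hm : SymbolOrder0 m) : ∃ C, 0 ≤ C ∧
    ∀ τ, 0 < τ → ∀ a h g : E3 → ℝ, Triple a h g →
      fourierConst * ‖∫ p, triKer (hat a) (hat h) (hat g) p * (incrKer m τ p : ℂ)‖ ≤
        C * ener τ a h g := by
  obtain ⟨C, hC0, hC⟩ := exists_kernel_bound hm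
  refine ⟨fourierConst * (81 * C), mul_nonneg fourierConst_pos.le (by positivity), ?_⟩
  intro τ hτ a h g H
  obtain ⟨σ, hσ, rfl⟩ : ∃ σ : ℝ, 0 < σ ∧ σ ^ 2 = τ := ⟨√τ, Real.sqrt_pos.2 hτ, Real.sq_sqrt hτ.le⟩
  obtain ⟨hkc, hkL, hkw, hkC⟩ := hC σ⁻¹ (inv_nonneg.2 hσ.le)
  set k := kap m σ⁻¹
  set X := IF (fun ξ => (k ξ : ℂ))
  have hX : Integrable X := by
    refine hkw.mono' (continuous_IF hkL.int).aestronglyMeasurable (Eventually.of_forall fun y => ?_)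
    exact le_mul_of_one_le_left (norm_nonneg _) (by linarith [norm_nonneg y])
  set A := wmul (gauss (σ ^ 2)) (hat a)
  set B := wmul (fun ξ => nsq ξ * gauss (σ ^ 2) ξ) (hat h)
  set G := wmul (fun ξ => nsq ξ * gauss (σ ^ 2) ξ) (hat g)
  have e : ∫ p, triKer (hat a) (hat h) (hat g) p * (incrKer m (σ ^ 2) p : ℂ) =
      ((27 / 2 * σ : ℝ) : ℂ) * ∫ p : E3 × E3, triKer A B G p * (fourierConst *
        ∫ y, (phase (-(σ • (p.1 + p.2))) y - phase (-(σ • p.2)) y) * X y) := by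
    rw [← integral_const_mul]
    congr 1
    funext p
    have h1 : (fourierConst : ℂ) *
        ∫ y, (phase (-(σ • (p.1 + p.2))) y - phase (-(σ • p.2)) y) * X y =
        (k (σ • (p.1 + p.2)) : ℂ) - k (σ • p.2) := by
      rw [ofReal_eq_integral_phase hkc hkL hX, ofReal_eq_integral_phase hkc hkL hX, ← mul_sub,
        ← integral_sub (hX.phase_mul _) (hX.phase_mul _)]
      simp only [sub_mul, X]
    rw [h1, triKer_wmul, incrKer, quadWt_eq_kap m hσ, quadWt_eq_kap m hσ]
    push_cast
    ring
  have hB := (goodWt_nsq hτ).L12 H.mid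
  have hG := (goodWt_nsq hτ).L12 H.right
  have h1 := norm_integral_triKer_increment_le hσ.le
    (H.left.L12_wmul (continuous_gauss _) (lin_gauss hτ.le)).int hB hG hX hkw
    (norm_IF_phase_sub_le hτ H.left H.pd_le)
  have h2 := (goodWt_nsq hτ).integral_mid_le hτ H
  have h3 := (goodWt_nsq hτ).integral_right_le hτ H
  have hE := ener_nonneg (σ ^ 2) a h g
  rw [e, norm_mul, Complex.norm_real, Real.norm_of_nonneg (by positivity),
    mul_assoc fourierConst]
  refine mul_le_mul_of_nonneg_left ?_ fourierConst_pos.le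
  calc 27 / 2 * σ * ‖_‖ ≤ 27 / 2 * σ * (σ * 3 * ((∫ ξ, ‖B ξ‖ ^ 2) + ∫ ξ, ‖G ξ‖ ^ 2) *
        ∫ y, (1 + ‖y‖) * ‖X y‖) := by gcongr
    _ ≤ 27 / 2 * σ * (σ * 3 * (1 / σ ^ 2 * ener (σ ^ 2) a h g + 1 / σ ^ 2 * ener (σ ^ 2) a h g) *
        C) := by gcongr
    _ = 81 * C * ener (σ ^ 2) a h g := by
        field_simp
        ring

theorem integrable_triKer {A B C : E3 → ℂ} (hA : Integrable A) (hB : L12 B) (hC : L12 C) :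
    Integrable (triKer A B C) :=
  integrable_tri hA hB hC

theorem triKer_mul_regKer' (m : E3 → ℝ) (τ : ℝ) (A B C : E3 → ℂ) (p : E3 × E3) :
    triKer A B C p * (regKer' m τ p : ℂ) =
      -(∑ j, triKer (wmul (fun ξ => ξ j * gauss τ ξ) A) (wmul (quadWt m 2 6 (-18) τ) B)
        (wmul (fun ξ => ξ j * gauss τ ξ) C) p)
      - (∑ j, triKer (wmul (fun ξ => ξ j * gauss τ ξ) A) (wmul (fun ξ => ξ j * gauss τ ξ) B)
        (wmul (quadWt m 2 6 (-18) τ) C) p)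
      + (triKer (wmul (fun ξ => nsq ξ * gauss τ ξ) A) (wmul (gauss τ) B)
        (wmul (quadWt m 0 0 (27 / 2) τ) C) p
      - triKer (wmul (fun ξ => nsq ξ * gauss τ ξ) A) (wmul (quadWt m 0 0 (27 / 2) τ) B)
        (wmul (gauss τ) C) p)
      + triKer A B C p * (incrKer m τ p : ℂ) := by
  simp only [triKer_wmul, regKer', incrKer]
  push_cast
  simp only [← Finset.mul_sum]
  ring

theorem triKer_mul_incrKer (m : E3 → ℝ) (τ : ℝ) (A B C : E3 → ℂ) (p : E3 × E3) :
    triKer A B C p * (incrKer m τ p : ℂ) =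
      triKer (wmul (gauss τ) A) (wmul (fun ξ => nsq ξ * gauss τ ξ) B)
        (wmul (quadWt m 0 0 (27 / 2) τ) C) p
      - triKer (wmul (gauss τ) A) (wmul (quadWt m 0 0 (27 / 2) τ) B)
        (wmul (fun ξ => nsq ξ * gauss τ ξ) C) p := by
  simp only [triKer_wmul, incrKer]
  push_cast
  ring

theorem integral_sums_add {F G : Fin 3 → E3 × E3 → ℂ} {A B D : E3 × E3 → ℂ}
    (hF : ∀ j, Integrable (F j)) (hG : ∀ j, Integrable (G j)) (hA : Integrable A)
    (hB : Integrable B) (hD : Integrable D) :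
    ∫ p, (-(∑ j, F j p) - (∑ j, G j p) + (A p - B p) + D p) =
      -(∑ j, ∫ p, F j p) - (∑ j, ∫ p, G j p) + ((∫ p, A p) - ∫ p, B p) + ∫ p, D p := by
  have s1 := integrable_finsetSum Finset.univ fun j _ => hF j
  have s2 := integrable_finsetSum Finset.univ fun j _ => hG j
  have s3 : Integrable (fun p => -(∑ j, F j p)) := s1.neg
  have s4 : Integrable (fun p => -(∑ j, F j p) - ∑ j, G j p) := s3.sub s2
  have s5 : Integrable (fun p => A p - B p) := hA.sub hB
  have s6 : Integrable (fun p => -(∑ j, F j p) - (∑ j, G j p) + (A p - B p)) := s4.add s5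
  rw [integral_add s6 hD, integral_add s4 s5, integral_sub s3 s2, integral_sub hA hB,
    integral_neg, integral_finsetSum _ fun j _ => hF j, integral_finsetSum _ fun j _ => hG j]

theorem exists_bound_integral_regKer' {m : E3 → ℝ} (hm : SymbolOrder0 m) : ∃ C, 0 ≤ C ∧
    ∀ τ, 0 < τ → ∀ a h g : E3 → ℝ, Triple a h g →
      ‖∫ p, triKer (hat a) (hat h) (hat g) p * (regKer' m τ p : ℂ)‖ ≤ C * ener τ a h g := by
  obtain ⟨M, hM0, hM⟩ := hm.exists_bound_self
  obtain ⟨C, hC0, hC⟩ := exists_bound_incrKer hm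
  have hc := fourierConst_pos
  refine ⟨(8 * (1 + (M * 36) ^ 2) + C) / fourierConst, by positivity, fun τ hτ a h g H => ?_⟩
  have q1 : GoodWt τ ((M * 36) ^ 2) (quadWt m 2 6 (-18) τ) :=
    goodWt_quadWt hm hM hτ.le (by norm_num) (by norm_num) (by norm_num)
  have q2 : GoodWt τ ((M * 36) ^ 2) (quadWt m 0 0 (27 / 2) τ) :=
    goodWt_quadWt hm hM hτ.le (by norm_num) (by norm_num) (by norm_num)
  have q3 := fun j => goodWt_coord hτ.le j
  have q4 := goodWt_nsq hτ
  have lg : ∀ {f : E3 → ℝ}, C3c f → L12 (wmul (gauss τ) (hat f)) := fun hf =>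
    hf.L12_wmul (continuous_gauss τ) (lin_gauss hτ.le)
  have i1 := fun j => integrable_triKer ((q3 j).L12 H.left).int (q1.L12 H.mid) ((q3 j).L12 H.right)
  have i2 := fun j => integrable_triKer ((q3 j).L12 H.left).int ((q3 j).L12 H.mid) (q1.L12 H.right)
  have i3 := integrable_triKer (q4.L12 H.left).int (lg H.mid) (q2.L12 H.right)
  have i4 := integrable_triKer (q4.L12 H.left).int (q2.L12 H.mid) (lg H.right)
  have i5 : Integrable (fun p => triKer (hat a) (hat h) (hat g) p * (incrKer m τ p : ℂ)) := by
    simp only [triKer_mul_incrKer]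
    exact (integrable_triKer (lg H.left).int (q4.L12 H.mid) (q2.L12 H.right)).sub
      (integrable_triKer (lg H.left).int (q2.L12 H.mid) (q4.L12 H.right))
  have e : ∫ p, triKer (hat a) (hat h) (hat g) p * (regKer' m τ p : ℂ) =
      -(∑ j, Tri (wmul (fun ξ => ξ j * gauss τ ξ) (hat a)) (wmul (quadWt m 2 6 (-18) τ) (hat h))
        (wmul (fun ξ => ξ j * gauss τ ξ) (hat g)))
      - (∑ j, Tri (wmul (fun ξ => ξ j * gauss τ ξ) (hat a))
        (wmul (fun ξ => ξ j * gauss τ ξ) (hat h)) (wmul (quadWt m 2 6 (-18) τ) (hat g)))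
      + (Tri (wmul (fun ξ => nsq ξ * gauss τ ξ) (hat a)) (wmul (gauss τ) (hat h))
        (wmul (quadWt m 0 0 (27 / 2) τ) (hat g))
      - Tri (wmul (fun ξ => nsq ξ * gauss τ ξ) (hat a)) (wmul (quadWt m 0 0 (27 / 2) τ) (hat h))
        (wmul (gauss τ) (hat g)))
      + ∫ p, triKer (hat a) (hat h) (hat g) p * (incrKer m τ p : ℂ) := by
    simp only [triKer_mul_regKer']
    exact integral_sums_add i1 i2 i3 i4 i5
  have b1 := fun j => norm_Tri_coord_le hτ H j q1 (q3 j)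
  have b2 := fun j => norm_Tri_coord_le hτ H j (q3 j) q1
  have b3 := norm_Tri_nsq_mid_le hτ H q2
  have b4 := norm_Tri_nsq_right_le hτ H q2
  have b5 := hC τ hτ a h g H
  have S : ∀ {T : Fin 3 → ℂ} {R : ℝ}, (∀ j, fourierConst * ‖T j‖ ≤ R) →
      fourierConst * ‖∑ j, T j‖ ≤ 3 * R := by
    intro T R hT
    calc fourierConst * ‖∑ j, T j‖ ≤ ∑ j, fourierConst * ‖T j‖ := by
          rw [← Finset.mul_sum]
          exact mul_le_mul_of_nonneg_left (norm_sum_le _ _) hc.le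
      _ ≤ ∑ j : Fin 3, R := Finset.sum_le_sum fun j _ => hT j
      _ = 3 * R := by simp
  rw [div_mul_eq_mul_div, le_div_iff₀ hc, mul_comm, e]
  refine (mul_le_mul_of_nonneg_left ((norm_add_le _ _).trans (add_le_add_left
    ((norm_add_le _ _).trans (add_le_add (norm_sub_le _ _) (norm_sub_le _ _))) _)) hc.le).trans ?_
  rw [norm_neg]
  have c1 := S b1
  have c2 := S b2
  linarith

theorem hasDerivAt_integral_gauss_dens {τ : ℝ} (hτ : 0 < τ) {a h g : E3 → ℝ} (ha : C3c a)
    (hh : C3c h) (hg : C3c g) :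
    HasDerivAt (fun τ => ∫ ξ, gauss τ ξ * dens a h g ξ) (-ener τ a h g) τ := by
  have hd := (integrable_dens ha hh hg).1
  have e : -ener τ a h g = ∫ ξ, -(nsq ξ * gauss τ ξ * dens a h g ξ) := by
    rw [integral_neg, ener]
  rw [e]
  refine (hasDerivAt_integral_of_dominated_loc_of_deriv_le (𝕜 := ℝ) (s := Set.Ioi (τ / 2))
    (F := fun τ ξ => gauss τ ξ * dens a h g ξ)
    (F' := fun τ ξ => -(nsq ξ * gauss τ ξ * dens a h g ξ))
    (bound := fun ξ => 1 / (τ / 2) * dens a h g ξ)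
    (Ioi_mem_nhds (by linarith)) (Eventually.of_forall fun t => ?_) ?_ ?_
    (Eventually.of_forall fun ξ t ht => ?_) (hd.const_mul _)
    (Eventually.of_forall fun ξ t _ => ?_)).2
  · exact (continuous_gauss t).aestronglyMeasurable.mul hd.1
  · exact hd.bdd_mul (c := 1) (continuous_gauss τ).aestronglyMeasurable
      (Eventually.of_forall fun ξ => by simpa using abs_gauss_le hτ.le ξ)
  · exact (((continuous_nsq.mul (continuous_gauss τ)).aestronglyMeasurable).mul hd.1).neg
  · have ht' : τ / 2 < t := ht
    have ht0 : 0 < t := by linarith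
    rw [norm_neg, Real.norm_of_nonneg (mul_nonneg (mul_nonneg (nsq_nonneg ξ) (gauss_pos t ξ).le)
      (dens_nonneg a h g ξ))]
    refine mul_le_mul_of_nonneg_right ((nsq_mul_gauss_le ht0 ξ).trans ?_) (dens_nonneg a h g ξ)
    exact one_div_le_one_div_of_le (by linarith) ht'.le
  · have h1 : HasDerivAt (fun t => gauss t ξ) (-(nsq ξ * gauss t ξ)) t := by
      have := ((hasDerivAt_id t).neg.mul_const (nsq ξ)).exp
      refine this.congr_deriv ?_
      simp only [gauss, id, neg_mul, Pi.neg_apply]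
      ring
    exact (h1.mul_const _).congr_deriv (by ring)

theorem integral_sq_wmul_le_of_bound {f : E3 → ℝ} (hf : C3c f) {u : E3 → ℝ} {D : ℝ}
    (hu : ∀ ξ, |u ξ| ≤ D) : ∫ ξ, ‖wmul u (hat f) ξ‖ ^ 2 ≤ D ^ 2 * ∫ x, f x ^ 2 := by
  rw [← integral_sq_hat hf.continuous hf.compact, ← integral_const_mul]
  refine integral_mono_of_nonneg (Eventually.of_forall fun ξ => by positivity)
    ((integrable_sq_hat hf.continuous hf.compact).const_mul _) (Eventually.of_forall fun ξ => ?_)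
  simp only [wmul, norm_mul, Complex.norm_real, Real.norm_eq_abs, mul_pow]
  gcongr
  exact hu ξ

theorem exists_bound_integral_regKer_one {m : E3 → ℝ} (hm : SymbolOrder0 m) : ∃ C, 0 ≤ C ∧
    ∀ a h g : E3 → ℝ, Triple a h g →
      ‖∫ p, triKer (hat a) (hat h) (hat g) p * (regKer m 1 p : ℂ)‖ ≤
        C * ((∫ x, h x ^ 2) + ∫ x, g x ^ 2) := by
  obtain ⟨M, hM0, hM⟩ := hm.exists_bound_self
  have hc := fourierConst_pos
  refine ⟨(1 + (M * 9 * (1 + 1 / 1)) ^ 2) / fourierConst, by positivity, fun a h g H => ?_⟩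
  set D := M * 9 * (1 + 1 / 1)
  set q := quadWt m 1 3 (9 / 2) 1
  have hq : ∀ ξ, |q ξ| ≤ D := fun ξ =>
    abs_quadWt_le_const hM one_pos ξ (by norm_num) (by norm_num) (by norm_num)
  have hD : 0 ≤ D := (abs_nonneg _).trans (hq 0)
  have hqL : ∀ {f : E3 → ℝ}, C3c f → L12 (wmul q (hat f)) := fun hf =>
    hf.L12_wmul (continuous_quadWt hm _ _ _ _) (C := D) fun ξ => by
      nlinarith [hq ξ, norm_nonneg ξ, mul_nonneg hD (norm_nonneg ξ)]
  have lg : ∀ {f : E3 → ℝ}, C3c f → L12 (wmul (gauss 1) (hat f)) := fun hf =>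
    hf.L12_wmul (continuous_gauss 1) (lin_gauss zero_le_one)
  have e : ∫ p, triKer (hat a) (hat h) (hat g) p * (regKer m 1 p : ℂ) =
      Tri (wmul (gauss 1) (hat a)) (wmul q (hat h)) (wmul (gauss 1) (hat g)) -
      Tri (wmul (gauss 1) (hat a)) (wmul (gauss 1) (hat h)) (wmul q (hat g)) := by
    unfold Tri
    rw [← integral_sub (integrable_tri (lg H.left).int (hqL H.mid) (lg H.right))
      (integrable_tri (lg H.left).int (lg H.mid) (hqL H.right))]
    congr 1
    funext p
    change _ = triKer (wmul (gauss 1) (hat a)) (wmul q (hat h)) (wmul (gauss 1) (hat g)) p -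
      triKer (wmul (gauss 1) (hat a)) (wmul (gauss 1) (hat h)) (wmul q (hat g)) p
    rw [triKer_wmul, triKer_wmul, regKer]
    push_cast
    ring
  have hs := norm_IF_gauss_le one_pos H.left.continuous H.left.compact H.left_le
  have b1 := norm_Tri_le_left (lg H.left).int (hqL H.mid) (lg H.right) hs
  have b2 := norm_Tri_le_left (lg H.left).int (lg H.mid) (hqL H.right) hs
  have c1 := integral_sq_wmul_le_of_bound H.mid hq
  have c2 := integral_sq_wmul_le_of_bound H.right hq
  have c3 := integral_sq_wmul_le_of_bound H.mid (fun ξ => abs_gauss_le zero_le_one ξ)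
  have c4 := integral_sq_wmul_le_of_bound H.right (fun ξ => abs_gauss_le zero_le_one ξ)
  rw [div_mul_eq_mul_div, le_div_iff₀ hc, mul_comm, e]
  refine (mul_le_mul_of_nonneg_left (norm_sub_le _ _) hc.le).trans ?_
  linarith

/-- The trilinear commutator estimate: the commutator of multiplication by `a` with the multiplier
`ξ₀ m(ξ)` is bounded by the `L^∞` norms of the arguments and of `∂a`, times their `L²` size. -/
theorem exists_bound_commutator {m : E3 → ℝ} (hm : SymbolOrder0 m) : ∃ C, 0 ≤ C ∧
    ∀ a h g : E3 → ℝ, Triple a h g →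
      ‖∫ p : E3 × E3, triKer (hat a) (hat h) (hat g) p *
        ((rsym m p.2 - rsym m (p.1 + p.2) : ℝ) : ℂ)‖ ≤
        C * ((∫ x, h x ^ 2) + (∫ x, g x ^ 2) + ∑ j, ∫ x, pd j a x ^ 2) := by
  obtain ⟨C₁, hC₁, h₁⟩ := exists_bound_integral_regKer' hm
  obtain ⟨C₂, hC₂, h₂⟩ := exists_bound_integral_regKer_one hm
  refine ⟨C₁ + C₂, by positivity, fun a h g H => ?_⟩
  obtain ⟨hd, hde⟩ := integrable_dens H.left H.mid H.right
  rw [← hde]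
  have hle : (∫ x, h x ^ 2) + (∫ x, g x ^ 2) ≤ ∫ ξ, dens a h g ξ := by
    rw [hde]
    exact le_add_of_nonneg_right (Finset.sum_nonneg fun j _ => integral_nonneg fun x => sq_nonneg _)
  set W := triKer (hat a) (hat h) (hat g)
  have hW : Integrable W := integrable_triKer H.left.L12_hat.int H.mid.L12_hat H.right.L12_hat
  set G : ℝ → ℂ := fun τ => ∫ p, W p * (regKer m τ p : ℂ)
  set N : ℝ → ℝ := fun τ => ∫ ξ, gauss τ ξ * dens a h g ξ
  have hN0 : ∀ τ, 0 ≤ N τ := fun τ =>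
    integral_nonneg fun ξ => mul_nonneg (gauss_pos τ ξ).le (dens_nonneg a h g ξ)
  have hN1 : ∀ τ, 0 < τ → N τ ≤ ∫ ξ, dens a h g ξ := fun τ hτ =>
    integral_mono_of_nonneg
      (Eventually.of_forall fun ξ => mul_nonneg (gauss_pos τ ξ).le (dens_nonneg a h g ξ)) hd
      (Eventually.of_forall fun ξ =>
        mul_le_of_le_one_left (dens_nonneg a h g ξ) (gauss_le_one hτ.le ξ))
  have hG : ∀ τ, 0 < τ → HasDerivAt G (∫ p, W p * (regKer' m τ p : ℂ)) τ := fun τ hτ =>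
    hasDerivAt_integral_regKer hm hW hτ
  have hN : ∀ τ, 0 < τ → HasDerivAt N (-ener τ a h g) τ := fun τ hτ =>
    hasDerivAt_integral_gauss_dens hτ H.left H.mid H.right
  have key : ∀ δ, δ ∈ Set.Ioc (0 : ℝ) 1 → ‖G δ‖ ≤ (C₁ + C₂) * ∫ ξ, dens a h g ξ := by
    intro δ hδ
    have hpos : ∀ {x}, δ ≤ x → 0 < x := fun hx => hδ.1.trans_le hx
    have h3 := image_norm_le_of_norm_deriv_right_le_deriv_boundary' (a := δ) (b := 1)
      (f := fun τ => G τ - G δ) (f' := fun τ => ∫ p, W p * (regKer' m τ p : ℂ))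
      (B := fun τ => C₁ * (N δ - N τ)) (B' := fun τ => C₁ * ener τ a h g)
      (fun x hx => ((hG x (hpos hx.1)).sub_const _).continuousAt.continuousWithinAt)
      (fun x hx => ((hG x (hpos hx.1)).sub_const _).hasDerivWithinAt)
      (by simp)
      (fun x hx => (((hN x (hpos hx.1)).const_sub _).const_mul _).continuousAt.continuousWithinAt)
      (fun x hx => ((((hN x (hpos hx.1)).const_sub (N δ)).const_mul C₁).congr_deriv
        (by ring)).hasDerivWithinAt)
      (fun x hx => h₁ x (hpos hx.1) a h g H)
      (Set.right_mem_Icc.2 hδ.2)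
    have h4 := h₂ a h g H
    have h5 : ‖G δ‖ ≤ ‖G 1 - G δ‖ + ‖G 1‖ := by
      have := norm_sub_le (G 1) (G 1 - G δ)
      rw [sub_sub_cancel] at this
      linarith
    have h6 : C₁ * (N δ - N 1) ≤ C₁ * ∫ ξ, dens a h g ξ := by
      gcongr
      linarith [hN0 1, hN1 δ hδ.1]
    have h7 : C₂ * ((∫ x, h x ^ 2) + ∫ x, g x ^ 2) ≤ C₂ * ∫ ξ, dens a h g ξ := by gcongr
    have h8 : ‖G 1‖ ≤ C₂ * ((∫ x, h x ^ 2) + ∫ x, g x ^ 2) := h4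
    have h9 : ‖G 1 - G δ‖ ≤ C₁ * (N δ - N 1) := h3
    linarith
  have hlin : ∀ {f : E3 → ℝ}, C3c f → L12 (wmul (fun ξ => ‖ξ‖) (hat f)) := fun hf =>
    hf.L12_wmul continuous_norm (C := 1) fun ξ => by
      rw [abs_norm]; linarith
  have hW2 : Integrable (fun p => ‖W p‖ * ‖p.2‖) := by
    refine (integrable_triKer H.left.L12_hat.int (hlin H.mid) H.right.L12_hat).norm.congr
      (Eventually.of_forall fun p => ?_)
    simp only [W, triKer, wmul, norm_mul, Complex.norm_real, norm_norm]
    ring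
  have hW3 : Integrable (fun p => ‖W p‖ * ‖p.1 + p.2‖) := by
    refine (integrable_triKer H.left.L12_hat.int H.mid.L12_hat (hlin H.right)).norm.congr
      (Eventually.of_forall fun p => ?_)
    simp only [W, triKer, wmul, norm_mul, Complex.norm_real, norm_norm, RCLike.norm_conj]
    ring
  refine le_of_tendsto (tendsto_integral_regKer hm hW.1 hW2 hW3).norm ?_
  exact mem_of_superset (Ioc_mem_nhdsGT one_pos) key

theorem IF_sub {X Y : E3 → ℂ} (hX : Integrable X) (hY : Integrable Y) (x : E3) :
    IF (fun ξ => X ξ - Y ξ) x = IF X x - IF Y x := by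
  unfold IF
  rw [← mul_sub, ← integral_sub (hX.phase_mul _) (hY.phase_mul _)]
  simp only [mul_sub]

theorem IF_const_mul (c : ℂ) (X : E3 → ℂ) (x : E3) : IF (fun ξ => c * X ξ) x = c * IF X x := by
  unfold IF
  rw [mul_left_comm c, ← integral_const_mul c]
  congr 2
  funext ξ
  ring

theorem hat_sub {f g : E3 → ℝ} (hf : C3c f) (hg : C3c g) (ξ : E3) :
    hat (fun x => f x - g x) ξ = hat f ξ - hat g ξ := by
  simp only [hat_eq_IF_neg, Complex.ofReal_sub]
  exact IF_sub (integrable_ofReal_of_compact hf.continuous hf.compact)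
    (integrable_ofReal_of_compact hg.continuous hg.compact) _

theorem hat_const_mul (c : ℝ) (f : E3 → ℝ) (ξ : E3) : hat (fun x => c * f x) ξ = c * hat f ξ := by
  simp only [hat_eq_IF_neg, Complex.ofReal_mul]
  exact IF_const_mul _ _ _

theorem C3c.sub {f g : E3 → ℝ} (hf : C3c f) (hg : C3c g) : C3c (fun x => f x - g x) :=
  ⟨hf.smooth.sub hg.smooth, hf.compact.sub hg.compact⟩

theorem C3c.const_mul {f : E3 → ℝ} (hf : C3c f) (c : ℝ) : C3c (fun x => c * f x) :=
  ⟨contDiff_const.mul hf.smooth, hf.compact.mul_left⟩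

theorem C3c.mul {f g : E3 → ℝ} (hf : C3c f) (hg : C3c g) : C3c (fun x => f x * g x) :=
  ⟨hf.smooth.mul hg.smooth, hf.compact.mul_right⟩

theorem C3c.differentiable {f : E3 → ℝ} (hf : C3c f) : Differentiable ℝ f :=
  hf.smooth.differentiable (by norm_num)

theorem pd_sub {f g : E3 → ℝ} {x : E3} (hf : DifferentiableAt ℝ f x) (hg : DifferentiableAt ℝ g x)
    (j : Fin 3) : pd j (fun y => f y - g y) x = pd j f x - pd j g x := by
  unfold pd
  rw [fderiv_fun_sub hf hg]
  rfl

theorem pd_mul {f g : E3 → ℝ} {x : E3} (hf : DifferentiableAt ℝ f x) (hg : DifferentiableAt ℝ g x)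
    (j : Fin 3) : pd j (fun y => f y * g y) x = pd j f x * g x + f x * pd j g x := by
  unfold pd
  rw [fderiv_fun_mul hf hg]
  simp only [add_apply, smul_apply, smul_eq_mul]
  ring

theorem pd_const_mul {f : E3 → ℝ} {x : E3} (hf : DifferentiableAt ℝ f x) (c : ℝ) (j : Fin 3) :
    pd j (fun y => c * f y) x = c * pd j f x := by
  unfold pd
  rw [fderiv_const_mul hf]
  rfl

/-- The trilinear form of the commutator of multiplication by `a` with `ξ₀ m(ξ)`. -/
def commForm (m a h g : E3 → ℝ) : ℂ :=
  ∫ p : E3 × E3, triKer (hat a) (hat h) (hat g) p *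
    ((rsym m p.2 - rsym m (p.1 + p.2) : ℝ) : ℂ)

theorem C3c.L12_symbol {m f : E3 → ℝ} (hm : SymbolOrder0 m) (hf : C3c f) :
    L12 (wmul m (hat f)) := by
  obtain ⟨M, hM0, hM⟩ := hm.exists_bound_self
  refine hf.L12_wmul hm.continuous (C := M) fun ξ => (hM ξ).trans ?_
  exact le_mul_of_one_le_right hM0 (by linarith [norm_nonneg ξ])

theorem C3c.L12_rsym {m f : E3 → ℝ} (hm : SymbolOrder0 m) (hf : C3c f) :
    L12 (wmul (rsym m) (hat f)) := by
  obtain ⟨M, hM0, hM⟩ := hm.exists_bound_self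
  refine hf.L12_wmul hm.continuous_rsym (C := M) fun ξ => ?_
  rw [rsym, abs_mul, mul_comm]
  refine mul_le_mul (hM ξ) ((abs_coord_le ξ 0).trans ?_) (abs_nonneg _) hM0
  linarith

theorem triKer_mul_rsym (m : E3 → ℝ) (A B C : E3 → ℂ) (p : E3 × E3) :
    triKer A B C p * ((rsym m p.2 - rsym m (p.1 + p.2) : ℝ) : ℂ) =
      triKer A (wmul (rsym m) B) C p - triKer A B (wmul (rsym m) C) p := by
  simp only [triKer, wmul, map_mul, Complex.conj_ofReal]
  push_cast
  ring

theorem integrable_comm {m a h g : E3 → ℝ} (hm : SymbolOrder0 m) (ha : C3c a) (hh : C3c h)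
    (hg : C3c g) : Integrable (fun p : E3 × E3 => triKer (hat a) (hat h) (hat g) p *
      ((rsym m p.2 - rsym m (p.1 + p.2) : ℝ) : ℂ)) := by
  simp only [triKer_mul_rsym]
  exact (integrable_triKer ha.L12_hat.int (hh.L12_rsym hm) hg.L12_hat).sub
    (integrable_triKer ha.L12_hat.int hh.L12_hat (hg.L12_rsym hm))

theorem commForm_eq {m a h g : E3 → ℝ} (hm : SymbolOrder0 m) (ha : C3c a) (hh : C3c h) (hg : C3c g) :
    commForm m a h g = Tri (hat a) (wmul (rsym m) (hat h)) (hat g) -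
      Tri (hat a) (hat h) (wmul (rsym m) (hat g)) := by
  unfold commForm
  simp only [triKer_mul_rsym]
  exact integral_sub (integrable_triKer ha.L12_hat.int (hh.L12_rsym hm) hg.L12_hat)
    (integrable_triKer ha.L12_hat.int hh.L12_hat (hg.L12_rsym hm))

theorem commForm_sub_left {m a a' h g : E3 → ℝ} (hm : SymbolOrder0 m) (ha : C3c a) (ha' : C3c a')
    (hh : C3c h) (hg : C3c g) :
    commForm m (fun x => a x - a' x) h g = commForm m a h g - commForm m a' h g := by
  unfold commForm
  rw [← integral_sub (integrable_comm hm ha hh hg) (integrable_comm hm ha' hh hg)]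
  congr 1
  funext p
  simp only [triKer, hat_sub ha ha']
  ring

theorem commForm_sub_mid {m a h h' g : E3 → ℝ} (hm : SymbolOrder0 m) (ha : C3c a) (hh : C3c h)
    (hh' : C3c h') (hg : C3c g) :
    commForm m a (fun x => h x - h' x) g = commForm m a h g - commForm m a h' g := by
  unfold commForm
  rw [← integral_sub (integrable_comm hm ha hh hg) (integrable_comm hm ha hh' hg)]
  congr 1
  funext p
  simp only [triKer, hat_sub hh hh']
  ring

theorem commForm_sub_right {m a h g g' : E3 → ℝ} (hm : SymbolOrder0 m) (ha : C3c a) (hh : C3c h)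
    (hg : C3c g) (hg' : C3c g') :
    commForm m a h (fun x => g x - g' x) = commForm m a h g - commForm m a h g' := by
  unfold commForm
  rw [← integral_sub (integrable_comm hm ha hh hg) (integrable_comm hm ha hh hg')]
  congr 1
  funext p
  simp only [triKer, hat_sub hg hg', map_sub]
  ring

theorem commForm_const_mul (m a h g : E3 → ℝ) (A B C : ℝ) :
    commForm m (fun x => A * a x) (fun x => B * h x) (fun x => C * g x) =
      ((A * B * C : ℝ) : ℂ) * commForm m a h g := by
  unfold commForm
  rw [← integral_const_mul]
  congr 1
  funext p
  simp only [triKer, hat_const_mul, map_mul, Complex.conj_ofReal]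
  push_cast
  ring

/-- The part of the commutator form in which the derivative falls on the coefficient. -/
def lead (m b a f g : E3 → ℝ) : ℂ :=
  ∫ x, ((f x * pd 0 (fun y => a y * b y) x : ℝ) : ℂ) * IF (wmul m (hat g)) x

theorem integrable_lead {m b a f g : E3 → ℝ} (hm : SymbolOrder0 m) (hb : C3c b) (ha : C3c a)
    (hf : C3c f) (hg : C3c g) : Integrable (fun x =>
      ((f x * pd 0 (fun y => a y * b y) x : ℝ) : ℂ) * IF (wmul m (hat g)) x) := by
  have hc : Continuous (fun x => f x * pd 0 (fun y => a y * b y) x) :=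
    hf.continuous.mul ((ha.mul hb).contDiff_pd 0).continuous
  refine Continuous.integrable_of_hasCompactSupport
    ((Complex.continuous_ofReal.comp hc).mul (continuous_IF (hg.L12_symbol hm).int)) ?_
  refine HasCompactSupport.mul_right ?_
  exact (hf.compact.mul_right (f' := pd 0 (fun y => a y * b y))).comp_left
    (g := Complex.ofReal) Complex.ofReal_zero

theorem lead_sub_left {m b a a' f g : E3 → ℝ} (hm : SymbolOrder0 m) (hb : C3c b) (ha : C3c a)
    (ha' : C3c a') (hf : C3c f) (hg : C3c g) :
    lead m b (fun x => a x - a' x) f g = lead m b a f g - lead m b a' f g := by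
  unfold lead
  rw [← integral_sub (integrable_lead hm hb ha hf hg) (integrable_lead hm hb ha' hf hg)]
  congr 1
  funext x
  simp only [sub_mul]
  rw [pd_sub ((ha.mul hb).differentiable x) ((ha'.mul hb).differentiable x)]
  push_cast
  ring

theorem lead_sub_mid {m b a f f' g : E3 → ℝ} (hm : SymbolOrder0 m) (hb : C3c b) (ha : C3c a)
    (hf : C3c f) (hf' : C3c f') (hg : C3c g) :
    lead m b a (fun x => f x - f' x) g = lead m b a f g - lead m b a f' g := by
  unfold lead
  rw [← integral_sub (integrable_lead hm hb ha hf hg) (integrable_lead hm hb ha hf' hg)]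
  congr 1
  funext x
  push_cast
  ring

theorem lead_sub_right {m b a f g g' : E3 → ℝ} (hm : SymbolOrder0 m) (hb : C3c b) (ha : C3c a)
    (hf : C3c f) (hg : C3c g) (hg' : C3c g') :
    lead m b a f (fun x => g x - g' x) = lead m b a f g - lead m b a f g' := by
  unfold lead
  rw [← integral_sub (integrable_lead hm hb ha hf hg) (integrable_lead hm hb ha hf hg')]
  congr 1
  funext x
  have e : wmul m (hat fun x => g x - g' x) = fun ξ => wmul m (hat g) ξ - wmul m (hat g') ξ := by
    funext ξ
    simp only [wmul, hat_sub hg hg', mul_sub]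
  rw [e, IF_sub (hg.L12_symbol hm).int (hg'.L12_symbol hm).int, mul_sub]

theorem lead_const_mul {m b a f g : E3 → ℝ} (hb : C3c b) (ha : C3c a) (A B C : ℝ) :
    lead m b (fun x => A * a x) (fun x => B * f x) (fun x => C * g x) =
      ((A * B * C : ℝ) : ℂ) * lead m b a f g := by
  unfold lead
  rw [← integral_const_mul]
  congr 1
  funext x
  have e : wmul m (hat fun x => C * g x) = fun ξ => (C : ℂ) * wmul m (hat g) ξ := by
    funext ξ
    simp only [wmul, hat_const_mul]
    ring
  simp only [mul_assoc A]
  rw [e, IF_const_mul, pd_const_mul ((ha.mul hb).differentiable x)]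
  push_cast
  ring

/-- The commutator form of the statement, with coefficient `a` of compact support. -/
def form (m b a f g : E3 → ℝ) : ℂ :=
  lead m b a f g + Complex.I * fourierConst * commForm m a g (fun x => b x * f x)

theorem form_sub_left {m b a a' f g : E3 → ℝ} (hm : SymbolOrder0 m) (hb : C3c b) (ha : C3c a)
    (ha' : C3c a') (hf : C3c f) (hg : C3c g) :
    form m b (fun x => a x - a' x) f g = form m b a f g - form m b a' f g := by
  unfold form
  rw [lead_sub_left hm hb ha ha' hf hg, commForm_sub_left hm ha ha' hg (hb.mul hf)]
  ring

theorem form_sub_mid {m b a f f' g : E3 → ℝ} (hm : SymbolOrder0 m) (hb : C3c b) (ha : C3c a)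
    (hf : C3c f) (hf' : C3c f') (hg : C3c g) :
    form m b a (fun x => f x - f' x) g = form m b a f g - form m b a f' g := by
  unfold form
  simp only [mul_sub]
  rw [lead_sub_mid hm hb ha hf hf' hg, commForm_sub_right hm ha hg (hb.mul hf) (hb.mul hf')]
  ring

theorem form_sub_right {m b a f g g' : E3 → ℝ} (hm : SymbolOrder0 m) (hb : C3c b) (ha : C3c a)
    (hf : C3c f) (hg : C3c g) (hg' : C3c g') :
    form m b a f (fun x => g x - g' x) = form m b a f g - form m b a f g' := by
  unfold form
  rw [lead_sub_right hm hb ha hf hg hg', commForm_sub_mid hm ha hg hg' (hb.mul hf)]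
  ring

theorem form_const_mul {m b a f g : E3 → ℝ} (hb : C3c b) (ha : C3c a) (A B C : ℝ) :
    form m b (fun x => A * a x) (fun x => B * f x) (fun x => C * g x) =
      ((A * B * C : ℝ) : ℂ) * form m b a f g := by
  unfold form
  simp only [mul_left_comm _ B]
  rw [lead_const_mul hb ha, commForm_const_mul]
  push_cast
  ring

theorem integral_sq_le_volume {S : Set E3} (hS : IsCompact S) {f : E3 → ℝ} {D : ℝ}
    (h0 : ∀ x, x ∉ S → f x = 0) (h1 : ∀ x, |f x| ≤ D) :
    ∫ x, f x ^ 2 ≤ D ^ 2 * volume.real S := by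
  rw [← setIntegral_eq_integral_of_forall_compl_eq_zero (s := S) fun x hx => by simp [h0 x hx]]
  have h := norm_setIntegral_le_of_norm_le_const (μ := volume) (s := S) (f := fun x => f x ^ 2)
    (C := D ^ 2) hS.measure_lt_top fun x _ => by
      rw [norm_pow, Real.norm_eq_abs]
      exact pow_le_pow_left₀ (abs_nonneg _) (h1 x) 2
  exact (le_abs_self _).trans h

theorem norm_lead_le {m a b f g : E3 → ℝ} (hm : SymbolOrder0 m) (hb : C3c b) {S : Set E3}
    (hS : IsCompact S) {M B V : ℝ} (hM : ∀ ξ, |m ξ| ≤ M) (hBb : ∀ x, |b x| ≤ B)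
    (hBd : ∀ x, |pd 0 b x| ≤ B) (ha : C3c a) (hf : C3c f) (hg : C3c g) (sf : tsupport f ⊆ S)
    (a1 : ∀ x, |a x| ≤ 1) (d1 : ∀ x, |pd 0 a x| ≤ 1) (f1 : ∀ x, |f x| ≤ 1)
    (Vg : ∫ x, g x ^ 2 ≤ V) :
    ‖lead m b a f g‖ ≤ (2 * B) ^ 2 * volume.real S + M ^ 2 * V := by
  have hp : ∀ x, |pd 0 (fun y => a y * b y) x| ≤ 2 * B := fun x => by
    rw [pd_mul (ha.differentiable x) (hb.differentiable x)]
    refine (abs_add_le _ _).trans ?_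
    rw [abs_mul, abs_mul]
    have h1 := mul_le_mul (d1 x) (hBb x) (abs_nonneg _) zero_le_one
    have h2 := mul_le_mul (a1 x) (hBd x) (abs_nonneg _) zero_le_one
    linarith
  have hu : ∀ x, |f x * pd 0 (fun y => a y * b y) x| ≤ 2 * B := fun x => by
    rw [abs_mul]
    have := mul_le_mul (f1 x) (hp x) (abs_nonneg _) zero_le_one
    linarith
  have h1 : ∫ x, (f x * pd 0 (fun y => a y * b y) x) ^ 2 ≤ (2 * B) ^ 2 * volume.real S :=
    integral_sq_le_volume hS (fun x hx => by
      rw [image_eq_zero_of_notMem_tsupport fun h => hx (sf h), zero_mul]) hu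
  have h2 : ∫ x, ‖IF (wmul m (hat g)) x‖ ^ 2 ≤ M ^ 2 * V := by
    rw [integral_norm_sq_IF (hg.L12_symbol hm)]
    exact (integral_sq_wmul_le_of_bound hg hM).trans (by gcongr)
  have hcont : Continuous (fun x => f x * pd 0 (fun y => a y * b y) x) :=
    hf.continuous.mul ((ha.mul hb).contDiff_pd 0).continuous
  have i1 : Integrable (fun x => (f x * pd 0 (fun y => a y * b y) x) ^ 2) := by
    refine (hcont.pow 2).integrable_of_hasCompactSupport (hf.compact.mono fun x hx hfx => hx ?_)
    change (f x * _) ^ 2 = 0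
    rw [hfx, zero_mul, zero_pow two_ne_zero]
  have i2 := integrable_norm_sq_IF (hg.L12_symbol hm)
  refine le_trans ?_ (add_le_add h1 h2)
  rw [← integral_add i1 i2]
  have h3 : ∀ s t : ℝ, |s| * |t| ≤ s ^ 2 + t ^ 2 := fun s t => by
    rw [← sq_abs s, ← sq_abs t]
    nlinarith [sq_nonneg (|s| - |t|), sq_nonneg |s|, sq_nonneg |t|]
  have i3 : Integrable (fun x => (f x * pd 0 (fun y => a y * b y) x) ^ 2 +
      ‖IF (wmul m (hat g)) x‖ ^ 2) := i1.add i2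
  unfold lead
  refine norm_integral_le_of_norm_le i3 (Eventually.of_forall fun x => ?_)
  have h := h3 (f x * pd 0 (fun y => a y * b y) x) ‖IF (wmul m (hat g)) x‖
  rw [abs_norm] at h
  rw [norm_mul, Complex.norm_real, Real.norm_eq_abs]
  exact h

/-- The commutator form is bounded by the Lipschitz norm of the coefficient and the `L^∞` norms of
the arguments. -/
theorem exists_bound_form {m b : E3 → ℝ} (hm : SymbolOrder0 m) (hb : C3c b) {S : Set E3}
    (hS : IsCompact S) : ∃ C, 0 ≤ C ∧ ∀ a f g : E3 → ℝ, C3c a → C3c f → C3c g →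
      tsupport a ⊆ S → tsupport f ⊆ S → tsupport g ⊆ S → ∀ A F G : ℝ, 0 < A → 0 < F → 0 < G →
      (∀ x, |a x| ≤ A) → (∀ j x, |pd j a x| ≤ A) → (∀ x, |f x| ≤ F) → (∀ x, |g x| ≤ G) →
      ‖form m b a f g‖ ≤ C * (A * F * G) := by
  obtain ⟨M, hM0, hM⟩ := hm.exists_bound_self
  obtain ⟨C, hC0, hC⟩ := exists_bound_commutator hm
  obtain ⟨B₁, hB₁⟩ := exists_bound_of_compact hb.continuous hb.compact
  obtain ⟨B₂, hB₂⟩ := exists_bound_of_compact (hb.contDiff_pd 0).continuous (hb.compact.pd 0)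
  set B := max 1 (max B₁ B₂)
  have hB1 : 1 ≤ B := le_max_left _ _
  have hBb : ∀ x, |b x| ≤ B := fun x => (hB₁ x).trans ((le_max_left _ _).trans (le_max_right _ _))
  have hBd : ∀ x, |pd 0 b x| ≤ B := fun x =>
    (hB₂ x).trans ((le_max_right _ _).trans (le_max_right _ _))
  have hB0 : 0 < B := by linarith
  set V := volume.real S
  have hV : 0 ≤ V := measureReal_nonneg
  have hc := fourierConst_pos
  have key : ∀ a f g : E3 → ℝ, C3c a → C3c f → C3c g →
      tsupport a ⊆ S → tsupport f ⊆ S → tsupport g ⊆ S →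
      (∀ x, |a x| ≤ 1) → (∀ j x, |pd j a x| ≤ 1) → (∀ x, |f x| ≤ 1) → (∀ x, |g x| ≤ 1) →
      ‖form m b a f g‖ ≤ ((2 * B) ^ 2 * V + M ^ 2 * V) + fourierConst * (B * (C * (5 * V))) := by
    intro a f g ha hf hg sa sf sg a1 d1 f1 g1
    have z : ∀ {u : E3 → ℝ}, tsupport u ⊆ S → ∀ x, x ∉ S → u x = 0 := fun hu x hx =>
      image_eq_zero_of_notMem_tsupport fun h => hx (hu h)
    have Vg : ∫ x, g x ^ 2 ≤ V := by simpa using integral_sq_le_volume hS (z sg) g1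
    refine (norm_add_le _ _).trans (add_le_add ?_ ?_)
    · exact norm_lead_le hm hb hS hM hBb hBd ha hf hg sf a1 (d1 0) f1 Vg
    · set h := fun x => B⁻¹ * (b x * f x)
      have hh : C3c h := (hb.mul hf).const_mul _
      have h1 : ∀ x, |h x| ≤ 1 := fun x => by
        rw [abs_mul, abs_of_pos (inv_pos.2 hB0), inv_mul_le_iff₀ hB0, abs_mul]
        exact mul_le_mul (hBb x) (f1 x) (abs_nonneg _) hB0.le
      have e : commForm m a g (fun x => b x * f x) = (B : ℂ) * commForm m a g h := by
        have := commForm_const_mul m a g h 1 1 B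
        simp only [one_mul] at this
        rw [← this]
        congr 1
        funext x
        simp only [h]
        rw [mul_inv_cancel_left₀ hB0.ne']
      rw [norm_mul, norm_mul, Complex.norm_I, one_mul, Complex.norm_real,
        Real.norm_of_nonneg hc.le, e, norm_mul, Complex.norm_real, Real.norm_of_nonneg hB0.le]
      gcongr
      refine (hC a g h ⟨ha, hg, hh, a1, d1, g1, h1⟩).trans ?_
      gcongr
      have Vh : ∫ x, h x ^ 2 ≤ V := by
        simpa using integral_sq_le_volume hS (fun x hx => by simp [h, z sf x hx]) h1
      have Va : ∀ j, ∫ x, pd j a x ^ 2 ≤ V := fun j => by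
        simpa using integral_sq_le_volume hS (z ((tsupport_pd_subset a j).trans sa)) (d1 j)
      have Vs : ∑ j, ∫ x, pd j a x ^ 2 ≤ 3 * V :=
        (Finset.sum_le_sum fun j _ => Va j).trans (by simp)
      linarith
  refine ⟨((2 * B) ^ 2 * V + M ^ 2 * V) + fourierConst * (B * (C * (5 * V))), by positivity, ?_⟩
  intro a f g ha hf hg sa sf sg A F G hA hF hG a1 d1 f1 g1
  have hsc : ∀ {u : E3 → ℝ} {D : ℝ}, 0 < D → ∀ x, |u x| ≤ D → |D⁻¹ * u x| ≤ 1 :=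
    fun hD x hu => by
      rw [abs_mul, abs_of_pos (inv_pos.2 hD), inv_mul_le_iff₀ hD, mul_one]
      exact hu
  have hsp : ∀ {u : E3 → ℝ} {D : ℝ}, tsupport u ⊆ S → tsupport (fun x => D * u x) ⊆ S :=
    fun hu => (tsupport_mul_subset_right).trans hu
  have h := key _ _ _ (ha.const_mul A⁻¹) (hf.const_mul F⁻¹) (hg.const_mul G⁻¹) (hsp sa) (hsp sf)
    (hsp sg) (fun x => hsc hA x (a1 x))
    (fun j x => by
      rw [pd_const_mul (ha.differentiable x)]
      exact hsc (u := pd j a) hA x (d1 j x))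
    (fun x => hsc hF x (f1 x)) (fun x => hsc hG x (g1 x))
  have e := form_const_mul (m := m) (b := b) (a := fun x => A⁻¹ * a x) (f := fun x => F⁻¹ * f x)
    (g := fun x => G⁻¹ * g x) hb (ha.const_mul A⁻¹) A F G
  simp only [mul_inv_cancel_left₀ hA.ne', mul_inv_cancel_left₀ hF.ne',
    mul_inv_cancel_left₀ hG.ne'] at e
  rw [e, norm_mul, Complex.norm_real, Real.norm_of_nonneg (by positivity), mul_comm]
  gcongr

theorem FMul_eq_IF_hat (m f : E3 → ℝ) : FMul m f = IF (wmul m (hat f)) := by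
  funext x
  exact FMul_eq m f x

theorem FMul_pd_zero {m f : E3 → ℝ} (hf : C3c f) (x : E3) :
    FMul m (pd 0 f) x = Complex.I * IF (wmul (rsym m) (hat f)) x := by
  rw [FMul_eq_IF_hat, ← IF_const_mul]
  congr 1
  funext ξ
  simp only [wmul, rsym, hf.hat_pd]
  push_cast
  ring

theorem C3c.integrable_weight_symbol {m f : E3 → ℝ} (hm : SymbolOrder0 m) (hf : C3c f) :
    Integrable (fun ξ : E3 => (1 + ‖ξ‖) * ‖wmul m (hat f) ξ‖) := by
  obtain ⟨M, hM0, hM⟩ := hm.exists_bound_self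
  refine (hf.integrable_weight_hat.const_mul M).mono' ?_ (Eventually.of_forall fun ξ => ?_)
  · exact ((continuous_const.add continuous_norm).aestronglyMeasurable).mul
      (hf.L12_symbol hm).int.aestronglyMeasurable.norm
  · rw [Real.norm_of_nonneg (by positivity), wmul, norm_mul, Complex.norm_real, Real.norm_eq_abs,
      mul_left_comm]
    gcongr
    exact hM ξ

theorem differentiable_IF_symbol {m f : E3 → ℝ} (hm : SymbolOrder0 m) (hf : C3c f) :
    Differentiable ℝ (IF (wmul m (hat f))) :=
  differentiable_IF (hf.L12_symbol hm).int.aestronglyMeasurable (hf.integrable_weight_symbol hm)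

theorem pdC_zero_IF_symbol {m f : E3 → ℝ} (hm : SymbolOrder0 m) (hf : C3c f) (x : E3) :
    pdC 0 (IF (wmul m (hat f))) x = Complex.I * IF (wmul (rsym m) (hat f)) x := by
  rw [pdC_IF (hf.L12_symbol hm).int.aestronglyMeasurable (hf.integrable_weight_symbol hm),
    ← IF_const_mul]
  congr 1
  funext ξ
  simp only [wmul, rsym]
  push_cast
  ring

theorem pdC_ofReal_mul {u : E3 → ℝ} {w : E3 → ℂ} {x : E3} (hu : DifferentiableAt ℝ u x)
    (hw : DifferentiableAt ℝ w x) (j : Fin 3) :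
    pdC j (fun y => (u y : ℂ) * w y) x = (pd j u x : ℂ) * w x + (u x : ℂ) * pdC j w x := by
  have h1 := Complex.ofRealCLM.hasFDerivAt.comp x hu.hasFDerivAt
  have h2 := h1.mul hw.hasFDerivAt
  unfold pdC pd
  rw [show (fun y => (u y : ℂ) * w y) = (Complex.ofRealCLM ∘ u) * w from rfl, h2.fderiv]
  simp
  ring

theorem integral_mul_IF_rsym {m a g h : E3 → ℝ} (hm : SymbolOrder0 m) (ha : C3c a) (hg : C3c g)
    (hh : C3c h) :
    ∫ x, (h x : ℂ) * ((a x : ℂ) * IF (wmul (rsym m) (hat g)) x) =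
      fourierConst * Tri (hat a) (wmul (rsym m) (hat g)) (hat h) := by
  rw [fourierConst_mul_Tri ha.L12_hat.int (hg.L12_rsym hm) hh.L12_hat]
  congr 1
  funext x
  rw [ha.IF_hat, hh.IF_hat, Complex.conj_ofReal]
  ring

theorem integral_mul_IF_rsym_mul {m a g h : E3 → ℝ} (hm : SymbolOrder0 m) (ha : C3c a)
    (hg : C3c g) (hh : C3c h) :
    ∫ x, (h x : ℂ) * IF (wmul (rsym m) (hat (fun y => a y * g y))) x =
      fourierConst * Tri (hat a) (hat g) (wmul (rsym m) (hat h)) := by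
  have hag := ha.mul hg
  rw [fourierConst_mul_Tri ha.L12_hat.int hg.L12_hat (hh.L12_rsym hm)]
  have e1 := integral_IF_mul_conj (hag.L12_rsym hm) hh.L12_hat
  have e2 := integral_IF_mul_conj hag.L12_hat (hh.L12_rsym hm)
  calc _ = ∫ x, IF (wmul (rsym m) (hat (fun y => a y * g y))) x *
        (starRingEnd ℂ) (IF (hat h) x) := by
        congr 1
        funext x
        rw [hh.IF_hat, Complex.conj_ofReal, mul_comm]
    _ = ∫ x, IF (hat fun y => a y * g y) x * (starRingEnd ℂ) (IF (wmul (rsym m) (hat h)) x) := by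
        rw [e1, e2]
        congr 1
        funext ξ
        simp only [wmul, map_mul, Complex.conj_ofReal]
        ring
    _ = _ := by
        congr 1
        funext x
        rw [hag.IF_hat, ha.IF_hat, hg.IF_hat, Complex.ofReal_mul, mul_assoc]

theorem C3c.integrable_ofReal_mul {h : E3 → ℝ} (hh : C3c h) {w : E3 → ℂ} (hw : Continuous w) :
    Integrable (fun x => (h x : ℂ) * w x) := by
  refine Continuous.integrable_of_hasCompactSupport
    ((Complex.continuous_ofReal.comp hh.continuous).mul hw) ?_
  refine hh.compact.mono fun x hx hfx => hx ?_
  change (h x : ℂ) * _ = 0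
  rw [hfx, Complex.ofReal_zero, zero_mul]

/-- The commutator form with a coefficient `E` only depends on a localization `a` of `E` near the
supports of the arguments. -/
theorem integral_commutator_eq_form {m b E a f g : E3 → ℝ} {T : Set E3} (hm : SymbolOrder0 m)
    (hb : C3c b) (ha : C3c a) (hf : C3c f) (hg : C3c g) (hfT : tsupport f ⊆ T)
    (hgT : tsupport g ⊆ T) (hE : ∀ x ∈ T, E =ᶠ[nhds x] a) :
    ∫ x, (f x : ℂ) * (pdC 0 (fun y => (E y : ℂ) * ((b y : ℂ) * FMul m g y)) x -
      (b x : ℂ) * FMul m (fun y => pd 0 (fun z => E z * g z) y) x) = form m b a f g := by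
  have hEg : (fun z => E z * g z) = fun z => a z * g z := by
    funext z
    by_cases hz : z ∈ tsupport g
    · rw [(hE z (hgT hz)).self_of_nhds]
    · rw [image_eq_zero_of_notMem_tsupport hz, mul_zero, mul_zero]
  have hh : C3c (fun x => b x * f x) := hb.mul hf
  have hag := ha.mul hg
  have hpt : ∀ x, (f x : ℂ) * (pdC 0 (fun y => (E y : ℂ) * ((b y : ℂ) * FMul m g y)) x -
      (b x : ℂ) * FMul m (fun y => pd 0 (fun z => E z * g z) y) x) =
      ((f x * pd 0 (fun y => a y * b y) x : ℝ) : ℂ) * IF (wmul m (hat g)) x +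
      Complex.I * (((b x * f x : ℝ) : ℂ) * ((a x : ℂ) * IF (wmul (rsym m) (hat g)) x) -
        ((b x * f x : ℝ) : ℂ) * IF (wmul (rsym m) (hat (fun y => a y * g y))) x) := by
    intro x
    by_cases hx : x ∈ tsupport f
    · have e1 : pdC 0 (fun y => (E y : ℂ) * ((b y : ℂ) * FMul m g y)) x =
          pdC 0 (fun y => ((a y * b y : ℝ) : ℂ) * IF (wmul m (hat g)) y) x := by
        unfold pdC
        rw [Filter.EventuallyEq.fderiv_eq]
        filter_upwards [hE x (hfT hx)] with y hy
        rw [hy, FMul_eq_IF_hat]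
        push_cast
        ring
      rw [e1, pdC_ofReal_mul ((ha.mul hb).differentiable x) (differentiable_IF_symbol hm hg x),
        pdC_zero_IF_symbol hm hg, hEg, FMul_pd_zero hag]
      push_cast
      ring
    · rw [image_eq_zero_of_notMem_tsupport hx]
      simp
  have i1 := integrable_lead hm hb ha hf hg
  have i2 : Integrable fun x => ((b x * f x : ℝ) : ℂ) *
      ((a x : ℂ) * IF (wmul (rsym m) (hat g)) x) :=
    hh.integrable_ofReal_mul ((Complex.continuous_ofReal.comp ha.continuous).mul
      (continuous_IF (hg.L12_rsym hm).int))
  have i3 : Integrable fun x => ((b x * f x : ℝ) : ℂ) *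
      IF (wmul (rsym m) (hat (fun y => a y * g y))) x :=
    hh.integrable_ofReal_mul (continuous_IF (hag.L12_rsym hm).int)
  have i4 : Integrable fun x => Complex.I *
      (((b x * f x : ℝ) : ℂ) * ((a x : ℂ) * IF (wmul (rsym m) (hat g)) x) -
        ((b x * f x : ℝ) : ℂ) * IF (wmul (rsym m) (hat (fun y => a y * g y))) x) :=
    (i2.sub i3).const_mul _
  simp only [hpt]
  rw [integral_add i1 i4, integral_const_mul, integral_sub i2 i3,
    integral_mul_IF_rsym hm ha hg hh, integral_mul_IF_rsym_mul hm ha hg hh, form,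
    commForm_eq hm ha hg hh, lead]
  ring

theorem exists_cutoff {s K : Set E3} (hs : IsClosed s) (hK : IsCompact K) (h : s ⊆ interior K) :
    ∃ η : E3 → ℝ, C3c η ∧ tsupport η ⊆ K ∧ ∀ x ∈ s, η =ᶠ[nhds x] fun _ => 1 := by
  obtain ⟨f, h1, h0, -⟩ :=
    exists_contMDiffMap_one_nhds_of_subset_interior (n := 3) (modelWithCornersSelf ℝ E3) hs h
  have hsub : tsupport f ⊆ K := closure_minimal
    (fun x hx => by_contra fun hxK => hx (h0 x hxK)) hK.isClosed
  refine ⟨f, ⟨f.contMDiff.contDiff, hK.of_isClosed_subset (isClosed_tsupport _) hsub⟩, hsub,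
    fun x hx => ?_⟩
  exact h1.filter_mono (nhds_le_nhdsSet hx)

theorem eventually_abs_le {K : Set E3} (hK : IsCompact K) {f : E3 → ℝ} (hf : Continuous f) :
    ∀ᶠ L in atTop, ∀ x ∈ K, |f x| ≤ L := by
  obtain ⟨C, hC⟩ := hK.exists_bound_of_continuousOn hf.continuousOn
  filter_upwards [eventually_ge_atTop C] with L hL x hx
  exact (hC x hx).trans hL

theorem abs_exp_sub_exp_le {s t Γ : ℝ} (hs : |s| ≤ Γ) (ht : |t| ≤ Γ) :
    |Real.exp (2 * s) - Real.exp (2 * t)| ≤ 2 * Real.exp (2 * Γ) * |s - t| := by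
  have h := (convex_Icc (-Γ) Γ).norm_image_sub_le_of_norm_hasDerivWithin_le
    (f := fun u => Real.exp (2 * u)) (f' := fun u => Real.exp (2 * u) * (2 * 1))
    (C := 2 * Real.exp (2 * Γ)) (x := t) (y := s)
    (fun u _ => (((hasDerivAt_id u).const_mul 2).exp).hasDerivWithinAt)
    (fun u hu => by
      rw [mul_one, mul_comm, norm_mul, Real.norm_of_nonneg (Real.exp_pos _).le, Real.norm_two]
      gcongr
      exact hu.2) (abs_le.1 ht) (abs_le.1 hs)
  exact h

/-- The normalized derivative of `u` along `∂_t - βⁱ∂_i`. -/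
def flux (β : Fin 2 → E3 → ℝ) (N u : E3 → ℝ) (x : E3) : ℝ := e0 β u x / N x

theorem C3c_flux {β : Fin 2 → E3 → ℝ} {N u : E3 → ℝ} (hβ : ∀ i, ContDiff ℝ 3 (β i))
    (hN : ContDiff ℝ 3 N) (hN0 : ∀ x, N x ≠ 0) (hu : ContDiff ℝ 4 u) (hc : HasCompactSupport u) :
    C3c (flux β N u) where
  smooth := by
    have h : ∀ j, ContDiff ℝ 3 (pd j u) := fun j => ContDiff.pd (by exact_mod_cast hu) j
    exact ((h 0).sub (((hβ 0).mul (h 1)).add ((hβ 1).mul (h 2)))).div hN hN0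
  compact := by
    refine hc.mono' fun x hx => by_contra fun h => hx ?_
    have hz : ∀ j, pd j u x = 0 := fun j =>
      image_eq_zero_of_notMem_tsupport fun h' => h (tsupport_pd_subset u j h')
    simp [flux, e0, hz]

theorem tsupport_flux_subset (β : Fin 2 → E3 → ℝ) (N u : E3 → ℝ) :
    tsupport (flux β N u) ⊆ tsupport u := by
  refine closure_minimal (fun x hx => by_contra fun h => hx ?_) (isClosed_tsupport _)
  have hz : ∀ j, pd j u x = 0 := fun j =>
    image_eq_zero_of_notMem_tsupport fun h' => h (tsupport_pd_subset u j h')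
  simp [flux, e0, hz]

theorem abs_e0_le {β : Fin 2 → E3 → ℝ} {u : E3 → ℝ} {x : E3} {L D : ℝ} (hL : 1 ≤ L)
    (hβ : ∀ i, |β i x| ≤ L) (hu : ∀ j, |pd j u x| ≤ D) : |e0 β u x| ≤ 3 * (L * D) := by
  have hD : 0 ≤ D := (abs_nonneg _).trans (hu 0)
  have h1 : |β 0 x * pd 1 u x| ≤ L * D := by
    rw [abs_mul]
    exact mul_le_mul (hβ 0) (hu 1) (abs_nonneg _) (by linarith)
  have h2 : |β 1 x * pd 2 u x| ≤ L * D := by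
    rw [abs_mul]
    exact mul_le_mul (hβ 1) (hu 2) (abs_nonneg _) (by linarith)
  have h3 : D ≤ L * D := le_mul_of_one_le_left hD hL
  have h4 := abs_sub (pd 0 u x) (β 0 x * pd 1 u x + β 1 x * pd 2 u x)
  have h5 := abs_add_le (β 0 x * pd 1 u x) (β 1 x * pd 2 u x)
  have h6 := hu 0
  unfold e0
  linarith

theorem abs_flux_le {β : Fin 2 → E3 → ℝ} {N u : E3 → ℝ} {x : E3} {L D : ℝ} (hL : 1 ≤ L)
    (hβ : ∀ i, |β i x| ≤ L) (hN : |(N x)⁻¹| ≤ L) (hu : ∀ j, |pd j u x| ≤ D) :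
    |flux β N u x| ≤ 3 * (L * D) * L := by
  rw [flux, div_eq_mul_inv, abs_mul]
  have h := abs_e0_le hL hβ hu
  exact mul_le_mul h hN (abs_nonneg _) ((abs_nonneg _).trans h)

theorem abs_flux_sub_le {β β' : Fin 2 → E3 → ℝ} {N N' u : E3 → ℝ} {x : E3} {L D δ : ℝ}
    (hL : 1 ≤ L) (hβ' : ∀ i, |β' i x| ≤ L) (hN0 : N x ≠ 0) (hN0' : N' x ≠ 0)
    (hN : |(N x)⁻¹| ≤ L) (hN' : |(N' x)⁻¹| ≤ L) (hu : ∀ j, |pd j u x| ≤ D)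
    (hβδ : ∀ i, |β i x - β' i x| ≤ δ) (hNδ : |N x - N' x| ≤ δ) :
    |flux β N u x - flux β' N' u x| ≤ 2 * (δ * D) * L + 3 * (L * D) * (δ * L * L) := by
  have hδ : 0 ≤ δ := (abs_nonneg _).trans hNδ
  have e : flux β N u x - flux β' N' u x =
      -((β 0 x - β' 0 x) * pd 1 u x + (β 1 x - β' 1 x) * pd 2 u x) * (N x)⁻¹ -
        e0 β' u x * ((N x - N' x) * (N x)⁻¹ * (N' x)⁻¹) := by
    unfold flux e0
    field_simp
    ring
  rw [e]
  refine (abs_sub _ _).trans (add_le_add ?_ ?_)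
  · rw [abs_mul, abs_neg]
    refine mul_le_mul ((abs_add_le _ _).trans ?_) hN (abs_nonneg _) ?_
    · rw [abs_mul, abs_mul, two_mul]
      exact add_le_add (mul_le_mul (hβδ 0) (hu 1) (abs_nonneg _) hδ)
        (mul_le_mul (hβδ 1) (hu 2) (abs_nonneg _) hδ)
    · have := (abs_nonneg _).trans (hu 0)
      positivity
  · have h := abs_e0_le hL hβ' hu
    rw [abs_mul, abs_mul, abs_mul]
    exact mul_le_mul h (mul_le_mul (mul_le_mul hNδ hN (abs_nonneg _) hδ) hN' (abs_nonneg _)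
      (by positivity)) (by positivity) ((abs_nonneg _).trans h)

/-- The coefficient `e^{2γ}` localized by `η`. -/
def locExp (η γ : E3 → ℝ) (x : E3) : ℝ := η x * Real.exp (2 * γ x)

theorem C3c_locExp {η γ : E3 → ℝ} (hη : C3c η) (hγ : ContDiff ℝ 3 γ) : C3c (locExp η γ) :=
  ⟨hη.smooth.mul (Real.contDiff_exp.comp (contDiff_const.mul hγ)), hη.compact.mul_right⟩

theorem pd_locExp {η γ : E3 → ℝ} {x : E3} (hη : DifferentiableAt ℝ η x)
    (hγ : DifferentiableAt ℝ γ x) (j : Fin 3) :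
    pd j (locExp η γ) x =
      pd j η x * Real.exp (2 * γ x) + η x * (2 * pd j γ x * Real.exp (2 * γ x)) := by
  have h := (hγ.hasFDerivAt.const_mul 2).exp
  have e : pd j (fun y => Real.exp (2 * γ y)) x = 2 * pd j γ x * Real.exp (2 * γ x) := by
    unfold pd
    rw [h.fderiv]
    simp only [smul_apply, smul_eq_mul]
    ring
  rw [← e]
  exact pd_mul hη h.differentiableAt j

theorem abs_locExp_le {η γ : E3 → ℝ} {x : E3} {L : ℝ} (hη : |η x| ≤ L)
    (hγ : Real.exp (2 * γ x) ≤ L) : |locExp η γ x| ≤ L * L := by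
  rw [locExp, abs_mul, Real.abs_exp]
  exact mul_le_mul hη hγ (Real.exp_pos _).le ((abs_nonneg _).trans hη)

theorem abs_pd_locExp_le {η γ : E3 → ℝ} {x : E3} {L : ℝ} (hη : DifferentiableAt ℝ η x)
    (hγ : DifferentiableAt ℝ γ x) (j : Fin 3) (h1 : |η x| ≤ L) (h2 : |pd j η x| ≤ L)
    (h3 : Real.exp (2 * γ x) ≤ L) (h4 : |pd j γ x| ≤ L) :
    |pd j (locExp η γ) x| ≤ L * L + L * (2 * L * L) := by
  have hL : 0 ≤ L := (abs_nonneg _).trans h1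
  rw [pd_locExp hη hγ]
  refine (abs_add_le _ _).trans ?_
  simp only [abs_mul, Real.abs_exp, abs_two]
  gcongr

theorem abs_locExp_sub_le {η γ γ' : E3 → ℝ} {x : E3} {L ε : ℝ} (hη : |η x| ≤ L)
    (he : |Real.exp (2 * γ x) - Real.exp (2 * γ' x)| ≤ ε) :
    |locExp η γ x - locExp η γ' x| ≤ L * ε := by
  rw [locExp, locExp, ← mul_sub, abs_mul]
  exact mul_le_mul hη he (abs_nonneg _) ((abs_nonneg _).trans hη)

theorem abs_pd_locExp_sub_le {η γ γ' : E3 → ℝ} {x : E3} {L ε : ℝ} (hη : C3c η)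
    (hγ : ContDiff ℝ 3 γ) (hγ' : ContDiff ℝ 3 γ') (j : Fin 3) (h1 : |η x| ≤ L)
    (h2 : |pd j η x| ≤ L) (h3 : Real.exp (2 * γ x) ≤ L) (h4 : |pd j γ' x| ≤ L)
    (he : |Real.exp (2 * γ x) - Real.exp (2 * γ' x)| ≤ ε)
    (hd : |pd j (fun y => γ y - γ' y) x| ≤ ε) :
    |pd j (fun y => locExp η γ y - locExp η γ' y) x| ≤
      L * ε + L * (2 * (ε * L + L * ε)) := by
  have hL : 0 ≤ L := (abs_nonneg _).trans h1
  have dγ := hγ.differentiable (by norm_num) x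
  have dγ' := hγ'.differentiable (by norm_num) x
  have e : pd j (fun y => locExp η γ y - locExp η γ' y) x =
      pd j η x * (Real.exp (2 * γ x) - Real.exp (2 * γ' x)) +
        η x * (2 * (pd j (fun y => γ y - γ' y) x * Real.exp (2 * γ x) +
          pd j γ' x * (Real.exp (2 * γ x) - Real.exp (2 * γ' x)))) := by
    rw [pd_sub ((C3c_locExp hη hγ).differentiable x) ((C3c_locExp hη hγ').differentiable x),
      pd_locExp (hη.differentiable x) dγ, pd_locExp (hη.differentiable x) dγ', pd_sub dγ dγ']
    ring
  rw [e]
  refine (abs_add_le _ _).trans (add_le_add ?_ ?_)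
  · rw [abs_mul]
    gcongr
  · rw [abs_mul, abs_mul, abs_two]
    have h5 := abs_add_le (pd j (fun y => γ y - γ' y) x * Real.exp (2 * γ x))
      (pd j γ' x * (Real.exp (2 * γ x) - Real.exp (2 * γ' x)))
    rw [abs_mul, abs_mul, Real.abs_exp] at h5
    have h0 : 0 ≤ ε := (abs_nonneg _).trans he
    have h6 : |pd j (fun y => γ y - γ' y) x| * Real.exp (2 * γ x) ≤ ε * L := by gcongr
    have h7 : |pd j γ' x| * |Real.exp (2 * γ x) - Real.exp (2 * γ' x)| ≤ L * ε := by gcongr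
    gcongr
    linarith

theorem exists_bound_form_sub {m b : E3 → ℝ} (hm : SymbolOrder0 m) (hb : C3c b) {S : Set E3}
    (hS : IsCompact S) : ∃ C, 0 ≤ C ∧ ∀ a a' f f' : E3 → ℝ, C3c a → C3c a' → C3c f → C3c f' →
      tsupport a ⊆ S → tsupport a' ⊆ S → tsupport f ⊆ S → tsupport f' ⊆ S →
      ∀ A α F φ : ℝ, 0 < A → 0 < α → 0 < F → 0 < φ →
      (∀ x ∈ S, |a' x| ≤ A) → (∀ j, ∀ x ∈ S, |pd j a' x| ≤ A) →
      (∀ x ∈ S, |a x - a' x| ≤ α) → (∀ j, ∀ x ∈ S, |pd j (fun y => a y - a' y) x| ≤ α) →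
      (∀ x ∈ S, |f x| ≤ F) → (∀ x ∈ S, |f' x| ≤ F) → (∀ x ∈ S, |f x - f' x| ≤ φ) →
      ‖form m b a f f - form m b a' f' f'‖ ≤ C * (α * F * F + A * φ * F + A * F * φ) := by
  obtain ⟨C, hC0, hC⟩ := exists_bound_form hm hb hS
  refine ⟨C, hC0, fun a a' f f' ha ha' hf hf' sa sa' sf sf' A α F φ hA hα hF hφ b1 b2 b3 b4 b5 b6
    b7 => ?_⟩
  have ext : ∀ {u : E3 → ℝ} {D : ℝ}, 0 < D → tsupport u ⊆ S → (∀ x ∈ S, |u x| ≤ D) →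
      ∀ x, |u x| ≤ D := fun {u D} hD hu h x => by
    by_cases hx : x ∈ S
    · exact h x hx
    · rw [image_eq_zero_of_notMem_tsupport fun h' => hx (hu h'), abs_zero]
      exact hD.le
  have sub : ∀ {u v : E3 → ℝ}, tsupport u ⊆ S → tsupport v ⊆ S →
      tsupport (fun x => u x - v x) ⊆ S := fun hu hv =>
    (tsupport_sub _ _).trans (Set.union_subset hu hv)
  have spd : ∀ {u : E3 → ℝ} (j : Fin 3), tsupport u ⊆ S → tsupport (pd j u) ⊆ S := fun j hu =>
    (tsupport_pd_subset _ j).trans hu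
  have h1 := hC _ f f (ha.sub ha') hf hf (sub sa sa') sf sf α F F hα hF hF
    (ext hα (sub sa sa') b3) (fun j => ext hα (spd j (sub sa sa')) (b4 j)) (ext hF sf b5)
    (ext hF sf b5)
  have h2 := hC a' _ f ha' (hf.sub hf') hf sa' (sub sf sf') sf A φ F hA hφ hF
    (ext hA sa' b1) (fun j => ext hA (spd j sa') (b2 j)) (ext hφ (sub sf sf') b7) (ext hF sf b5)
  have h3 := hC a' f' _ ha' hf' (hf.sub hf') sa' sf' (sub sf sf') A F φ hA hF hφ
    (ext hA sa' b1) (fun j => ext hA (spd j sa') (b2 j)) (ext hF sf' b6) (ext hφ (sub sf sf') b7)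
  have e : form m b a f f - form m b a' f' f' = form m b (fun x => a x - a' x) f f +
      form m b a' (fun x => f x - f' x) f + form m b a' f' (fun x => f x - f' x) := by
    rw [form_sub_left hm hb ha ha' hf hf, form_sub_mid hm hb ha' hf hf' hf,
      form_sub_right hm hb ha' hf' hf hf']
    ring
  rw [e]
  have h4 := norm_add₃_le (a := form m b (fun x => a x - a' x) f f)
    (b := form m b a' (fun x => f x - f' x) f) (c := form m b a' f' (fun x => f x - f' x))
  linarith

theorem abs_pd_mul_le {u v : E3 → ℝ} {x : E3} {L : ℝ} (hu : DifferentiableAt ℝ u x)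
    (hv : DifferentiableAt ℝ v x) (j : Fin 3) (h1 : |u x| ≤ L) (h2 : |pd j u x| ≤ L)
    (h3 : |v x| ≤ L) (h4 : |pd j v x| ≤ L) : |pd j (fun y => u y * v y) x| ≤ L * L + L * L := by
  have hL : 0 ≤ L := (abs_nonneg _).trans h1
  rw [pd_mul hu hv]
  refine (abs_add_le _ _).trans ?_
  rw [abs_mul, abs_mul]
  gcongr

theorem tendsto_form_sub {m b χ η : E3 → ℝ} (hm : SymbolOrder0 m) (hb : C3c b) {K : Set E3}
    (hK : IsCompact K) (hχ : ContDiff ℝ 4 χ) (hχc : HasCompactSupport χ) (hχK : tsupport χ ⊆ K)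
    (hη : C3c η) (hηK : tsupport η ⊆ K) {lam : ℕ → ℝ} (hlam : ∀ n, 0 < lam n)
    (hlam0 : Tendsto lam atTop (nhds 0)) {ψ N γ : ℕ → E3 → ℝ} {β : ℕ → Fin 2 → E3 → ℝ}
    {N₀ γ₀ : E3 → ℝ} {β₀ : Fin 2 → E3 → ℝ} (hψ : ∀ n, ContDiff ℝ 4 (ψ n))
    (hN : ∀ n, ContDiff ℝ 3 (N n)) (hγ : ∀ n, ContDiff ℝ 3 (γ n))
    (hβ : ∀ n i, ContDiff ℝ 3 (β n i)) (hN₀ : ContDiff ℝ 3 N₀) (hγ₀ : ContDiff ℝ 3 γ₀)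
    (hβ₀ : ∀ i, ContDiff ℝ 3 (β₀ i)) (hNp : ∀ n x, N n x ≠ 0) (hN₀p : ∀ x, N₀ x ≠ 0) {L : ℝ}
    (hL : 1 ≤ L) (bχ : ∀ x ∈ K, |χ x| ≤ L) (bχ' : ∀ j, ∀ x ∈ K, |pd j χ x| ≤ L)
    (bη : ∀ x ∈ K, |η x| ≤ L) (bη' : ∀ j, ∀ x ∈ K, |pd j η x| ≤ L)
    (bψ : ∀ n, ∀ x ∈ K, |ψ n x| ≤ L) (bψ' : ∀ n j, ∀ x ∈ K, |pd j (ψ n) x| ≤ L)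
    (bβ : ∀ n i, ∀ x ∈ K, |β n i x| ≤ L) (bβ₀ : ∀ i, ∀ x ∈ K, |β₀ i x| ≤ L)
    (bN : ∀ n, ∀ x ∈ K, |(N n x)⁻¹| ≤ L) (bN₀ : ∀ x ∈ K, |(N₀ x)⁻¹| ≤ L)
    (bγ : ∀ n, ∀ x ∈ K, Real.exp (2 * γ n x) ≤ L) (bγ₀ : ∀ x ∈ K, Real.exp (2 * γ₀ x) ≤ L)
    (bγ₀' : ∀ j, ∀ x ∈ K, |pd j γ₀ x| ≤ L)
    (cN : ∀ n, ∀ x ∈ K, |N n x - N₀ x| ≤ L * √(lam n))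
    (cβ : ∀ n i, ∀ x ∈ K, |β n i x - β₀ i x| ≤ L * √(lam n))
    (cγ : ∀ n, ∀ x ∈ K, |Real.exp (2 * γ n x) - Real.exp (2 * γ₀ x)| ≤ L * √(lam n))
    (cγ' : ∀ n j, ∀ x ∈ K, |pd j (fun y => γ n y - γ₀ y) x| ≤ L * √(lam n)) :
    Tendsto (fun n =>
      form m b (locExp η (γ n)) (flux (β n) (N n) (fun y => χ y * ψ n y))
        (flux (β n) (N n) (fun y => χ y * ψ n y)) -
      form m b (locExp η γ₀) (flux β₀ N₀ (fun y => χ y * ψ n y))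
        (flux β₀ N₀ (fun y => χ y * ψ n y))) atTop (nhds 0) := by
  obtain ⟨C, hC0, hC⟩ := exists_bound_form_sub hm hb hK
  have hL0 : 0 < L := by linarith
  set D := L * L + L * L
  set A := L * L + L * (2 * L * L)
  set F := 3 * (L * D) * L
  set α₁ := L * L + L * (2 * (L * L + L * L))
  set φ₁ := 2 * (L * D) * L + 3 * (L * D) * (L * L * L)
  have hD0 : 0 < D := by positivity
  have lim : Tendsto (fun n => C * (α₁ * F * F + A * φ₁ * F + A * F * φ₁) * √(lam n)) atTop
      (nhds 0) := by
    have := (Real.continuous_sqrt.tendsto 0).comp hlam0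
    rw [Real.sqrt_zero] at this
    simpa using this.const_mul (C * (α₁ * F * F + A * φ₁ * F + A * F * φ₁))
  refine squeeze_zero_norm (fun n => ?_) lim
  have hε : 0 < √(lam n) := Real.sqrt_pos.2 (hlam n)
  have hu : ContDiff ℝ 4 (fun y => χ y * ψ n y) := hχ.mul (hψ n)
  have huc : HasCompactSupport (fun y => χ y * ψ n y) := hχc.mul_right
  have huK : tsupport (fun y => χ y * ψ n y) ⊆ K := tsupport_mul_subset_left.trans hχK
  have bu : ∀ j, ∀ x ∈ K, |pd j (fun y => χ y * ψ n y) x| ≤ D := fun j x hx =>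
    abs_pd_mul_le (hχ.differentiable (by norm_num) x) ((hψ n).differentiable (by norm_num) x) j
      (bχ x hx) (bχ' j x hx) (bψ n x hx) (bψ' n j x hx)
  have hl : ∀ γ : E3 → ℝ, tsupport (locExp η γ) ⊆ K := fun γ =>
    tsupport_mul_subset_left.trans hηK
  have h := hC (locExp η (γ n)) (locExp η γ₀) (flux (β n) (N n) (fun y => χ y * ψ n y))
    (flux β₀ N₀ (fun y => χ y * ψ n y)) (C3c_locExp hη (hγ n)) (C3c_locExp hη hγ₀)
    (C3c_flux (hβ n) (hN n) (hNp n) hu huc) (C3c_flux hβ₀ hN₀ hN₀p hu huc) (hl _) (hl _)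
    ((tsupport_flux_subset _ _ _).trans huK) ((tsupport_flux_subset _ _ _).trans huK)
    A (α₁ * √(lam n)) F (φ₁ * √(lam n)) (by positivity) (by positivity) (by positivity)
    (by positivity)
    (fun x hx => (abs_locExp_le (bη x hx) (bγ₀ x hx)).trans (by
      simp only [A]
      have : 0 ≤ L * (2 * L * L) := by positivity
      linarith))
    (fun j x hx => abs_pd_locExp_le (hη.differentiable x) (hγ₀.differentiable (by norm_num) x) j
      (bη x hx) (bη' j x hx) (bγ₀ x hx) (bγ₀' j x hx))
    (fun x hx => (abs_locExp_sub_le (bη x hx) (cγ n x hx)).trans (by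
      have : 0 ≤ L * (2 * (L * L + L * L)) * √(lam n) := by positivity
      linarith))
    (fun j x hx => (abs_pd_locExp_sub_le hη (hγ n) hγ₀ j (bη x hx) (bη' j x hx) (bγ n x hx)
      (bγ₀' j x hx) (cγ n x hx) (cγ' n j x hx)).trans_eq (by ring))
    (fun x hx => abs_flux_le hL (fun i => bβ n i x hx) (bN n x hx) fun j => bu j x hx)
    (fun x hx => abs_flux_le hL (fun i => bβ₀ i x hx) (bN₀ x hx) fun j => bu j x hx)
    (fun x hx => (abs_flux_sub_le hL (fun i => bβ₀ i x hx) (hNp n x) (hN₀p x) (bN n x hx)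
      (bN₀ x hx) (fun j => bu j x hx) (fun i => cβ n i x hx) (cN n x hx)).trans_eq (by ring))
  exact h.trans_eq (by ring)

/-- Proposition `prop:gamma.commute.final` of Huneau–Luk: the commutator
terms involving `∂_t` and `e^{2γ}` for the metric `gₙ` and for the limit metric `g₀` have the
same limit. -/
theorem stmt14
    (lam : ℕ → ℝ) (hlam : ∀ n, lam n ∈ Set.Ioc (0 : ℝ) 1)
    (hlam0 : Tendsto lam atTop (nhds 0))
    (χ b : E3 → ℝ)
    (hχ : ContDiff ℝ (⊤ : ℕ∞) χ) (hχc : HasCompactSupport χ)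
    (hb : ContDiff ℝ (⊤ : ℕ∞) b) (hbc : HasCompactSupport b)
    (m : E3 → ℝ) (hm : SymbolOrder0 m) (hmeven : ∀ ξ, m (-ξ) = m ξ)
    (K : Set E3) (hK : IsCompact K) (hχK : tsupport χ ⊆ interior K)
    (c : ℝ) (hc : 0 < c)
    (ψ Nn γn : ℕ → E3 → ℝ) (bn : ℕ → Fin 2 → E3 → ℝ)
    (ψ₀ N₀ γ₀ : E3 → ℝ) (b₀ : Fin 2 → E3 → ℝ)
    (hreg : ∀ n, ContDiff ℝ 4 (ψ n) ∧ ContDiff ℝ 4 (Nn n) ∧ ContDiff ℝ 4 (γn n) ∧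
      ∀ i, ContDiff ℝ 4 (bn n i))
    (hlimreg : ContDiff ℝ (⊤ : ℕ∞) ψ₀ ∧ ContDiff ℝ (⊤ : ℕ∞) N₀ ∧
      ContDiff ℝ (⊤ : ℕ∞) γ₀ ∧ ∀ i, ContDiff ℝ (⊤ : ℕ∞) (b₀ i))
    (hNpos : ∀ n x, 0 < Nn n x) (hN₀pos : ∀ x, 0 < N₀ x)
    (hNc : ∀ n, ∀ x ∈ K, c ≤ Nn n x) (hN₀c : ∀ x ∈ K, c ≤ N₀ x)
    -- O(λₙ) closeness in L^∞(K)
    (hclose : ∃ C : ℝ, ∀ n, ∀ x ∈ K,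
      |ψ n x - ψ₀ x| ≤ C * lam n ∧ |Nn n x - N₀ x| ≤ C * lam n ∧
      (∀ i, |bn n i x - b₀ i x| ≤ C * lam n) ∧ |γn n x - γ₀ x| ≤ C * lam n)
    -- O(1) bounds on first derivatives in L^∞(K)
    (hD1 : ∃ C : ℝ, ∀ n, ∀ α : Fin 3, ∀ x ∈ K,
      |pd α (ψ n) x| ≤ C ∧ |pd α (Nn n) x| ≤ C ∧
      (∀ i, |pd α (bn n i) x| ≤ C) ∧ |pd α (γn n) x| ≤ C)
    -- O(λₙ^{1/2}) bound on the full gradient of γₙ − γ₀ on K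
    (hγgrad : ∃ C : ℝ, ∀ n, ∀ α : Fin 3, ∀ x ∈ K,
      |pd α (fun y => γn n y - γ₀ y) x| ≤ C * Real.sqrt (lam n)) :
    Tendsto (fun n =>
      (∫ x : E3, ((e0 (bn n) (fun y => χ y * ψ n y) x / Nn n x : ℝ) : ℂ) *
        (pdC 0 (fun y => ((Real.exp (2 * γn n y) : ℝ) : ℂ) * (((b y : ℝ) : ℂ) *
            FMul m (fun z => e0 (bn n) (fun w => χ w * ψ n w) z / Nn n z) y)) x
          - ((b x : ℝ) : ℂ) * FMul m (fun y =>
              pd 0 (fun z => Real.exp (2 * γn n z)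
                * (e0 (bn n) (fun w => χ w * ψ n w) z / Nn n z)) y) x))
      - (∫ x : E3, ((e0 b₀ (fun y => χ y * ψ n y) x / N₀ x : ℝ) : ℂ) *
        (pdC 0 (fun y => ((Real.exp (2 * γ₀ y) : ℝ) : ℂ) * (((b y : ℝ) : ℂ) *
            FMul m (fun z => e0 b₀ (fun w => χ w * ψ n w) z / N₀ z) y)) x
          - ((b x : ℝ) : ℂ) * FMul m (fun y =>
              pd 0 (fun z => Real.exp (2 * γ₀ z)
                * (e0 b₀ (fun w => χ w * ψ n w) z / N₀ z)) y) x)))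
      atTop (nhds 0) := by
  obtain ⟨Cc, hCc⟩ := hclose
  obtain ⟨Cd, hCd⟩ := hD1
  obtain ⟨Cg, hCg⟩ := hγgrad
  obtain ⟨hψ₀, hN₀, hγ₀, hb₀⟩ := hlimreg
  obtain ⟨η, hη, hηK, hη1⟩ := exists_cutoff (isClosed_tsupport χ) hK hχK
  have hχK' : tsupport χ ⊆ K := hχK.trans interior_subset
  have top : ∀ {f : E3 → ℝ}, ContDiff ℝ (⊤ : ℕ∞) f → ContDiff ℝ 4 f := fun hf =>
    contDiff_infty.1 hf 4
  have three : ∀ {f : E3 → ℝ}, ContDiff ℝ 4 f → ContDiff ℝ 3 f := fun hf =>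
    hf.of_le (by norm_num)
  have hpd : ∀ {f : E3 → ℝ}, ContDiff ℝ 4 f → ∀ j, Continuous (pd j f) := fun hf j =>
    (ContDiff.pd (n := 3) (by exact_mod_cast hf) j).continuous
  have hbC : C3c b := ⟨three (top hb), hbc⟩
  have hsq : ∀ n, lam n ≤ √(lam n) := fun n => by
    rw [Real.le_sqrt' (hlam n).1]
    nlinarith [(hlam n).1, (hlam n).2]
  have hs1 : ∀ n, √(lam n) ≤ 1 := fun n => Real.sqrt_le_one.2 (hlam n).2
  have hclose' : ∀ {n : ℕ} {L t : ℝ}, |Cc| ≤ L → t ≤ Cc * lam n → t ≤ L * √(lam n) :=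
    fun {n L t} hL ht => ht.trans (mul_le_mul ((le_abs_self _).trans hL) (hsq n) (hlam n).1.le
      ((abs_nonneg _).trans hL))
  have hnear : ∀ {n : ℕ} {s t B : ℝ}, |s - t| ≤ Cc * lam n → |t| ≤ B → |s| ≤ B + |Cc| :=
    fun {n s t B} h ht => by
      have h1 := hclose' le_rfl h
      have h2 := mul_le_mul_of_nonneg_left (hs1 n) (abs_nonneg Cc)
      have h3 := abs_sub_abs_le_abs_sub s t
      linarith
  obtain ⟨B, ⟨⟨Bψ, Bγ⟩, Bb⟩⟩ := ((eventually_abs_le hK (top hψ₀).continuous).and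
    (eventually_abs_le hK (top hγ₀).continuous)).and
    (eventually_all.2 fun i => eventually_abs_le hK (top (hb₀ i)).continuous) |>.exists
  set Γ := B + |Cc|
  have bγn : ∀ n, ∀ x ∈ K, |γn n x| ≤ Γ := fun n x hx => hnear (hCc n x hx).2.2.2 (Bγ x hx)
  have bγ0 : ∀ x ∈ K, |γ₀ x| ≤ Γ := fun x hx =>
    (Bγ x hx).trans (le_add_of_nonneg_right (abs_nonneg _))
  obtain ⟨L, ⟨⟨⟨⟨⟨bχ, bχ'⟩, bη⟩, bη'⟩, bγ₀'⟩, hL1, hLB, hLc, hLd, hLg, hLN, hLe, hLe'⟩⟩ :=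
    ((((eventually_abs_le hK hχ.continuous).and
      (eventually_all.2 fun j => eventually_abs_le hK (hpd (top hχ) j))).and
      (eventually_abs_le hK hη.continuous)).and
      (eventually_all.2 fun j => eventually_abs_le hK (hη.contDiff_pd j).continuous)).and
      (eventually_all.2 fun j => eventually_abs_le hK (hpd (top hγ₀) j)) |>.and
      ((eventually_ge_atTop 1).and <| (eventually_ge_atTop (B + |Cc|)).and <|
        (eventually_ge_atTop |Cc|).and <| (eventually_ge_atTop Cd).and <|
        (eventually_ge_atTop Cg).and <| (eventually_ge_atTop c⁻¹).and <|
        (eventually_ge_atTop (Real.exp (2 * Γ))).and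
        (eventually_ge_atTop (2 * Real.exp (2 * Γ) * |Cc|))) |>.exists
  have binv : ∀ {t : ℝ}, c ≤ t → |t⁻¹| ≤ L := fun {t} ht => by
    rw [abs_of_pos (inv_pos.2 (hc.trans_le ht))]
    exact (inv_anti₀ hc ht).trans hLN
  have bexp : ∀ {t : ℝ}, |t| ≤ Γ → Real.exp (2 * t) ≤ L := fun {t} ht => by
    refine le_trans (Real.exp_le_exp.2 ?_) hLe
    linarith [(abs_le.1 ht).2]
  have key := tendsto_form_sub (m := m) (b := b) (χ := χ) (η := η) hm hbC hK (top hχ) hχc hχK' hη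
    hηK (fun n => (hlam n).1) hlam0 (ψ := ψ) (N := Nn) (γ := γn) (β := bn) (N₀ := N₀) (γ₀ := γ₀)
    (β₀ := b₀) (fun n => (hreg n).1) (fun n => three (hreg n).2.1)
    (fun n => three (hreg n).2.2.1) (fun n i => three ((hreg n).2.2.2 i)) (three (top hN₀))
    (three (top hγ₀)) (fun i => three (top (hb₀ i))) (fun n x => (hNpos n x).ne')
    (fun x => (hN₀pos x).ne') hL1 bχ bχ' bη bη'
    (fun n x hx => (hnear (hCc n x hx).1 (Bψ x hx)).trans hLB)
    (fun n j x hx => (hCd n j x hx).1.trans hLd)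
    (fun n i x hx => (hnear ((hCc n x hx).2.2.1 i) (Bb i x hx)).trans hLB)
    (fun i x hx => (Bb i x hx).trans ((le_add_of_nonneg_right (abs_nonneg _)).trans hLB))
    (fun n x hx => binv (hNc n x hx)) (fun x hx => binv (hN₀c x hx))
    (fun n x hx => bexp (bγn n x hx)) (fun x hx => bexp (bγ0 x hx)) bγ₀'
    (fun n x hx => hclose' hLc (hCc n x hx).2.1)
    (fun n i x hx => hclose' hLc ((hCc n x hx).2.2.1 i))
    (fun n x hx => by
      refine (abs_exp_sub_exp_le (bγn n x hx) (bγ0 x hx)).trans ?_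
      have h := mul_le_mul_of_nonneg_left (hclose' le_rfl (hCc n x hx).2.2.2)
        (by positivity : 0 ≤ 2 * Real.exp (2 * Γ))
      have h' := mul_le_mul_of_nonneg_right hLe' (Real.sqrt_nonneg (lam n))
      linarith)
    (fun n j x hx => (hCg n j x hx).trans (by gcongr))
  have hloc : ∀ γ : E3 → ℝ, ∀ x ∈ tsupport χ,
      (fun y => Real.exp (2 * γ y)) =ᶠ[nhds x] locExp η γ := fun γ x hx => by
    filter_upwards [hη1 x hx] with y hy
    rw [locExp, hy, one_mul]
  have hu : ∀ n, ContDiff ℝ 4 (fun y => χ y * ψ n y) := fun n => (top hχ).mul (hreg n).1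
  have hF : ∀ n {β : Fin 2 → E3 → ℝ} {N : E3 → ℝ}, (∀ i, ContDiff ℝ 4 (β i)) → ContDiff ℝ 4 N →
      (∀ x, 0 < N x) → C3c (flux β N (fun y => χ y * ψ n y)) := fun n _ _ hβ hN h0 =>
    C3c_flux (fun i => three (hβ i)) (three hN) (fun x => (h0 x).ne') (hu n) hχc.mul_right
  have hsupp : ∀ n (β : Fin 2 → E3 → ℝ) (N : E3 → ℝ),
      tsupport (flux β N (fun y => χ y * ψ n y)) ⊆ tsupport χ := fun n β N =>
    (tsupport_flux_subset β N _).trans tsupport_mul_subset_left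
  refine key.congr fun n => ?_
  have hFn := hF n (hreg n).2.2.2 (hreg n).2.1 (hNpos n)
  have hGn := hF n (fun i => top (hb₀ i)) (top hN₀) hN₀pos
  rw [← integral_commutator_eq_form hm hbC (C3c_locExp hη (three (hreg n).2.2.1)) hFn hFn
      (hsupp n _ _) (hsupp n _ _) (hloc (γn n)),
    ← integral_commutator_eq_form hm hbC (C3c_locExp hη (three (top hγ₀))) hGn hGn
      (hsupp n _ _) (hsupp n _ _) (hloc γ₀)]
  rfl

end
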